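/- Let N ≥ 2, α ∈ (0,2) with α < N, Ω ⊂ ℝ^N a bounded open set and f a bounded continuous function on Ω. Let w be a classical solution of the extension problem on C_Ω with data f and v a classical solution of the extension problem on C_{Ω^#} with data f^#, radially symmetric and radially nonincreasing in x for each y ≥ 0. Then for every y ∈ [0,∞), sup_{x∈Ω} |w(x,y)| ≤ sup_{x∈Ω^#} |v(x,y)| = v(0,y). -/

import Mathlib

open MeasureTheory Filter Set

noncomputable section

abbrev Euc (N : ℕ) := EuclideanSpace ℝ (Fin N)

/-- Decreasing rearrangement of `g` on `E`:
`g*(s) = sup {t ≥ 0 : |{x ∈ E : |g x| > t}| > s}`. -/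
def rearr {N : ℕ} (E : Set (Euc N)) (g : Euc N → ℝ) (s : ℝ) : ℝ :=
  sSup {t : ℝ | 0 ≤ t ∧ ENNReal.ofReal s < volume {x | x ∈ E ∧ t < |g x|}}

/-- Measure of the unit ball of `ℝ^N`. -/
def omegaN (N : ℕ) : ℝ := (volume (Metric.ball (0 : Euc N) 1)).toReal

/-- Radius of the ball centered at the origin with the same measure as `Ω`. -/
def ballRad {N : ℕ} (Ω : Set (Euc N)) : ℝ := ((volume Ω).toReal / omegaN N) ^ ((N : ℝ)⁻¹)

/-- `Ω^#`: the ball centered at the origin with the same measure as `Ω`. -/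
def symmBall {N : ℕ} (Ω : Set (Euc N)) : Set (Euc N) := Metric.ball 0 (ballRad Ω)

/-- Schwarz rearrangement `f^#(x) = f*(ω_N |x|^N)`. -/
def schwarz {N : ℕ} (Ω : Set (Euc N)) (f : Euc N → ℝ) (x : Euc N) : ℝ :=
  rearr Ω f (omegaN N * ‖x‖ ^ N)

/-- `κ_α = 2^{1-α} Γ(1-α/2) / Γ(α/2)`. -/
def kappa (α : ℝ) : ℝ := (2 : ℝ) ^ (1 - α) * Real.Gamma (1 - α / 2) / Real.Gamma (α / 2)

/-- Laplacian of `w` with respect to the `x` variables. -/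
def lapx {N : ℕ} (w : Euc N → ℝ → ℝ) (x : Euc N) (y : ℝ) : ℝ :=
  ∑ i : Fin N, deriv (deriv fun t : ℝ => w (x + t • EuclideanSpace.single i (1 : ℝ)) y) 0

/-- A classical solution of the extension problem on `C_Ω = Ω × (0,∞)` with data `f`:
continuous and bounded up to the boundary, smooth with bounded derivatives up to
order two inside, satisfying the extension PDE, vanishing on the lateral boundary,
decaying uniformly as `y → ∞`, and with the Neumann data `f`. -/
structure IsExtSol {N : ℕ} (α : ℝ) (Ω : Set (Euc N)) (f : Euc N → ℝ)
    (w : Euc N → ℝ → ℝ) : Prop where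
  cont : ContinuousOn (fun p : Euc N × ℝ => w p.1 p.2) (closure (Ω ×ˢ Ioi (0 : ℝ)))
  bdd : ∃ M : ℝ, ∀ p ∈ closure (Ω ×ˢ Ioi (0 : ℝ)), |w (Prod.fst p) p.2| ≤ M
  smooth : ContDiffOn ℝ 2 (fun p : Euc N × ℝ => w p.1 p.2) (Ω ×ˢ Ioi (0 : ℝ))
  derivBdd : ∃ M : ℝ, ∀ p ∈ Ω ×ˢ Ioi (0 : ℝ),
    ‖fderiv ℝ (fun q : Euc N × ℝ => w q.1 q.2) p‖ ≤ M ∧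
    ‖fderiv ℝ (fderiv ℝ fun q : Euc N × ℝ => w q.1 q.2) p‖ ≤ M
  pde : ∀ x ∈ Ω, ∀ y ∈ Ioi (0 : ℝ),
    lapx w x y + ((1 - α) / y) * deriv (w x) y + deriv (deriv (w x)) y = 0
  lateral : ∀ x ∈ frontier Ω, ∀ y ∈ Ici (0 : ℝ), w x y = 0
  decay : ∀ ε > (0 : ℝ), ∃ Y : ℝ, ∀ y ≥ Y, ∀ x ∈ Ω, |w x y| ≤ ε
  neumann : ∀ x ∈ Ω,
    Tendsto (fun y : ℝ => y ^ (1 - α) * deriv (w x) y) (nhdsWithin 0 (Ioi 0))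
      (nhds (-(kappa α) * f x))

/-- `v` is radially symmetric and radially nonincreasing in `x` for each `y ≥ 0`. -/
def RadialDecr {N : ℕ} (v : Euc N → ℝ → ℝ) : Prop :=
  ∀ y : ℝ, 0 ≤ y → ∀ x x' : Euc N, ‖x‖ ≤ ‖x'‖ → v x' y ≤ v x y

open scoped ENNReal

/-- Reflection of `ℝ^N` across the hyperplane `⟪x, n⟫ = r`, for a unit vector `n`. -/
def hypRefl {N : ℕ} (n : Euc N) (r : ℝ) (x : Euc N) : Euc N := x - (2 * (inner ℝ x n - r)) • n

lemma inner_hypRefl {N : ℕ} {n : Euc N} (hn : ‖n‖ = 1) (r : ℝ) (x : Euc N) :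
    inner ℝ (hypRefl n r x) n = 2 * r - inner ℝ x n := by
  simp only [hypRefl, inner_sub_left, inner_smul_left, real_inner_self_eq_norm_sq, hn]
  simp; ring

lemma hypRefl_hypRefl {N : ℕ} {n : Euc N} (hn : ‖n‖ = 1) (r : ℝ) (x : Euc N) :
    hypRefl n r (hypRefl n r x) = x := by
  rw [hypRefl, inner_hypRefl hn, hypRefl, sub_sub, ← add_smul]
  ring_nf; simp

lemma continuous_hypRefl {N : ℕ} (n : Euc N) (r : ℝ) : Continuous (hypRefl n r) := by
  unfold hypRefl; fun_prop

lemma measurePreserving_hypRefl {N : ℕ} {n : Euc N} (hn : ‖n‖ = 1) (r : ℝ) :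
    MeasurePreserving (hypRefl n r) := by
  have h1 : MeasurePreserving (Submodule.reflection (Submodule.span ℝ {n})ᗮ)
      (volume : Measure (Euc N)) volume := LinearIsometryEquiv.measurePreserving _
  have h2 := measurePreserving_add_right (volume : Measure (Euc N)) ((2 * r) • n)
  suffices h : hypRefl n r =
      (fun x => x + (2 * r) • n) ∘ (Submodule.reflection (Submodule.span ℝ {n})ᗮ) by
    rw [h]; exact h2.comp h1
  funext x
  change hypRefl n r x = (Submodule.reflection (Submodule.span ℝ {n})ᗮ) x + (2 * r) • n
  rw [hypRefl, Submodule.reflection_orthogonal_apply, Submodule.reflection_singleton_apply, hn,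
    real_inner_comm x n, mul_sub, sub_smul]
  simp [two_smul, add_smul, two_mul]
  abel

lemma dist_sq_hypRefl {N : ℕ} {n : Euc N} (hn : ‖n‖ = 1) (r : ℝ) (x z : Euc N) :
    dist x (hypRefl n r z) ^ 2 =
      dist x z ^ 2 + 4 * ((r - inner ℝ x n) * (r - inner ℝ z n)) := by
  rw [dist_eq_norm, dist_eq_norm, hypRefl, sub_sub_eq_add_sub, add_sub_right_comm,
    norm_add_sq_real, norm_smul, inner_smul_right, inner_sub_left, hn, mul_pow, Real.norm_eq_abs,
    sq_abs]
  ring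

lemma dist_hypRefl_hypRefl {N : ℕ} {n : Euc N} (hn : ‖n‖ = 1) (r : ℝ) (x z : Euc N) :
    dist (hypRefl n r x) (hypRefl n r z) = dist x z := by
  rw [← sq_eq_sq₀ dist_nonneg dist_nonneg, dist_sq_hypRefl hn, dist_comm _ z, dist_sq_hypRefl hn,
    inner_hypRefl hn, dist_comm z x]
  ring

lemma dist_hypRefl_comm {N : ℕ} {n : Euc N} (hn : ‖n‖ = 1) (r : ℝ) (x z : Euc N) :
    dist (hypRefl n r x) z = dist x (hypRefl n r z) := by
  conv_lhs => rw [← hypRefl_hypRefl hn r z]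
  exact dist_hypRefl_hypRefl hn r _ _

lemma dist_le_dist_hypRefl {N : ℕ} {n : Euc N} (hn : ‖n‖ = 1) {r : ℝ} {x z : Euc N}
    (h : 0 ≤ (r - inner ℝ x n) * (r - inner ℝ z n)) : dist x z ≤ dist x (hypRefl n r z) := by
  rw [← sq_le_sq₀ dist_nonneg dist_nonneg, dist_sq_hypRefl hn]
  linarith

lemma norm_le_norm_hypRefl {N : ℕ} {n : Euc N} (hn : ‖n‖ = 1) {r : ℝ} (hr : 0 ≤ r) {x : Euc N}
    (h : inner ℝ x n ≤ r) : ‖x‖ ≤ ‖hypRefl n r x‖ := by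
  have := dist_le_dist_hypRefl hn (r := r) (x := 0) (z := x) (by
    simpa using mul_nonneg hr (sub_nonneg.2 h))
  simpa using this

lemma norm_hypRefl_le_norm {N : ℕ} {n : Euc N} (hn : ‖n‖ = 1) {r : ℝ} (hr : 0 ≤ r) {x : Euc N}
    (h : r < inner ℝ x n) : ‖hypRefl n r x‖ ≤ ‖x‖ := by
  have := norm_le_norm_hypRefl hn hr (x := hypRefl n r x) (by rw [inner_hypRefl hn]; linarith)
  rwa [hypRefl_hypRefl hn] at this

/-- The reflection exchanging `x` and `z`, where `‖z‖ < ‖x‖`. -/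
lemma exists_hypRefl_eq {N : ℕ} {x z : Euc N} (h : ‖z‖ < ‖x‖) :
    ∃ n : Euc N, ‖n‖ = 1 ∧ ∃ r : ℝ, 0 < r ∧ r ≤ ‖x‖ ∧ hypRefl n r x = z := by
  have hne : x - z ≠ 0 := by
    intro h0; rw [sub_eq_zero] at h0; simp [h0] at h
  have hd : 0 < ‖x - z‖ := norm_pos_iff.2 hne
  have hsq : ‖x - z‖ ^ 2 = ‖x‖ ^ 2 - 2 * inner ℝ x z + ‖z‖ ^ 2 := norm_sub_sq_real x z
  refine ⟨‖x - z‖⁻¹ • (x - z), by rw [norm_smul, norm_inv, norm_norm, inv_mul_cancel₀ hd.ne'],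
    (‖x‖ ^ 2 - ‖z‖ ^ 2) / (2 * ‖x - z‖), ?_, ?_, ?_⟩
  · have := norm_nonneg z
    exact div_pos (by nlinarith) (by linarith)
  · rw [div_le_iff₀ (by linarith)]
    have h1 : ‖x‖ - ‖z‖ ≤ ‖x - z‖ := norm_sub_norm_le x z
    have := norm_nonneg z
    nlinarith
  · rw [hypRefl, inner_smul_right, inner_sub_right, real_inner_self_eq_norm_sq, smul_smul]
    have : 2 * (‖x - z‖⁻¹ * (‖x‖ ^ 2 - inner ℝ x z) - (‖x‖ ^ 2 - ‖z‖ ^ 2) / (2 * ‖x - z‖)) *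
        ‖x - z‖⁻¹ = 1 := by
      field_simp
      linarith
    rw [this, one_smul, sub_sub_cancel]

open Classical in
/-- For a measure preserving involution, the measure of a set is half the integral of the number
of points of each pair `{p, g p}` lying in the set. -/
lemma lintegral_ite_add_ite_comp {X : Type*} [MeasurableSpace X] {μ : Measure X} {g : X → X}
    (hg : MeasurePreserving g μ μ) {S : Set X} (hS : MeasurableSet S) :
    ∫⁻ p, (((if p ∈ S then 1 else 0) + (if g p ∈ S then 1 else 0) : ℕ) : ℝ≥0∞) ∂μ = 2 * μ S := by
  have e1 : ∀ p, ((if p ∈ S then 1 else 0 : ℕ) : ℝ≥0∞) = S.indicator 1 p := by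
    intro p; by_cases h : p ∈ S <;> simp [h]
  simp_rw [Nat.cast_add, e1]
  have hm : Measurable (S.indicator (1 : X → ℝ≥0∞)) := measurable_one.indicator hS
  rw [lintegral_add_left hm, hg.lintegral_comp hm, lintegral_indicator_one hS, two_mul]

/-- Polarization of a set with respect to the half-space `⟪x, n⟫ ≤ r`. -/
def polarize {N : ℕ} (n : Euc N) (r : ℝ) (A : Set (Euc N)) : Set (Euc N) :=
  {x | (inner ℝ x n ≤ r ∧ (x ∈ A ∨ hypRefl n r x ∈ A)) ∨
    (r < inner ℝ x n ∧ x ∈ A ∧ hypRefl n r x ∈ A)}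

lemma measurableSet_polarize {N : ℕ} (n : Euc N) (r : ℝ) {A : Set (Euc N)}
    (hA : MeasurableSet A) : MeasurableSet (polarize n r A) := by
  have h1 : MeasurableSet {x : Euc N | inner ℝ x n ≤ r} :=
    measurableSet_le (by fun_prop) measurable_const
  have h2 : MeasurableSet {x : Euc N | r < inner ℝ x n} :=
    measurableSet_lt measurable_const (by fun_prop)
  have h3 : MeasurableSet (hypRefl n r ⁻¹' A) := (continuous_hypRefl n r).measurable hA
  exact (h1.inter (hA.union h3)).union (h2.inter (hA.inter h3))

lemma mem_polarize_of_le {N : ℕ} {n : Euc N} {r : ℝ} {A : Set (Euc N)} {x : Euc N}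
    (h : inner ℝ x n ≤ r) : x ∈ polarize n r A ↔ x ∈ A ∨ hypRefl n r x ∈ A := by
  simp [polarize, h, not_lt.2 h]

lemma mem_polarize_of_lt {N : ℕ} {n : Euc N} {r : ℝ} {A : Set (Euc N)} {x : Euc N}
    (h : r < inner ℝ x n) : x ∈ polarize n r A ↔ x ∈ A ∧ hypRefl n r x ∈ A := by
  simp [polarize, h, not_le.2 h]

lemma hypRefl_eq_self {N : ℕ} {n : Euc N} {r : ℝ} {x : Euc N} (h : inner ℝ x n = r) :
    hypRefl n r x = x := by
  simp [hypRefl, h]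

lemma hypRefl_mem_polarize_of_le {N : ℕ} {n : Euc N} (hn : ‖n‖ = 1) {r : ℝ} {A : Set (Euc N)}
    {x : Euc N} (h : inner ℝ x n ≤ r) :
    hypRefl n r x ∈ polarize n r A ↔ x ∈ A ∧ hypRefl n r x ∈ A := by
  rcases h.eq_or_lt with h | h
  · rw [hypRefl_eq_self h, mem_polarize_of_le h.le, hypRefl_eq_self h, or_self, and_self]
  rw [mem_polarize_of_lt (by rw [inner_hypRefl hn]; linarith), hypRefl_hypRefl hn, and_comm]

lemma hypRefl_mem_polarize_of_gt {N : ℕ} {n : Euc N} (hn : ‖n‖ = 1) {r : ℝ} {A : Set (Euc N)}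
    {x : Euc N} (h : r < inner ℝ x n) :
    hypRefl n r x ∈ polarize n r A ↔ x ∈ A ∨ hypRefl n r x ∈ A := by
  rw [mem_polarize_of_le (by rw [inner_hypRefl hn]; linarith), hypRefl_hypRefl hn, or_comm]

lemma volume_polarize {N : ℕ} {n : Euc N} (hn : ‖n‖ = 1) (r : ℝ) {A : Set (Euc N)}
    (hA : MeasurableSet A) : volume (polarize n r A) = volume A := by
  classical
  have h := lintegral_ite_add_ite_comp (measurePreserving_hypRefl hn r)
    (measurableSet_polarize n r hA)
  have h' := lintegral_ite_add_ite_comp (measurePreserving_hypRefl hn r) hA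
  refine (ENNReal.mul_right_inj two_ne_zero ENNReal.ofNat_ne_top).1 ?_
  rw [← h, ← h']
  refine lintegral_congr fun x => ?_
  congr 1
  rcases le_or_gt (inner ℝ x n) r with hx | hx
  · rw [mem_polarize_of_le hx, hypRefl_mem_polarize_of_le hn hx]
    by_cases h1 : x ∈ A <;> by_cases h2 : hypRefl n r x ∈ A <;> simp [h1, h2]
  · rw [mem_polarize_of_lt hx, hypRefl_mem_polarize_of_gt hn hx]
    by_cases h1 : x ∈ A <;> by_cases h2 : hypRefl n r x ∈ A <;> simp [h1, h2]

lemma polarize_subset_ball {N : ℕ} {n : Euc N} (hn : ‖n‖ = 1) {r : ℝ} (hr : 0 ≤ r)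
    {A : Set (Euc N)} {R : ℝ} (hA : A ⊆ Metric.ball 0 R) :
    polarize n r A ⊆ Metric.ball 0 R := by
  intro x hx
  rcases hx with ⟨h, h1 | h1⟩ | ⟨h, h1, h2⟩
  · exact hA h1
  · have := hA h1
    rw [mem_ball_zero_iff] at this ⊢
    exact (norm_le_norm_hypRefl hn hr h).trans_lt this
  · exact hA h1

lemma volume_polarize_inter_ball {N : ℕ} {n : Euc N} (hn : ‖n‖ = 1) {r : ℝ} (hr : 0 ≤ r)
    {A : Set (Euc N)} (hA : MeasurableSet A) (ρ : ℝ) :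
    volume (A ∩ Metric.ball 0 ρ) +
      volume ((A \ Metric.ball 0 ρ) ∩ hypRefl n r ⁻¹' (Metric.ball 0 ρ \ A)) ≤
    volume (polarize n r A ∩ Metric.ball 0 ρ) := by
  classical
  set B : Set (Euc N) := Metric.ball 0 ρ with hB
  have hBm : MeasurableSet B := measurableSet_ball
  have hTm : MeasurableSet ((A \ B) ∩ hypRefl n r ⁻¹' (B \ A)) :=
    (hA.diff hBm).inter ((continuous_hypRefl n r).measurable (hBm.diff hA))
  have hσ := measurePreserving_hypRefl hn r
  have h1 := lintegral_ite_add_ite_comp hσ (hA.inter hBm)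
  have h2 := lintegral_ite_add_ite_comp hσ hTm
  have h3 := lintegral_ite_add_ite_comp hσ ((measurableSet_polarize n r hA).inter hBm)
  refine (ENNReal.mul_le_mul_iff_right two_ne_zero ENNReal.ofNat_ne_top).1 ?_
  have hm : ∀ {S : Set (Euc N)}, MeasurableSet S → Measurable fun x =>
      (((if x ∈ S then 1 else 0) + (if hypRefl n r x ∈ S then 1 else 0) : ℕ) : ℝ≥0∞) := by
    intro S hS
    refine (measurable_from_top (f := fun k : ℕ => (k : ℝ≥0∞))).comp ?_
    exact (Measurable.ite hS measurable_const measurable_const).add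
      (Measurable.ite (hσ.measurable hS) measurable_const measurable_const)
  rw [mul_add, ← h1, ← h2, ← h3, ← lintegral_add_left (hm (hA.inter hBm))]
  refine lintegral_mono fun x => ?_
  dsimp only
  rw [← Nat.cast_add, Nat.cast_le]
  simp only [mem_inter_iff, Set.mem_sdiff, mem_preimage, hypRefl_hypRefl hn]
  rcases le_or_gt (inner ℝ x n) r with hx | hx
  · have hb : hypRefl n r x ∈ B → x ∈ B := by
      simp only [hB, mem_ball_zero_iff]
      exact (norm_le_norm_hypRefl hn hr hx).trans_lt
    rw [mem_polarize_of_le hx, hypRefl_mem_polarize_of_le hn hx]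
    by_cases h1 : x ∈ A <;> by_cases h2 : hypRefl n r x ∈ A <;> by_cases h3 : x ∈ B <;>
      by_cases h4 : hypRefl n r x ∈ B <;> simp [h1, h2, h3, h4] <;> exact h3 (hb h4)
  · have hb : x ∈ B → hypRefl n r x ∈ B := by
      simp only [hB, mem_ball_zero_iff]
      exact (norm_hypRefl_le_norm hn hr hx).trans_lt
    rw [mem_polarize_of_lt hx, hypRefl_mem_polarize_of_gt hn hx]
    by_cases h1 : x ∈ A <;> by_cases h2 : hypRefl n r x ∈ A <;> by_cases h3 : x ∈ B <;>
      by_cases h4 : hypRefl n r x ∈ B <;> simp [h1, h2, h3, h4] <;> exact h4 (hb h3)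

/-- The set of pairs of `A × B` at distance less than `h`. -/
def closePairs {N : ℕ} (h : ℝ) (A B : Set (Euc N)) : Set (Euc N × Euc N) :=
  {p | p.1 ∈ A ∧ p.2 ∈ B ∧ dist p.1 p.2 < h}

lemma measurableSet_closePairs {N : ℕ} (h : ℝ) {A B : Set (Euc N)} (hA : MeasurableSet A)
    (hB : MeasurableSet B) : MeasurableSet (closePairs h A B) :=
  (measurable_fst hA).inter ((measurable_snd hB).inter
    (isOpen_lt continuous_dist continuous_const).measurableSet)

open Classical in
lemma lintegral_ite_four {X : Type*} [MeasurableSpace X] {μ : Measure X} {g k : X → X}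
    (hg : MeasurePreserving g μ μ) (hk : MeasurePreserving k μ μ) {S : Set X}
    (hS : MeasurableSet S) :
    ∫⁻ p, (((if p ∈ S then 1 else 0) + (if g p ∈ S then 1 else 0) +
      ((if k p ∈ S then 1 else 0) + (if g (k p) ∈ S then 1 else 0)) : ℕ) : ℝ≥0∞) ∂μ =
    4 * μ S := by
  have hm : Measurable fun p =>
      (((if p ∈ S then 1 else 0) + (if g p ∈ S then 1 else 0) : ℕ) : ℝ≥0∞) := by
    refine (measurable_from_top (f := fun k : ℕ => (k : ℝ≥0∞))).comp ?_
    exact (Measurable.ite hS measurable_const measurable_const).add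
      (Measurable.ite (hg.measurable hS) measurable_const measurable_const)
  have h := lintegral_ite_add_ite_comp hg hS
  have h' := hk.lintegral_comp hm
  simp_rw [fun p => Nat.cast_add (R := ℝ≥0∞)
    ((if p ∈ S then 1 else 0) + (if g p ∈ S then 1 else 0))
    ((if k p ∈ S then 1 else 0) + (if g (k p) ∈ S then 1 else 0))]
  rw [lintegral_add_left hm, h, h', h, ← add_mul]
  norm_num

/-- Polarization does not decrease the measure of the set of close pairs. -/
lemma volume_closePairs_le_polarize {N : ℕ} {n : Euc N} (hn : ‖n‖ = 1) (r h : ℝ)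
    {A B : Set (Euc N)} (hA : MeasurableSet A) (hB : MeasurableSet B) :
    volume (closePairs h A B) ≤ volume (closePairs h (polarize n r A) (polarize n r B)) := by
  classical
  have hσ := measurePreserving_hypRefl hn r
  have hid := MeasurePreserving.id (volume : Measure (Euc N))
  have hg : MeasurePreserving (Prod.map (hypRefl n r) (id : Euc N → Euc N)) := hσ.prod hid
  have hk : MeasurePreserving (Prod.map (id : Euc N → Euc N) (hypRefl n r)) := hid.prod hσ
  have h1 := lintegral_ite_four hg hk (measurableSet_closePairs h hA hB)
  have h2 := lintegral_ite_four hg hk (measurableSet_closePairs h (measurableSet_polarize n r hA)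
    (measurableSet_polarize n r hB))
  refine (ENNReal.mul_le_mul_iff_right four_ne_zero ENNReal.ofNat_ne_top).1 ?_
  rw [← h1, ← h2]
  refine lintegral_mono fun p => ?_
  obtain ⟨x, z⟩ := p
  dsimp only
  rw [Nat.cast_le]
  simp only [closePairs, mem_ofPred_eq, Prod.map, id, dist_hypRefl_hypRefl hn,
    dist_hypRefl_comm hn]
  have hle : 0 ≤ (r - inner ℝ x n) * (r - inner ℝ z n) →
      dist x (hypRefl n r z) < h → dist x z < h :=
    fun h0 => (dist_le_dist_hypRefl hn h0).trans_lt
  have hge : (r - inner ℝ x n) * (r - inner ℝ z n) ≤ 0 →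
      dist x z < h → dist x (hypRefl n r z) < h := by
    intro h0
    have := dist_le_dist_hypRefl hn (r := r) (x := x) (z := hypRefl n r z)
      (by rw [inner_hypRefl hn]; linarith)
    rw [hypRefl_hypRefl hn] at this
    exact this.trans_lt
  rcases le_or_gt (inner ℝ x n) r with hx | hx <;> rcases le_or_gt (inner ℝ z n) r with hz | hz
  · have hPQ := hle (mul_nonneg (sub_nonneg.2 hx) (sub_nonneg.2 hz))
    simp only [mem_polarize_of_le hx, hypRefl_mem_polarize_of_le hn hx,
      mem_polarize_of_le hz, hypRefl_mem_polarize_of_le hn hz]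
    by_cases h1 : x ∈ A <;> by_cases h2 : hypRefl n r x ∈ A <;> by_cases h3 : z ∈ B <;>
      by_cases h4 : hypRefl n r z ∈ B <;> by_cases h5 : dist x z < h <;>
      by_cases h6 : dist x (hypRefl n r z) < h <;>
      first
        | exact absurd (hPQ ‹_›) ‹_›
        | simp only [h1, h2, h3, h4, h5, h6]; simp
  · have hPQ := hge (mul_nonpos_of_nonneg_of_nonpos (sub_nonneg.2 hx) (sub_nonpos.2 hz.le))
    simp only [mem_polarize_of_le hx, hypRefl_mem_polarize_of_le hn hx,
      mem_polarize_of_lt hz, hypRefl_mem_polarize_of_gt hn hz]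
    by_cases h1 : x ∈ A <;> by_cases h2 : hypRefl n r x ∈ A <;> by_cases h3 : z ∈ B <;>
      by_cases h4 : hypRefl n r z ∈ B <;> by_cases h5 : dist x z < h <;>
      by_cases h6 : dist x (hypRefl n r z) < h <;>
      first
        | exact absurd (hPQ ‹_›) ‹_›
        | simp only [h1, h2, h3, h4, h5, h6]; simp
  · have hPQ := hge (mul_nonpos_of_nonpos_of_nonneg (sub_nonpos.2 hx.le) (sub_nonneg.2 hz))
    simp only [mem_polarize_of_lt hx, hypRefl_mem_polarize_of_gt hn hx,
      mem_polarize_of_le hz, hypRefl_mem_polarize_of_le hn hz]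
    by_cases h1 : x ∈ A <;> by_cases h2 : hypRefl n r x ∈ A <;> by_cases h3 : z ∈ B <;>
      by_cases h4 : hypRefl n r z ∈ B <;> by_cases h5 : dist x z < h <;>
      by_cases h6 : dist x (hypRefl n r z) < h <;>
      first
        | exact absurd (hPQ ‹_›) ‹_›
        | simp only [h1, h2, h3, h4, h5, h6]; simp
  · have hPQ := hle (mul_nonneg_of_nonpos_of_nonpos (sub_nonpos.2 hx.le) (sub_nonpos.2 hz.le))
    simp only [mem_polarize_of_lt hx, hypRefl_mem_polarize_of_gt hn hx,
      mem_polarize_of_lt hz, hypRefl_mem_polarize_of_gt hn hz]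
    by_cases h1 : x ∈ A <;> by_cases h2 : hypRefl n r x ∈ A <;> by_cases h3 : z ∈ B <;>
      by_cases h4 : hypRefl n r z ∈ B <;> by_cases h5 : dist x z < h <;>
      by_cases h6 : dist x (hypRefl n r z) < h <;>
      first
        | exact absurd (hPQ ‹_›) ‹_›
        | simp only [h1, h2, h3, h4, h5, h6]; simp

/-- The reflection of `x` in the hyperplane with normal `p / ‖p‖` at distance `‖p‖ - 1`. -/
def paramRefl {N : ℕ} (x p : Euc N) : Euc N := hypRefl (‖p‖⁻¹ • p) (‖p‖ - 1) x

lemma norm_normalize_sub_le {N : ℕ} {p q : Euc N} (hp : 1 ≤ ‖p‖) (hq : 1 ≤ ‖q‖) :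
    ‖‖p‖⁻¹ • p - ‖q‖⁻¹ • q‖ ≤ 2 * ‖p - q‖ := by
  have hp0 : 0 < ‖p‖ := by linarith
  have hq0 : 0 < ‖q‖ := by linarith
  have e : ‖p‖⁻¹ • p - ‖q‖⁻¹ • q = ‖p‖⁻¹ • (p - q) + (‖p‖⁻¹ * (‖q‖ - ‖p‖)) • (‖q‖⁻¹ • q) := by
    rw [smul_sub, smul_smul, sub_add, ← sub_smul]
    congr 2
    field_simp
    ring
  have h1 : ‖p‖⁻¹ ≤ 1 := inv_le_one_of_one_le₀ hp
  have h2 : ‖‖q‖⁻¹ • q‖ = 1 := by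
    rw [norm_smul, norm_inv, norm_norm]; field_simp
  have h3 : |‖q‖ - ‖p‖| ≤ ‖p - q‖ := by rw [norm_sub_rev]; exact abs_norm_sub_norm_le q p
  rw [e]
  refine (norm_add_le _ _).trans ?_
  rw [norm_smul, norm_smul, h2, norm_mul, norm_inv, norm_norm, Real.norm_eq_abs]
  have h4 : 0 ≤ ‖p‖⁻¹ := by positivity
  nlinarith [norm_nonneg (p - q), abs_nonneg (‖q‖ - ‖p‖),
    mul_le_mul h1 h3 (abs_nonneg _) zero_le_one,
      mul_le_mul_of_nonneg_right h1 (norm_nonneg (p - q))]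

/-- The parameters of all hyperplanes meeting the closed ball of radius `R`. -/
def reflParams (N : ℕ) (R : ℝ) : Set (Euc N) := {p | 1 ≤ ‖p‖ ∧ ‖p‖ ≤ 1 + R}

lemma measurableSet_reflParams (N : ℕ) (R : ℝ) : MeasurableSet (reflParams N R) :=
  ((isClosed_le continuous_const continuous_norm).inter
    (isClosed_le continuous_norm continuous_const)).measurableSet

lemma volume_reflParams_lt_top (N : ℕ) (R : ℝ) :
    (volume : Measure (Euc N)) (reflParams N R) < ⊤ := by
  refine (measure_mono (t := Metric.closedBall 0 (1 + R)) ?_).trans_lt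
    measure_closedBall_lt_top
  intro p hp
  simpa using hp.2

lemma lipschitzOnWith_paramRefl {N : ℕ} {R : ℝ} (hR : 0 ≤ R) {x : Euc N} (hx : ‖x‖ ≤ R) :
    LipschitzOnWith (Real.toNNReal (12 * R + 2)) (paramRefl x) (reflParams N R) := by
  refine LipschitzOnWith.of_dist_le_mul fun p hp q hq => ?_
  rw [Real.coe_toNNReal _ (by linarith), dist_eq_norm, dist_eq_norm]
  have hn := norm_normalize_sub_le hp.1 hq.1
  have h3 : |‖p‖ - ‖q‖| ≤ ‖p - q‖ := abs_norm_sub_norm_le p q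
  have unit : ∀ p : Euc N, 1 ≤ ‖p‖ → ‖‖p‖⁻¹ • p‖ = 1 := fun p hp => by
    rw [norm_smul, norm_inv, norm_norm]; field_simp
  have hpu := unit p hp.1
  have hqu := unit q hq.1
  unfold paramRefl hypRefl
  set n := ‖p‖⁻¹ • p
  set m := ‖q‖⁻¹ • q
  have e : (x - (2 * (inner ℝ x n - (‖p‖ - 1))) • n) - (x - (2 * (inner ℝ x m - (‖q‖ - 1))) • m)
     = -((2 * (inner ℝ x (n - m) - (‖p‖ - ‖q‖))) • n
        + (2 * (inner ℝ x m - (‖q‖ - 1))) • (n - m)) := by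
    rw [inner_sub_right]; module
  rw [e, norm_neg]
  refine (norm_add_le _ _).trans ?_
  rw [norm_smul _ n, norm_smul _ (n - m), hpu, norm_mul, norm_mul]
  simp only [Real.norm_eq_abs, abs_two]
  have i1 : |inner ℝ x (n - m)| ≤ R * (2 * ‖p - q‖) :=
    (abs_real_inner_le_norm _ _).trans (mul_le_mul hx hn (norm_nonneg _) hR)
  have i2 : |inner ℝ x m| ≤ R := by
    have := abs_real_inner_le_norm x m
    rw [hqu] at this; linarith
  have i3 : |inner ℝ x (n - m) - (‖p‖ - ‖q‖)| ≤ R * (2 * ‖p - q‖) + ‖p - q‖ :=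
    (abs_sub _ _).trans (add_le_add i1 h3)
  have i4 : |inner ℝ x m - (‖q‖ - 1)| ≤ 2 * R := by
    have := abs_le.1 i2
    have h1 := hq.1
    have h2 := hq.2
    rw [abs_le]; constructor <;> linarith
  have i5 := mul_le_mul i4 hn (norm_nonneg _) (by linarith)
  nlinarith

lemma volume_image_le_of_lipschitzOnWith {N : ℕ} {K : NNReal} {F : Euc N → Euc N}
    {s : Set (Euc N)} (hF : LipschitzOnWith K F s) :
    volume (F '' s) ≤ (K : ℝ≥0∞) ^ N * volume s := by
  have h := hF.hausdorffMeasure_image_le (d := (N : ℝ)) (by positivity)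
  rw [← EuclideanSpace.euclideanHausdorffMeasure_eq_volume]
  simp only [Measure.euclideanHausdorffMeasure_def, Measure.smul_apply]
  rw [ENNReal.rpow_natCast] at h
  rw [mul_smul_comm]
  gcongr

lemma volume_le_volume_paramRefl {N : ℕ} {R : ℝ} (hR : 0 ≤ R) {x : Euc N} (hx : ‖x‖ ≤ R)
    {ρ : ℝ} (hρ : ρ ≤ ‖x‖) {Q : Set (Euc N)} (hQ : Q ⊆ Metric.ball 0 ρ) :
    volume Q ≤ (Real.toNNReal (12 * R + 2) : ℝ≥0∞) ^ N *
      volume (reflParams N R ∩ paramRefl x ⁻¹' Q) := by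
  refine (measure_mono ?_).trans (volume_image_le_of_lipschitzOnWith
    ((lipschitzOnWith_paramRefl hR hx).mono inter_subset_left))
  intro z hz
  have hz' : ‖z‖ < ‖x‖ := by have := hQ hz; simp at this; linarith
  obtain ⟨n, hn, r, hr, hrx, h⟩ := exists_hypRefl_eq hz'
  have hnorm : ‖(1 + r) • n‖ = 1 + r := by
    rw [norm_smul, hn, Real.norm_of_nonneg (by linarith), mul_one]
  have key : paramRefl x ((1 + r) • n) = z := by
    unfold paramRefl
    rw [hnorm, smul_smul, inv_mul_cancel₀ (by linarith), one_smul, add_sub_cancel_left, h]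
  refine ⟨(1 + r) • n, ⟨⟨by rw [hnorm]; linarith, by rw [hnorm]; linarith⟩, ?_⟩, key⟩
  rw [mem_preimage, key]; exact hz

lemma measurable_paramRefl {N : ℕ} :
    Measurable fun q : Euc N × Euc N => paramRefl q.2 q.1 := by
  unfold paramRefl hypRefl
  have h1 : Measurable fun q : Euc N × Euc N => ‖q.1‖ := measurable_fst.norm
  have h2 : Measurable fun q : Euc N × Euc N => ‖q.1‖⁻¹ • q.1 := h1.inv.smul measurable_fst
  exact measurable_snd.sub (((measurable_snd.inner h2).sub (h1.sub measurable_const)).const_mul 2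
    |>.smul h2)

lemma volume_mul_volume_le_lintegral {N : ℕ} {R : ℝ} (hR : 0 ≤ R) {ρ : ℝ}
    {P Q : Set (Euc N)} (hPm : MeasurableSet P) (hQm : MeasurableSet Q)
    (hP : P ⊆ Metric.ball 0 R \ Metric.ball 0 ρ) (hQ : Q ⊆ Metric.ball 0 ρ) :
    volume P * volume Q ≤ (Real.toNNReal (12 * R + 2) : ℝ≥0∞) ^ N *
      ∫⁻ p in reflParams N R,
        volume (P ∩ hypRefl (‖p‖⁻¹ • p) (‖p‖ - 1) ⁻¹' Q) := by
  let T : Set (Euc N × Euc N) := {q | q.2 ∈ P ∧ paramRefl q.2 q.1 ∈ Q}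
  have hT : MeasurableSet T := (measurable_snd hPm).inter (measurable_paramRefl hQm)
  have e1 : ∫⁻ p in reflParams N R, volume (P ∩ hypRefl (‖p‖⁻¹ • p) (‖p‖ - 1) ⁻¹' Q)
      = ((volume.restrict (reflParams N R)).prod volume) T := by
    rw [Measure.prod_apply hT]; rfl
  rw [e1, Measure.prod_apply_symm hT]
  have e2 : volume P * volume Q = ∫⁻ x in P, volume Q := by
    rw [setLIntegral_const, mul_comm]
  rw [e2, ← lintegral_const_mul' _ _ (by finiteness), ← lintegral_indicator hPm]
  refine lintegral_mono fun x => ?_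
  by_cases hx : x ∈ P
  · rw [indicator_of_mem hx]
    have h1 := (hP hx).1
    have h2 := (hP hx).2
    simp at h1 h2
    refine (volume_le_volume_paramRefl hR h1.le h2 hQ).trans ?_
    refine mul_le_mul_right ?_ _
    rw [Measure.restrict_apply (measurable_prodMk_right hT)]
    refine measure_mono fun p hp => ⟨⟨hx, hp.2⟩, hp.1⟩
  · rw [indicator_of_notMem hx]; exact zero_le

lemma volume_polarize_diff_ball {N : ℕ} {n : Euc N} (hn : ‖n‖ = 1) {r : ℝ} (hr : 0 ≤ r)
    {A : Set (Euc N)} (hA : MeasurableSet A) (hAf : volume A ≠ ⊤) (ρ : ℝ) :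
    volume (polarize n r A \ Metric.ball 0 ρ) +
      volume ((A \ Metric.ball 0 ρ) ∩ hypRefl n r ⁻¹' (Metric.ball 0 ρ \ A)) ≤
    volume (A \ Metric.ball 0 ρ) := by
  have h1 := volume_polarize_inter_ball hn hr hA ρ
  have h2 := volume_polarize hn r hA
  rw [← measure_inter_add_sdiff (polarize n r A)
    (Metric.isOpen_ball (x := (0 : Euc N)) (ε := ρ)).measurableSet,
    ← measure_inter_add_sdiff A
      (Metric.isOpen_ball (x := (0 : Euc N)) (ε := ρ)).measurableSet] at h2
  have hI : volume (A ∩ Metric.ball 0 ρ) ≠ ⊤ := measure_ne_top_of_subset inter_subset_left hAf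
  refine (ENNReal.add_le_add_iff_left hI).1 ?_
  rw [← h2, add_left_comm, add_comm]
  gcongr

lemma volume_ball_diff_eq {N : ℕ} {A : Set (Euc N)} (hA : MeasurableSet A) (hAf : volume A ≠ ⊤)
    {ρ : ℝ} (hρ : volume (Metric.ball (0 : Euc N) ρ) = volume A) :
    volume (Metric.ball (0 : Euc N) ρ \ A) = volume (A \ Metric.ball 0 ρ) := by
  have h1 := measure_inter_add_sdiff A
    (Metric.isOpen_ball (x := (0 : Euc N)) (ε := ρ)).measurableSet (μ := volume)
  have h2 := measure_inter_add_sdiff (Metric.ball (0 : Euc N) ρ) hA (μ := volume)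
  rw [inter_comm] at h2
  have hI : volume (A ∩ Metric.ball 0 ρ) ≠ ⊤ := measure_ne_top_of_subset inter_subset_left hAf
  refine (ENNReal.add_right_inj hI).1 ?_
  rw [h1, h2, hρ]

/-- If no polarization brings the total excess of `A` and `B` over their symmetrizations below `m`,
then that excess is quadratically close to `m`. -/
lemma excess_sq_le {N : ℕ} {R : ℝ} (hR : 0 ≤ R) {A B : Set (Euc N)} (hA : MeasurableSet A)
    (hB : MeasurableSet B) (hAR : A ⊆ Metric.ball 0 R) (hBR : B ⊆ Metric.ball 0 R) {a b : ℝ}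
    (ha : volume (Metric.ball (0 : Euc N) a) = volume A)
    (hb : volume (Metric.ball (0 : Euc N) b) = volume B) {m : ℝ≥0∞}
    (hm : ∀ n : Euc N, ‖n‖ = 1 → ∀ r : ℝ, 0 ≤ r →
      m ≤ volume (polarize n r A \ Metric.ball 0 a) + volume (polarize n r B \ Metric.ball 0 b)) :
    volume (A \ Metric.ball 0 a) * volume (A \ Metric.ball 0 a) +
      volume (B \ Metric.ball 0 b) * volume (B \ Metric.ball 0 b) ≤
    (Real.toNNReal (12 * R + 2) : ℝ≥0∞) ^ N *
      ((volume (A \ Metric.ball 0 a) + volume (B \ Metric.ball 0 b) - m) *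
        volume (reflParams N R)) := by
  have hAf : volume A ≠ ⊤ := measure_ne_top_of_subset hAR measure_ball_lt_top.ne
  have hBf : volume B ≠ ⊤ := measure_ne_top_of_subset hBR measure_ball_lt_top.ne
  have bm : ∀ ρ : ℝ, MeasurableSet (Metric.ball (0 : Euc N) ρ) :=
    fun ρ => Metric.isOpen_ball.measurableSet
  have kA := volume_mul_volume_le_lintegral hR (hA.diff (bm a)) ((bm a).diff hA)
    (fun x hx => ⟨hAR hx.1, hx.2⟩) sdiff_subset
  have kB := volume_mul_volume_le_lintegral hR (hB.diff (bm b)) ((bm b).diff hB)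
    (fun x hx => ⟨hBR hx.1, hx.2⟩) sdiff_subset
  rw [volume_ball_diff_eq hA hAf ha] at kA
  rw [volume_ball_diff_eq hB hBf hb] at kB
  refine (add_le_add kA kB).trans ?_
  rw [← mul_add]
  refine mul_le_mul_right ?_ _
  rw [← lintegral_add_left]
  · rw [← setLIntegral_const]
    refine setLIntegral_mono' (measurableSet_reflParams N R) fun p hp => ?_
    have hn : ‖‖p‖⁻¹ • p‖ = 1 := by
      have := hp.1
      rw [norm_smul, norm_inv, norm_norm]; field_simp
    have hr : 0 ≤ ‖p‖ - 1 := by linarith [hp.1]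
    have h1 := volume_polarize_diff_ball hn hr hA hAf a
    have h2 := volume_polarize_diff_ball hn hr hB hBf b
    have h3 := hm _ hn _ hr
    refine ENNReal.le_sub_of_add_le_left ?_ ?_
    · refine ne_top_of_le_ne_top ?_ (h3.trans
      (add_le_add (le_self_add.trans h1) (le_self_add.trans h2)))
      exact ENNReal.add_ne_top.2 ⟨measure_ne_top_of_subset sdiff_subset hAf,
        measure_ne_top_of_subset sdiff_subset hBf⟩
    · refine (add_le_add_left h3 _).trans ((le_of_eq ?_).trans (add_le_add h1 h2))
      abel
  · have := measurable_measure_prodMk_left (ν := (volume : Measure (Euc N)))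
      (((measurable_snd (hA.diff (bm a))).inter (measurable_paramRefl ((bm a).diff hA))))
    exact this

lemma volume_closePairs_le_of_diff {N : ℕ} (h : ℝ) {A B A' B' : Set (Euc N)}
    (hA : MeasurableSet A) (hB : MeasurableSet B) (hA' : MeasurableSet A')
    (hB' : MeasurableSet B') :
    volume (closePairs h A B) ≤ volume (closePairs h A' B') +
      (volume (A \ A') + volume (B \ B')) * volume (Metric.ball (0 : Euc N) h) := by
  have h1 : volume (closePairs h (A \ A') univ) =
      volume (A \ A') * volume (Metric.ball (0 : Euc N) h) := by
    rw [Measure.volume_eq_prod, Measure.prod_apply (measurableSet_closePairs h (hA.diff hA') .univ),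
      mul_comm, ← setLIntegral_const, ← lintegral_indicator (hA.diff hA')]
    refine lintegral_congr fun x => ?_
    by_cases hx : x ∈ A \ A'
    · rw [indicator_of_mem hx, ← Measure.addHaar_ball_center volume x]
      congr 1; ext z; simp [closePairs, hx.1, hx.2, dist_comm]
    · rw [indicator_of_notMem hx]
      convert measure_empty (μ := volume)
      ext z; simp only [closePairs, mem_preimage, mem_ofPred_eq, hx, false_and, mem_empty_iff_false]
  have h2 : volume (closePairs h univ (B \ B')) =
      volume (B \ B') * volume (Metric.ball (0 : Euc N) h) := by
    rw [Measure.volume_eq_prod, Measure.prod_apply_symm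
      (measurableSet_closePairs h .univ (hB.diff hB')),
      mul_comm, ← setLIntegral_const, ← lintegral_indicator (hB.diff hB')]
    refine lintegral_congr fun x => ?_
    by_cases hx : x ∈ B \ B'
    · rw [indicator_of_mem hx, ← Measure.addHaar_ball_center volume x]
      congr 1; ext z; simp [closePairs, hx.1, hx.2]
    · rw [indicator_of_notMem hx]
      convert measure_empty (μ := volume)
      ext z; simp only [closePairs, mem_preimage, mem_ofPred_eq, hx,
        false_and, and_false, mem_empty_iff_false]
  rw [add_mul, ← h1, ← h2]
  refine (measure_mono ?_).trans ((measure_union_le _ _).trans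
    (add_le_add_right (measure_union_le _ _) _))
  rintro ⟨x, z⟩ ⟨hx, hz, hd⟩
  by_cases h3 : x ∈ A'
  · by_cases h4 : z ∈ B'
    · exact Or.inl ⟨h3, h4, hd⟩
    · exact Or.inr (Or.inr ⟨trivial, ⟨hz, h4⟩, hd⟩)
  · exact Or.inr (Or.inl ⟨⟨hx, h3⟩, trivial, hd⟩)

/-- Riesz's rearrangement inequality for the kernel `1_{|x-z|<h}` and indicator functions. -/
lemma volume_closePairs_le_ball {N : ℕ} (h : ℝ) {A B : Set (Euc N)} (hA : MeasurableSet A)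
    (hB : MeasurableSet B) (hAb : Bornology.IsBounded A) (hBb : Bornology.IsBounded B) {a b : ℝ}
    (ha : volume (Metric.ball (0 : Euc N) a) = volume A)
    (hb : volume (Metric.ball (0 : Euc N) b) = volume B) :
    volume (closePairs h A B) ≤
      volume (closePairs h (Metric.ball (0 : Euc N) a) (Metric.ball 0 b)) := by
  obtain ⟨R, hAR⟩ : ∃ R : ℝ, 0 ≤ R ∧ A ⊆ Metric.ball 0 R ∧ B ⊆ Metric.ball 0 R := by
    obtain ⟨R, hR⟩ := (hAb.union hBb).subset_ball 0
    exact ⟨max R 0, le_max_right _ _, fun x hx =>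
      Metric.ball_subset_ball (le_max_left _ _) (hR (Or.inl hx)),
      fun x hx => Metric.ball_subset_ball (le_max_left _ _) (hR (Or.inr hx))⟩
  obtain ⟨hR, hAR, hBR⟩ := hAR
  have bm : ∀ ρ : ℝ, MeasurableSet (Metric.ball (0 : Euc N) ρ) :=
    fun ρ => Metric.isOpen_ball.measurableSet
  let good : Set (Euc N) → Set (Euc N) → Prop := fun A' B' =>
    MeasurableSet A' ∧ MeasurableSet B' ∧ A' ⊆ Metric.ball 0 R ∧ B' ⊆ Metric.ball 0 R ∧
    volume (Metric.ball (0 : Euc N) a) = volume A' ∧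
    volume (Metric.ball (0 : Euc N) b) = volume B' ∧
    volume (closePairs h A B) ≤ volume (closePairs h A' B')
  let D : Set (Euc N) → Set (Euc N) → ℝ≥0∞ := fun A' B' =>
    volume (A' \ Metric.ball 0 a) + volume (B' \ Metric.ball 0 b)
  let m : ℝ≥0∞ := sInf {d | ∃ A' B', good A' B' ∧ d = D A' B'}
  have hmle : ∀ A' B', good A' B' → m ≤ D A' B' := fun A' B' hg => sInf_le ⟨A', B', hg, rfl⟩
  have hgood : good A B := ⟨hA, hB, hAR, hBR, ha, hb, le_rfl⟩
  have hfin : ∀ A' B', good A' B' → D A' B' ≠ ⊤ := by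
    intro A' B' hg
    exact ENNReal.add_ne_top.2
      ⟨measure_ne_top_of_subset (sdiff_subset.trans hg.2.2.1) measure_ball_lt_top.ne,
        measure_ne_top_of_subset (sdiff_subset.trans hg.2.2.2.1) measure_ball_lt_top.ne⟩
  have hmf : m ≠ ⊤ := ne_top_of_le_ne_top (hfin _ _ hgood) (hmle _ _ hgood)
  have happrox : ∀ ε : ℝ≥0∞, ε ≠ 0 → ∃ A' B', good A' B' ∧ D A' B' < m + ε := by
    intro ε hε
    have : m < m + ε := ENNReal.lt_add_right hmf hε
    obtain ⟨d, ⟨A', B', hg, rfl⟩, hd⟩ := sInf_lt_iff.1 this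
    exact ⟨A', B', hg, hd⟩
  let C : ℝ≥0∞ := 2 * ((Real.toNNReal (12 * R + 2) : ℝ≥0∞) ^ N * volume (reflParams N R))
  have hC : C ≠ ⊤ := by
    have := (volume_reflParams_lt_top N R).ne
    finiteness
  have hsq : ∀ A' B', good A' B' → D A' B' * D A' B' ≤ C * (D A' B' - m) := by
    intro A' B' hg
    obtain ⟨g1, g2, g3, g4, g5, g6, g7⟩ := hg
    have key := excess_sq_le hR g1 g2 g3 g4 g5 g6 (m := m) (fun n hn r hr => by
      refine hmle _ _ ⟨measurableSet_polarize n r g1, measurableSet_polarize n r g2,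
        polarize_subset_ball hn hr g3, polarize_subset_ball hn hr g4, ?_, ?_, ?_⟩
      · rw [volume_polarize hn r g1, g5]
      · rw [volume_polarize hn r g2, g6]
      · exact g7.trans (volume_closePairs_le_polarize hn r h g1 g2))
    have f1 : volume (A' \ Metric.ball 0 a) ≠ ⊤ :=
      measure_ne_top_of_subset (sdiff_subset.trans g3) measure_ball_lt_top.ne
    have f2 : volume (B' \ Metric.ball 0 b) ≠ ⊤ :=
      measure_ne_top_of_subset (sdiff_subset.trans g4) measure_ball_lt_top.ne
    have e : C * (D A' B' - m) = 2 * ((Real.toNNReal (12 * R + 2) : ℝ≥0∞) ^ N *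
      ((D A' B' - m) * volume (reflParams N R))) := by simp only [C]; ring
    rw [e]
    refine le_trans ?_ (mul_le_mul_right key 2)
    simp only [D]
    lift volume (A' \ Metric.ball 0 a) to NNReal using f1 with s
    lift volume (B' \ Metric.ball 0 b) to NNReal using f2 with t
    norm_cast
    rw [← NNReal.coe_le_coe]; push_cast
    nlinarith [sq_nonneg ((s : ℝ) - t)]
  have hm0 : m = 0 := by
    by_contra hne
    have hpos : 0 < m * m / (C + 1) := ENNReal.div_pos (mul_ne_zero hne hne) (by finiteness)
    obtain ⟨A', B', hg, hd⟩ := happrox _ hpos.ne'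
    have h1 := hsq A' B' hg
    have h2 : m * m ≤ C * (D A' B' - m) := (mul_le_mul' (hmle _ _ hg) (hmle _ _ hg)).trans h1
    have h3 : D A' B' - m ≤ m * m / (C + 1) := by
      rw [tsub_le_iff_left]; exact hd.le
    have h4 : m * m ≤ C * (m * m / (C + 1)) := h2.trans (mul_le_mul_right h3 _)
    have hmm : m * m ≠ ⊤ := ENNReal.mul_ne_top hmf hmf
    have h5 : C * (m * m / (C + 1)) < (C + 1) * (m * m / (C + 1)) := by
      refine (ENNReal.mul_lt_mul_iff_left hpos.ne' ?_).2 (ENNReal.lt_add_right hC one_ne_zero)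
      exact ENNReal.div_ne_top hmm (by simp)
    rw [ENNReal.mul_div_cancel (by simp) (by finiteness)] at h5
    exact absurd h4 (not_le.2 h5)
  refine ENNReal.le_of_forall_pos_le_add fun ε hε _ => ?_
  have hV : volume (Metric.ball (0 : Euc N) h) ≠ ⊤ := measure_ball_lt_top.ne
  obtain ⟨A', B', hg, hd⟩ := happrox (ε / (volume (Metric.ball (0 : Euc N) h) + 1))
    (ENNReal.div_pos (by exact_mod_cast hε.ne') (by finiteness)).ne'
  rw [hm0, zero_add] at hd
  refine hg.2.2.2.2.2.2.trans ((volume_closePairs_le_of_diff h hg.1 hg.2.1 (bm a) (bm b)).trans ?_)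
  refine add_le_add_right ?_ _
  refine (mul_le_mul' hd.le (le_self_add (b := 1))).trans ?_
  rw [ENNReal.div_mul_cancel (by simp) (by finiteness)]

lemma omegaN_pos (N : ℕ) : 0 < omegaN N :=
  ENNReal.toReal_pos (Metric.measure_ball_pos volume _ one_pos).ne' measure_ball_lt_top.ne

lemma ballRad_nonneg {N : ℕ} (A : Set (Euc N)) : 0 ≤ ballRad A :=
  Real.rpow_nonneg (div_nonneg ENNReal.toReal_nonneg (omegaN_pos N).le) _

lemma volume_ball_eq_ofReal {N : ℕ} [Nontrivial (Euc N)] (x : Euc N) {r : ℝ} (hr : 0 ≤ r) :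
    volume (Metric.ball x r) = ENNReal.ofReal (omegaN N * r ^ N) := by
  rw [Measure.addHaar_ball volume x hr, finrank_euclideanSpace, Fintype.card_fin,
    ENNReal.ofReal_mul (omegaN_pos N).le, mul_comm, omegaN,
    ENNReal.ofReal_toReal measure_ball_lt_top.ne]

lemma volume_ball_ballRad {N : ℕ} [Nontrivial (Euc N)] {A : Set (Euc N)} (hA : volume A ≠ ⊤) :
    volume (Metric.ball (0 : Euc N) (ballRad A)) = volume A := by
  have hN : N ≠ 0 := by
    rintro rfl
    exact not_subsingleton (Euc 0) inferInstance
  rw [volume_ball_eq_ofReal _ (ballRad_nonneg A), ballRad, Real.rpow_inv_natCast_pow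
    (div_nonneg ENNReal.toReal_nonneg (omegaN_pos N).le) hN,
    mul_div_cancel₀ _ (omegaN_pos N).ne', ENNReal.ofReal_toReal hA]

lemma ae_eq_ball_of_radial {N : ℕ} [Nontrivial (Euc N)] {S : Set (Euc N)} {R : ℝ} (hR : 0 ≤ R)
    (hS : S ⊆ Metric.closedBall 0 R) (h : ∀ x ∈ S, ∀ z : Euc N, ‖z‖ < ‖x‖ → z ∈ S) :
    ∃ ρ ∈ Icc 0 R, S =ᵐ[volume] Metric.ball (0 : Euc N) ρ := by
  have hb : BddAbove (norm '' S) := by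
    refine ⟨R, ?_⟩; rintro _ ⟨x, hx, rfl⟩; simpa using hS hx
  refine ⟨sSup (norm '' S), ⟨Real.sSup_nonneg ?_, Real.sSup_le ?_ hR⟩, ?_⟩
  · rintro _ ⟨x, hx, rfl⟩; exact norm_nonneg x
  · rintro _ ⟨x, hx, rfl⟩; simpa using hS hx
  have h1 : Metric.ball (0 : Euc N) (sSup (norm '' S)) ⊆ S := by
    intro z hz
    have hz' : ‖z‖ < sSup (norm '' S) := by simpa using hz
    rcases S.eq_empty_or_nonempty with rfl | hne
    · simp at hz'; exact absurd hz' (not_lt.2 (norm_nonneg z))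
    obtain ⟨_, ⟨x, hx, rfl⟩, hlt⟩ := exists_lt_of_lt_csSup (hne.image _) hz'
    exact h x hx z hlt
  have h2 : S ⊆ Metric.closedBall (0 : Euc N) (sSup (norm '' S)) := by
    intro x hx
    simpa using le_csSup hb ⟨x, hx, rfl⟩
  refine (ae_eq_of_subset_of_measure_ge h1 ?_ Metric.isOpen_ball.measurableSet.nullMeasurableSet
    (measure_ne_top_of_subset h2 measure_closedBall_lt_top.ne)).symm
  rw [← Measure.addHaar_closedBall_eq_addHaar_ball]
  exact measure_mono h2

lemma volume_ball_inter_ball_anti {N : ℕ} (r h : ℝ) {x z : Euc N} (hxz : ‖z‖ < ‖x‖) :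
    volume (Metric.ball 0 r ∩ Metric.ball x h) ≤ volume (Metric.ball 0 r ∩ Metric.ball z h) := by
  classical
  obtain ⟨n, hn, s, hs, -, rfl⟩ := exists_hypRefl_eq hxz
  have hx : s ≤ inner ℝ x n := by
    by_contra hlt
    exact absurd (norm_le_norm_hypRefl hn hs.le (not_le.1 hlt).le) (not_le.2 hxz)
  have hm : ∀ y : Euc N, MeasurableSet (Metric.ball 0 r ∩ Metric.ball y h) := fun y =>
    (Metric.isOpen_ball.inter Metric.isOpen_ball).measurableSet
  have key : 2 * volume (Metric.ball 0 r ∩ Metric.ball x h) ≤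
      2 * volume (Metric.ball 0 r ∩ Metric.ball (hypRefl n s x) h) := by
    rw [← lintegral_ite_add_ite_comp (measurePreserving_hypRefl hn s) (hm _),
      ← lintegral_ite_add_ite_comp (measurePreserving_hypRefl hn s) (hm _)]
    refine lintegral_mono fun p => ?_
    norm_cast
    have hz : inner ℝ (hypRefl n s x) n = 2 * s - inner ℝ x n := inner_hypRefl hn s x
    set S := Metric.ball (0 : Euc N) r ∩ Metric.ball x h with hS
    set T := Metric.ball (0 : Euc N) r ∩ Metric.ball (hypRefl n s x) h with hT
    have d1 : dist (hypRefl n s p) (hypRefl n s x) = dist p x := dist_hypRefl_hypRefl hn s p x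
    have d2 : dist (hypRefl n s p) x = dist p (hypRefl n s x) := dist_hypRefl_comm hn s p x
    rcases le_or_gt (inner ℝ p n) s with hp | hp
    · have n1 := norm_le_norm_hypRefl hn hs.le hp
      have d3 : dist p (hypRefl n s x) ≤ dist p x := by
        have := dist_le_dist_hypRefl hn (r := s) (x := p) (z := hypRefl n s x)
          (mul_nonneg (by linarith) (by linarith))
        rwa [hypRefl_hypRefl hn] at this
      have a1 : p ∈ S → p ∈ T := fun h => ⟨h.1, d3.trans_lt h.2⟩
      have a2 : hypRefl n s p ∈ S → p ∈ T := fun h => by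
        refine ⟨?_, ?_⟩
        · have := h.1; simp at this ⊢; linarith
        · have := h.2; rw [Metric.mem_ball, d2] at this; exact this
      have a3 : p ∈ S → hypRefl n s p ∈ S → hypRefl n s p ∈ T := fun h h' => by
        refine ⟨h'.1, ?_⟩
        rw [Metric.mem_ball, d1]; exact h.2
      clear_value S T
      by_cases c1 : p ∈ S <;> by_cases c2 : hypRefl n s p ∈ S <;>
        by_cases c3 : p ∈ T <;> by_cases c4 : hypRefl n s p ∈ T <;> simp [c1, c2, c3, c4] <;>
        tauto
    · have n1 := norm_hypRefl_le_norm hn hs.le hp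
      have d3 : dist p x ≤ dist p (hypRefl n s x) := 
        dist_le_dist_hypRefl hn (mul_nonneg_of_nonpos_of_nonpos (by linarith) (by linarith))
      have a1 : p ∈ S → hypRefl n s p ∈ T := fun h => by
        refine ⟨?_, ?_⟩
        · have := h.1; simp at this ⊢; linarith
        · rw [Metric.mem_ball, d1]; exact h.2
      have a2 : hypRefl n s p ∈ S → hypRefl n s p ∈ T := fun h => by
        refine ⟨h.1, ?_⟩
        have := h.2
        rw [Metric.mem_ball, d2] at this
        rw [Metric.mem_ball, d1]; linarith
      have a3 : p ∈ S → hypRefl n s p ∈ S → p ∈ T := fun h h' => by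
        refine ⟨h.1, ?_⟩
        have := h'.2
        rw [Metric.mem_ball, d2] at this
        exact this
      clear_value S T
      by_cases c1 : p ∈ S <;> by_cases c2 : hypRefl n s p ∈ S <;>
        by_cases c3 : p ∈ T <;> by_cases c4 : hypRefl n s p ∈ T <;> simp [c1, c2, c3, c4] <;>
        tauto
  exact (ENNReal.mul_le_mul_iff_right (by simp) (by simp)).1 key

lemma lintegral_lintegral_ball {N : ℕ} (h : ℝ) {A : Set (Euc N)} (hA : MeasurableSet A)
    {g : Euc N → ℝ≥0∞} (hg : Measurable g) :
    ∫⁻ p in closePairs h A univ, g p.2 = ∫⁻ x in A, ∫⁻ z in Metric.ball x h, g z := by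
  have hc := measurableSet_closePairs h hA (B := univ) .univ
  have hgi : Measurable ((closePairs h A univ).indicator fun p : Euc N × Euc N => g p.2) :=
    (hg.comp measurable_snd).indicator hc
  rw [← lintegral_indicator hc, Measure.volume_eq_prod, lintegral_prod _ hgi.aemeasurable,
    ← lintegral_indicator hA]
  refine lintegral_congr fun x => ?_
  by_cases hx : x ∈ A
  · rw [indicator_of_mem hx, ← lintegral_indicator Metric.isOpen_ball.measurableSet]
    refine lintegral_congr fun z => ?_
    by_cases hz : z ∈ Metric.ball x h
    · rw [indicator_of_mem hz, indicator_of_mem]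
      exact ⟨hx, trivial, by rw [dist_comm]; exact hz⟩
    · rw [indicator_of_notMem hz, indicator_of_notMem]
      rintro ⟨-, -, h3⟩
      exact hz (by rw [Metric.mem_ball, dist_comm]; exact h3)
  · rw [indicator_of_notMem hx]
    refine (lintegral_congr fun z => ?_).trans lintegral_zero
    exact indicator_of_notMem (fun h => hx h.1) _

lemma lintegral_lintegral_ball' {N : ℕ} (h : ℝ) {A : Set (Euc N)} (hA : MeasurableSet A)
    {g : Euc N → ℝ≥0∞} (hg : Measurable g) :
    ∫⁻ p in closePairs h A univ, g p.2 = ∫⁻ z, volume (A ∩ Metric.ball z h) * g z := by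
  have hc := measurableSet_closePairs h hA (B := univ) .univ
  have hgi : Measurable ((closePairs h A univ).indicator fun p : Euc N × Euc N => g p.2) :=
    (hg.comp measurable_snd).indicator hc
  rw [← lintegral_indicator hc, Measure.volume_eq_prod, lintegral_prod_symm _ hgi.aemeasurable]
  refine lintegral_congr fun z => ?_
  have hm : MeasurableSet (A ∩ Metric.ball z h) := hA.inter Metric.isOpen_ball.measurableSet
  rw [mul_comm, ← setLIntegral_const, ← lintegral_indicator hm]
  refine lintegral_congr fun x => ?_
  by_cases hx : x ∈ A ∩ Metric.ball z h
  · rw [indicator_of_mem hx, indicator_of_mem]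
    exact ⟨hx.1, trivial, hx.2⟩
  · rw [indicator_of_notMem hx, indicator_of_notMem]
    exact fun h => hx ⟨h.1, h.2.2⟩

/-- The integral of the decreasing rearrangement of `u` over `(0, s)`, in layer cake form. -/
def rearrInt {N : ℕ} (u : Euc N → ℝ) (s : ℝ≥0∞) : ℝ≥0∞ :=
  ∫⁻ t in Ioi (0 : ℝ), min s (volume {x | t < u x})

lemma antitone_measure_lt {X : Type*} [MeasurableSpace X] (μ : Measure X) (g : X → ℝ) :
    Antitone fun t : ℝ => μ {x | t < g x} :=
  fun _ _ h => measure_mono fun _ hx => h.trans_lt hx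

lemma measurable_volume_ball_inter {N : ℕ} (h : ℝ) {A : Set (Euc N)} (hA : MeasurableSet A) :
    Measurable fun z : Euc N => volume (A ∩ Metric.ball z h) := by
  have := measurable_measure_prodMk_right (μ := (volume : Measure (Euc N)))
    (measurableSet_closePairs h hA (B := univ) .univ)
  convert this using 3 with z
  ext x; simp [closePairs]

/-- Riesz's rearrangement inequality, for a function against the indicator of a set. -/
lemma lintegral_lintegral_ball_le {N : ℕ} [Nontrivial (Euc N)] {h r₀ : ℝ}
    {A : Set (Euc N)} (hA : MeasurableSet A) (hAb : Bornology.IsBounded A)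
    (hr₀ : volume (Metric.ball (0 : Euc N) r₀) = volume A) {u : Euc N → ℝ} (hu : Measurable u)
    (hu0 : ∀ x, 0 ≤ u x) (hub : Bornology.IsBounded (Function.support u)) :
    ∫⁻ x in A, ∫⁻ z in Metric.ball x h, ENNReal.ofReal (u z) ≤
      ∫⁻ l in Ioo 0 (volume (Metric.ball (0 : Euc N) h)).toReal,
        rearrInt u (volume {z : Euc N |
          l < (volume (Metric.ball 0 r₀ ∩ Metric.ball z h)).toReal}) := by
  set ψ : Euc N → ℝ≥0∞ := fun z => volume (Metric.ball 0 r₀ ∩ Metric.ball z h) with hψ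
  have hψm : Measurable ψ := measurable_volume_ball_inter h Metric.isOpen_ball.measurableSet
  have hψf : ∀ z, ψ z ≠ ⊤ := fun z =>
    measure_ne_top_of_subset inter_subset_right measure_ball_lt_top.ne
  have hψle : ∀ z, ψ z ≤ volume (Metric.ball (0 : Euc N) h) := fun z => by
    rw [← Measure.addHaar_ball_center volume z]; exact measure_mono inter_subset_right
  have hlev : ∀ t : ℝ, MeasurableSet {x | t < u x} := fun t => measurableSet_lt measurable_const hu
  rw [← lintegral_lintegral_ball h hA (g := fun z => ENNReal.ofReal (u z)) (by fun_prop)]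
  rw [lintegral_eq_lintegral_meas_lt _ (f := fun p : Euc N × Euc N => u p.2)
    (ae_of_all _ fun p => hu0 p.2) (hu.comp measurable_snd).aemeasurable]
  have step : ∀ t ∈ Ioi (0 : ℝ),
      (volume.restrict (closePairs h A univ)) {p : Euc N × Euc N | t < u p.2} ≤
      ∫⁻ l in Ioo 0 (volume (Metric.ball (0 : Euc N) h)).toReal,
        min (volume {z : Euc N | l < (ψ z).toReal}) (volume {x | t < u x}) := by
    intro t ht
    have hbd : Bornology.IsBounded {x | t < u x} := hub.subset fun x hx => by
      simp only [mem_ofPred_eq, mem_Ioi] at hx ht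
      exact (ht.trans hx).ne'
    have hfin : volume {x | t < u x} ≠ ⊤ := hbd.measure_lt_top.ne
    set b := ballRad {x | t < u x}
    have hb := volume_ball_ballRad hfin
    have e1 : (volume.restrict (closePairs h A univ)) {p : Euc N × Euc N | t < u p.2} =
        volume (closePairs h A {x | t < u x}) := by
      have hm : MeasurableSet {p : Euc N × Euc N | t < u p.2} := measurable_snd (hlev t)
      rw [Measure.restrict_apply hm]
      congr 1; ext p; simp [closePairs]; tauto
    rw [e1]
    refine (volume_closePairs_le_ball h hA (hlev t) hAb hbd hr₀ hb).trans ?_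
    have e2 : volume (closePairs h (Metric.ball (0 : Euc N) r₀) (Metric.ball 0 b)) =
        ∫⁻ z in Metric.ball (0 : Euc N) b, ψ z := by
      rw [Measure.volume_eq_prod, Measure.prod_apply_symm (measurableSet_closePairs h
        Metric.isOpen_ball.measurableSet Metric.isOpen_ball.measurableSet),
        ← lintegral_indicator Metric.isOpen_ball.measurableSet]
      refine lintegral_congr fun z => ?_
      by_cases hz : z ∈ Metric.ball (0 : Euc N) b
      · rw [indicator_of_mem hz]
        congr 1; ext x
        simp only [closePairs, mem_preimage, mem_ofPred_eq, hz, true_and]; rfl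
      · rw [indicator_of_notMem hz]
        convert measure_empty (μ := volume)
        ext x
        simp only [closePairs, mem_preimage, mem_ofPred_eq, hz, false_and, and_false,
          mem_empty_iff_false]
    have e3 : ∫⁻ z in Metric.ball (0 : Euc N) b, ψ z =
        ∫⁻ z in Metric.ball (0 : Euc N) b, ENNReal.ofReal (ψ z).toReal :=
      lintegral_congr fun z => (ENNReal.ofReal_toReal (hψf z)).symm
    rw [e2, e3, lintegral_eq_lintegral_meas_lt _ (ae_of_all _ fun z => ENNReal.toReal_nonneg)
      hψm.ennreal_toReal.aemeasurable, ← lintegral_indicator measurableSet_Ioi,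
      ← lintegral_indicator measurableSet_Ioo]
    refine lintegral_mono fun l => ?_
    by_cases hl : l ∈ Ioo 0 (volume (Metric.ball (0 : Euc N) h)).toReal
    · rw [indicator_of_mem hl, indicator_of_mem (show l ∈ Ioi 0 from hl.1)]
      refine le_min (Measure.restrict_apply_le _ _) ?_
      rw [← hb]
      exact (measure_mono (subset_univ _)).trans (by rw [Measure.restrict_apply_univ])
    · rw [indicator_of_notMem hl]
      by_cases h0 : l ∈ Ioi 0
      · rw [indicator_of_mem h0]
        have : {z : Euc N | l < (ψ z).toReal} = ∅ := by
          ext z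
          simp only [mem_ofPred_eq, mem_empty_iff_false, iff_false, not_lt]
          refine le_trans (ENNReal.toReal_mono measure_ball_lt_top.ne (hψle z)) ?_
          by_contra hc
          exact hl ⟨h0, not_le.1 hc⟩
        rw [this, measure_empty]
      · rw [indicator_of_notMem h0]
  refine (setLIntegral_mono' measurableSet_Ioi step).trans ?_
  rw [lintegral_lintegral_swap]
  · rfl
  · have m1 : Measurable fun p : ℝ × ℝ => volume {z : Euc N | p.2 < (ψ z).toReal} := by
      have : Measurable fun l : ℝ => volume {z : Euc N | l < (ψ z).toReal} :=
        (antitone_measure_lt volume fun z => (ψ z).toReal).measurable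
      exact this.comp measurable_snd
    have m2 : Measurable fun p : ℝ × ℝ => volume {x : Euc N | p.1 < u x} := by
      have : Measurable fun t : ℝ => volume {x : Euc N | t < u x} :=
        (antitone_measure_lt volume u).measurable
      exact this.comp measurable_fst
    exact (m1.min m2).aemeasurable

/-- The discrete comparison of averages: if the concentration of `u` exceeds that of `q` the most at
radius `r₀`, and `u` over `A` attains it, then so is the case after averaging over `h`-balls. -/
lemma lintegral_average_comparison {N : ℕ} [Nontrivial (Euc N)] {h r₀ R : ℝ}
    {A : Set (Euc N)} (hA : MeasurableSet A) (hAb : Bornology.IsBounded A)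
    (hr₀ : volume (Metric.ball (0 : Euc N) r₀) = volume A) (hR : r₀ + h ≤ R) (hR0 : 0 ≤ R)
    {u : Euc N → ℝ} (hu : Measurable u)
    (hu0 : ∀ x, 0 ≤ u x) (hub : Bornology.IsBounded (Function.support u))
    {q : Euc N → ℝ≥0∞} (hq : Measurable q)
    (hmax : ∀ ρ ∈ Icc 0 R, rearrInt u (volume (Metric.ball (0 : Euc N) ρ)) +
      (∫⁻ x in Metric.ball (0 : Euc N) r₀, q x) ≤
      (∫⁻ x in Metric.ball (0 : Euc N) ρ, q x) + ∫⁻ x in A, ENNReal.ofReal (u x)) :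
    (∫⁻ x in A, ∫⁻ z in Metric.ball x h, ENNReal.ofReal (u z)) +
      volume (Metric.ball (0 : Euc N) h) * (∫⁻ x in Metric.ball (0 : Euc N) r₀, q x) ≤
    (∫⁻ x in Metric.ball (0 : Euc N) r₀, ∫⁻ z in Metric.ball x h, q z) +
      volume (Metric.ball (0 : Euc N) h) * (∫⁻ x in A, ENNReal.ofReal (u x)) := by
  set ψ : Euc N → ℝ≥0∞ := fun z => volume (Metric.ball 0 r₀ ∩ Metric.ball z h) with hψ
  have bm : MeasurableSet (Metric.ball (0 : Euc N) r₀) := Metric.isOpen_ball.measurableSet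
  have hψm : Measurable ψ := measurable_volume_ball_inter h bm
  have hψf : ∀ z, ψ z ≠ ⊤ := fun z =>
    measure_ne_top_of_subset inter_subset_right measure_ball_lt_top.ne
  set Λ := volume (Metric.ball (0 : Euc N) h) with hΛ
  have hΛf : Λ ≠ ⊤ := measure_ball_lt_top.ne
  have hI : ∀ c : ℝ≥0∞, Λ * c = ∫⁻ l in Ioo 0 Λ.toReal, c := fun c => by
    rw [setLIntegral_const, Real.volume_Ioo, sub_zero, ENNReal.ofReal_toReal hΛf, mul_comm]
  have hU := lintegral_lintegral_ball_le hA hAb hr₀ hu hu0 hub (h := h)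
  have mW : Measurable fun l : ℝ => rearrInt u (volume {z : Euc N | l < (ψ z).toReal}) := by
    have : Antitone fun l : ℝ => rearrInt u (volume {z : Euc N | l < (ψ z).toReal}) := by
      intro l l' hl
      refine lintegral_mono fun t => min_le_min_right _ (measure_mono fun z hz => hl.trans_lt hz)
    exact this.measurable
  have hQ : ∫⁻ l in Ioo 0 Λ.toReal, ∫⁻ x in {z : Euc N | l < (ψ z).toReal}, q x ≤
      ∫⁻ x in Metric.ball (0 : Euc N) r₀, ∫⁻ z in Metric.ball x h, q z := by
    rw [← lintegral_lintegral_ball h bm hq, lintegral_lintegral_ball' h bm hq]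
    have : ∫⁻ z, ψ z * q z = ∫⁻ z, ENNReal.ofReal (ψ z).toReal ∂(volume.withDensity q) := by
      rw [lintegral_withDensity_eq_lintegral_mul _ hq (by fun_prop)]
      refine lintegral_congr fun z => ?_
      rw [Pi.mul_apply, ENNReal.ofReal_toReal (hψf z), mul_comm]
    change _ ≤ ∫⁻ z, ψ z * q z
    rw [this, lintegral_eq_lintegral_meas_lt _ (ae_of_all _ fun z => ENNReal.toReal_nonneg)
      hψm.ennreal_toReal.aemeasurable]
    refine (lintegral_mono_set (show Ioo 0 Λ.toReal ⊆ Ioi 0 from fun l hl => hl.1)).trans' ?_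
    refine lintegral_mono fun l => ?_
    rw [withDensity_apply _ (measurableSet_lt measurable_const hψm.ennreal_toReal)]
  refine (add_le_add hU (hI _).le).trans (le_trans ?_ (add_le_add hQ (hI _).ge))
  rw [← lintegral_add_right _ measurable_const, ← lintegral_add_right _ measurable_const]
  refine setLIntegral_mono' measurableSet_Ioo fun l hl => ?_
  obtain ⟨ρ, hρ, hae⟩ := ae_eq_ball_of_radial (S := {z : Euc N | l < (ψ z).toReal}) hR0 (by
    intro z hz
    have hz' : ψ z ≠ 0 := by
      intro h0
      simp only [mem_ofPred_eq, h0, ENNReal.toReal_zero] at hz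
      exact absurd hl.1 (not_lt.2 hz.le)
    obtain ⟨x, hx1, hx2⟩ := nonempty_of_measure_ne_zero hz'
    simp only [Metric.mem_ball, dist_zero_right, mem_closedBall_zero_iff] at hx1 hx2 ⊢
    have := norm_sub_norm_le z x
    rw [dist_comm, dist_eq_norm] at hx2
    linarith) (by
    intro x hx z hxz
    exact lt_of_lt_of_le hx (ENNReal.toReal_mono (hψf z) (volume_ball_inter_ball_anti r₀ h hxz)))
  rw [measure_congr hae, setLIntegral_congr hae]
  exact hmax ρ hρ

lemma rearrInt_mono {N : ℕ} (u : Euc N → ℝ) : Monotone (rearrInt u) := fun _ _ h =>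
  lintegral_mono fun _ => min_le_min_right _ h

lemma setLIntegral_eq_lintegral_volume_inter {N : ℕ} {u : Euc N → ℝ} (hu : Measurable u)
    (hu0 : ∀ x, 0 ≤ u x) (A : Set (Euc N)) :
    ∫⁻ x in A, ENNReal.ofReal (u x) = ∫⁻ t in Ioi (0 : ℝ), volume (A ∩ {x | t < u x}) := by
  rw [lintegral_eq_lintegral_meas_lt _ (ae_of_all _ hu0) hu.aemeasurable]
  refine lintegral_congr fun t => ?_
  rw [Measure.restrict_apply (measurableSet_lt measurable_const hu), inter_comm]

lemma setLIntegral_le_rearrInt {N : ℕ} {u : Euc N → ℝ} (hu : Measurable u)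
    (hu0 : ∀ x, 0 ≤ u x) (A : Set (Euc N)) :
    ∫⁻ x in A, ENNReal.ofReal (u x) ≤ rearrInt u (volume A) := by
  rw [setLIntegral_eq_lintegral_volume_inter hu hu0]
  exact lintegral_mono fun t => le_min (measure_mono inter_subset_left)
    (measure_mono inter_subset_right)

lemma rearrInt_eq_of_ge {N : ℕ} {u : Euc N → ℝ} (hu : Measurable u)
    (hu0 : ∀ x, 0 ≤ u x) {s : ℝ≥0∞} (hs : volume {x | 0 < u x} ≤ s) :
    rearrInt u s = ∫⁻ x in {x | 0 < u x}, ENNReal.ofReal (u x) := by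
  rw [setLIntegral_eq_lintegral_volume_inter hu hu0]
  refine setLIntegral_congr_fun measurableSet_Ioi fun t ht => ?_
  have : {x | t < u x} ⊆ {x | 0 < u x} := fun x (hx : t < u x) =>
    lt_trans (mem_Ioi.1 ht) hx
  rw [inter_eq_right.2 this, min_eq_right ((measure_mono this).trans hs)]

lemma rearrInt_le_add {N : ℕ} {u : Euc N → ℝ} {M : ℝ} (hM : ∀ x, u x ≤ M) {s s' : ℝ≥0∞} :
    rearrInt u s' ≤ rearrInt u s + (s' - s) * ENNReal.ofReal M := by
  have e : (s' - s) * ENNReal.ofReal M =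
    ∫⁻ t in Ioi (0 : ℝ), (Ioo 0 M).indicator (fun _ => s' - s) t := by
    rw [lintegral_indicator measurableSet_Ioo, Measure.restrict_restrict measurableSet_Ioo,
      setLIntegral_const, inter_eq_left.2 (fun t ht => ht.1), Real.volume_Ioo, sub_zero]
  unfold rearrInt
  rw [e, ← lintegral_add_right _ (measurable_const.indicator measurableSet_Ioo)]
  refine setLIntegral_mono' measurableSet_Ioi fun t ht => ?_
  by_cases htM : t < M
  · rw [indicator_of_mem (show t ∈ Ioo 0 M from ⟨ht, htM⟩)]
    rcases le_total s (volume {x | t < u x}) with h | h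
    · rw [min_eq_left h]
      exact (min_le_left _ _).trans le_add_tsub
    · rw [min_eq_right h]
      exact (min_le_right _ _).trans le_self_add
  · have : {x | t < u x} = ∅ := by
      ext x
      simp only [mem_ofPred_eq, mem_empty_iff_false, iff_false, not_lt]
      linarith [hM x]
    simp [this]

lemma volume_ball_sdiff_ball {N : ℕ} [Nontrivial (Euc N)] {r s : ℝ} (hr : 0 ≤ r) (hrs : r ≤ s) :
    volume (Metric.ball (0 : Euc N) s \ Metric.ball 0 r) =
      ENNReal.ofReal (omegaN N * s ^ N - omegaN N * r ^ N) := by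
  rw [measure_sdiff (Metric.ball_subset_ball hrs) Metric.isOpen_ball.measurableSet.nullMeasurableSet
    measure_ball_lt_top.ne, volume_ball_eq_ofReal _ hr, volume_ball_eq_ofReal _ (hr.trans hrs),
    ENNReal.ofReal_sub _ (mul_nonneg (omegaN_pos N).le (pow_nonneg hr _))]

/-- Lebesgue measure has the intermediate value property. -/
lemma exists_measurable_between {N : ℕ} [Nontrivial (Euc N)] {E F : Set (Euc N)}
    (hE : MeasurableSet E) (hF : MeasurableSet F) (hEF : E ⊆ F) (hFb : Bornology.IsBounded F)
    {s : ℝ≥0∞} (h1 : volume E ≤ s) (h2 : s ≤ volume F) :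
    ∃ A, MeasurableSet A ∧ E ⊆ A ∧ A ⊆ F ∧ volume A = s := by
  obtain ⟨R, hR⟩ := hFb.subset_ball 0
  obtain ⟨R, hR, hR0⟩ : ∃ R : ℝ, F ⊆ Metric.ball 0 R ∧ 0 ≤ R :=
    ⟨max R 0, hR.trans (Metric.ball_subset_ball (le_max_left _ _)), le_max_right _ _⟩
  have hFf : volume F ≠ ⊤ := measure_ne_top_of_subset hR measure_ball_lt_top.ne
  let A : ℝ → Set (Euc N) := fun ρ => E ∪ (F ∩ Metric.ball 0 ρ)
  have hAF : ∀ ρ, A ρ ⊆ F := fun ρ => union_subset hEF inter_subset_left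
  have hAf : ∀ ρ, volume (A ρ) ≠ ⊤ := fun ρ => measure_ne_top_of_subset (hAF ρ) hFf
  let g : ℝ → ℝ := fun ρ => (volume (A ρ)).toReal
  have hmono : ∀ {r t : ℝ}, r ≤ t → g r ≤ g t := fun h => ENNReal.toReal_mono (hAf _)
    (measure_mono (union_subset_union_right _
      (inter_subset_inter_right _ (Metric.ball_subset_ball h))))
  have hlip : ∀ {r t : ℝ}, 0 ≤ r → r ≤ t → g t - g r ≤ omegaN N * t ^ N - omegaN N * r ^ N := by
    intro r t hr h
    have hnn : 0 ≤ omegaN N * t ^ N - omegaN N * r ^ N := sub_nonneg.2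
      (mul_le_mul_of_nonneg_left (pow_le_pow_left₀ hr h N) (omegaN_pos N).le)
    have : volume (A t) ≤ volume (A r) + ENNReal.ofReal (omegaN N * t ^ N - omegaN N * r ^ N) := by
      rw [← volume_ball_sdiff_ball hr h]
      refine (measure_mono ?_).trans (measure_union_le _ _)
      rintro x (hx | hx)
      · exact Or.inl (Or.inl hx)
      · by_cases hxr : x ∈ Metric.ball (0 : Euc N) r
        · exact Or.inl (Or.inr ⟨hx.1, hxr⟩)
        · exact Or.inr ⟨hx.2, hxr⟩
    have := ENNReal.toReal_mono (by have := hAf r; finiteness) this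
    rw [ENNReal.toReal_add (hAf r) (by finiteness), ENNReal.toReal_ofReal hnn] at this
    simp only [g]; linarith
  have hcont : ContinuousOn g (Icc 0 R) := by
    have hpow : Continuous fun t : ℝ => omegaN N * t ^ N := by fun_prop
    intro r hr
    have h0 : Tendsto (fun t : ℝ => |omegaN N * t ^ N - omegaN N * r ^ N|)
      (nhdsWithin r (Icc 0 R)) (nhds 0) := by
      have : Tendsto (fun t : ℝ => |omegaN N * t ^ N - omegaN N * r ^ N|) (nhds r)
          (nhds |omegaN N * r ^ N - omegaN N * r ^ N|) :=
        ((hpow.tendsto r).sub tendsto_const_nhds).abs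
      rw [sub_self, abs_zero] at this
      exact this.mono_left nhdsWithin_le_nhds
    rw [ContinuousWithinAt, tendsto_iff_dist_tendsto_zero]
    refine squeeze_zero' (Eventually.of_forall fun _ => dist_nonneg) ?_ h0
    filter_upwards [self_mem_nhdsWithin] with t ht
    rw [Real.dist_eq]
    rcases le_total r t with h | h
    · rw [abs_of_nonneg (sub_nonneg.2 (hmono h))]
      exact (hlip hr.1 h).trans (le_abs_self _)
    · rw [abs_sub_comm, abs_sub_comm (omegaN N * t ^ N), abs_of_nonneg (sub_nonneg.2 (hmono h))]
      exact (hlip ht.1 h).trans (le_abs_self _)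
  have hsf : s ≠ ⊤ := ne_top_of_le_ne_top hFf h2
  have hs : s.toReal ∈ Icc (g 0) (g R) := by
    refine ⟨ENNReal.toReal_mono hsf ?_, ENNReal.toReal_mono (hAf R) (h2.trans (measure_mono ?_))⟩
    · simpa [A] using h1
    · exact fun x hx => Or.inr ⟨hx, hR hx⟩
  obtain ⟨ρ, -, hρ⟩ := intermediate_value_Icc hR0 hcont hs
  exact ⟨A ρ, hE.union (hF.inter Metric.isOpen_ball.measurableSet), subset_union_left, hAF ρ,
    (ENNReal.toReal_eq_toReal_iff' (hAf ρ) hsf).1 hρ⟩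

/-- The rearranged integral of `u` is attained on a set of the given measure. -/
lemma exists_setLIntegral_eq_rearrInt {N : ℕ} [Nontrivial (Euc N)] {u : Euc N → ℝ}
    (hu : Measurable u) (hu0 : ∀ x, 0 ≤ u x) (hub : Bornology.IsBounded (Function.support u))
    {M : ℝ} (hM : ∀ x, u x ≤ M) {s : ℝ≥0∞} (hs0 : s ≠ 0) (hs : s ≤ volume {x | 0 < u x}) :
    ∃ A, MeasurableSet A ∧ A ⊆ {x | 0 < u x} ∧ volume A = s ∧
      ∫⁻ x in A, ENNReal.ofReal (u x) = rearrInt u s := by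
  have hlev : ∀ t : ℝ, MeasurableSet {x | t < u x} := fun t => measurableSet_lt measurable_const hu
  have hbd : Bornology.IsBounded {x | 0 < u x} := hub.subset fun x hx => ne_of_gt hx
  have hfin : ∀ t : ℝ, 0 ≤ t → volume {x | t < u x} ≠ ⊤ := fun t ht =>
    measure_ne_top_of_subset (fun x hx => lt_of_le_of_lt ht hx) hbd.measure_lt_top.ne
  set T : Set ℝ := {t | 0 ≤ t ∧ s ≤ volume {x | t < u x}} with hT
  have hT0 : (0 : ℝ) ∈ T := ⟨le_rfl, hs⟩
  have hTb : BddAbove T := by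
    refine ⟨M, fun t ht => ?_⟩
    by_contra hc
    have : {x | t < u x} = ∅ := by
      ext x
      simp only [mem_ofPred_eq, mem_empty_iff_false, iff_false, not_lt]
      linarith [hM x, not_le.1 hc]
    have h2 := ht.2
    rw [this, measure_empty] at h2
    exact hs0 (le_antisymm h2 bot_le)
  set t₀ := sSup T with ht₀
  have ht₀0 : 0 ≤ t₀ := le_csSup hTb hT0
  have hbelow : ∀ t, t < t₀ → s ≤ volume {x | t < u x} := by
    intro t ht
    obtain ⟨t', h1, h2⟩ := exists_lt_of_lt_csSup ⟨0, hT0⟩ ht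
    exact h1.2.trans (measure_mono fun x hx => h2.trans hx)
  have habove : volume {x | t₀ < u x} ≤ s := by
    have e : {x | t₀ < u x} = ⋃ n : ℕ, {x | t₀ + 1 / ((n : ℝ) + 1) < u x} := by
      ext x
      simp only [mem_ofPred_eq, mem_iUnion]
      constructor
      · intro hx
        obtain ⟨n, hn⟩ := exists_nat_one_div_lt (sub_pos.2 hx)
        exact ⟨n, by linarith⟩
      · rintro ⟨n, hn⟩
        have : (0 : ℝ) < 1 / ((n : ℝ) + 1) := by positivity
        linarith
    have hm : Monotone fun n : ℕ => {x | t₀ + 1 / ((n : ℝ) + 1) < u x} := by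
      intro n m hnm x hx
      simp only [mem_ofPred_eq] at hx ⊢
      have : 1 / ((m : ℝ) + 1) ≤ 1 / ((n : ℝ) + 1) := Nat.one_div_le_one_div hnm
      linarith
    rw [e, hm.measure_iUnion]
    refine iSup_le fun n => ?_
    by_contra hc
    have h3 : (0 : ℝ) < 1 / ((n : ℝ) + 1) := by positivity
    have : t₀ + 1 / ((n : ℝ) + 1) ∈ T := ⟨by linarith, (not_le.1 hc).le⟩
    have := le_csSup hTb this
    linarith
  have hge : t₀ = 0 ∨ s ≤ volume {x | t₀ ≤ u x} := by
    rcases ht₀0.eq_or_lt with h | hpos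
    · exact Or.inl h.symm
    right
    have e : {x | t₀ ≤ u x} = ⋂ n : ℕ, {x | t₀ - t₀ / ((n : ℝ) + 1) < u x} := by
      ext x
      simp only [mem_ofPred_eq, mem_iInter]
      constructor
      · intro hx n
        have : (0 : ℝ) < t₀ / ((n : ℝ) + 1) := by positivity
        linarith
      · intro hx
        by_contra hc
        obtain ⟨n, hn⟩ := exists_nat_one_div_lt (div_pos (sub_pos.2 (not_le.1 hc)) hpos)
        have h1 := hx n
        rw [lt_div_iff₀ hpos] at hn
        have : t₀ / ((n : ℝ) + 1) = 1 / ((n : ℝ) + 1) * t₀ := by ring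
        linarith
    have ha : Antitone fun n : ℕ => {x | t₀ - t₀ / ((n : ℝ) + 1) < u x} := by
      intro n m hnm x hx
      simp only [mem_ofPred_eq] at hx ⊢
      have : 1 / ((m : ℝ) + 1) ≤ 1 / ((n : ℝ) + 1) := Nat.one_div_le_one_div hnm
      have h2 := mul_le_mul_of_nonneg_right this hpos.le
      have e1 : t₀ / ((n : ℝ) + 1) = 1 / ((n : ℝ) + 1) * t₀ := by ring
      have e2 : t₀ / ((m : ℝ) + 1) = 1 / ((m : ℝ) + 1) * t₀ := by ring
      linarith
    rw [e, ha.measure_iInter (fun n => (hlev _).nullMeasurableSet) ⟨0, hfin _ (by simp)⟩]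
    refine le_iInf fun n => hbelow _ ?_
    have : (0 : ℝ) < t₀ / ((n : ℝ) + 1) := by positivity
    linarith
  obtain ⟨A, hA, hA1, hA2, hA3⟩ : ∃ A, MeasurableSet A ∧ {x | t₀ < u x} ⊆ A ∧
      (A ⊆ {x | 0 < u x} ∧ A ⊆ {x | t₀ ≤ u x}) ∧ volume A = s := by
    rcases ht₀0.eq_or_lt with h | hpos
    · refine ⟨{x | t₀ < u x}, hlev _, subset_rfl, ⟨fun x hx => lt_of_le_of_lt ht₀0 hx,
        fun x (hx : t₀ < u x) => hx.le⟩, le_antisymm habove ?_⟩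
      rw [← h]; exact hs
    · obtain ⟨A, h1, h2, h3, h4⟩ := exists_measurable_between (hlev t₀)
        (measurableSet_le measurable_const hu) (fun x (hx : t₀ < u x) => hx.le)
        (hbd.subset fun x (hx : t₀ ≤ u x) => hpos.trans_le hx) habove (hge.resolve_left hpos.ne')
      exact ⟨A, h1, h2, ⟨fun x hx => hpos.trans_le (h3 hx), h3⟩, h4⟩
  refine ⟨A, hA, hA2.1, hA3, ?_⟩
  rw [setLIntegral_eq_lintegral_volume_inter hu hu0]
  refine lintegral_congr fun t => ?_
  rcases lt_or_ge t t₀ with h | h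
  · have : A ⊆ {x | t < u x} := fun x hx => lt_of_lt_of_le h (hA2.2 hx)
    rw [inter_eq_left.2 this, hA3, min_eq_left (hbelow t h)]
  · have : {x | t < u x} ⊆ A := fun x hx => hA1 (lt_of_le_of_lt h hx)
    rw [inter_eq_right.2 this, min_eq_right (hA3 ▸ measure_mono this)]

lemma rearrInt_le_add_of_le {N : ℕ} [Nontrivial (Euc N)] {u u' : Euc N → ℝ}
    (hu : Measurable u) (hu0 : ∀ x, 0 ≤ u x) (hub : Bornology.IsBounded (Function.support u))
    {M : ℝ} (hM : ∀ x, u x ≤ M) (hu' : Measurable u') (hu0' : ∀ x, 0 ≤ u' x) {c : ℝ}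
    (hc : ∀ x, u x ≤ u' x + c) (s : ℝ≥0∞) :
    rearrInt u s ≤ rearrInt u' s + s * ENNReal.ofReal c := by
  rcases eq_or_ne s 0 with rfl | hs0
  · simp [rearrInt]
  obtain ⟨A, hAs, hAe⟩ : ∃ A, volume A ≤ s ∧
      ∫⁻ x in A, ENNReal.ofReal (u x) = rearrInt u s := by
    rcases le_total s (volume {x | 0 < u x}) with h | h
    · obtain ⟨A, -, -, h3, h4⟩ := exists_setLIntegral_eq_rearrInt hu hu0 hub hM hs0 h
      exact ⟨A, h3.le, h4⟩
    · exact ⟨_, h, (rearrInt_eq_of_ge hu hu0 h).symm⟩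
  rw [← hAe]
  calc ∫⁻ x in A, ENNReal.ofReal (u x)
      ≤ ∫⁻ x in A, (ENNReal.ofReal (u' x) + ENNReal.ofReal c) :=
        lintegral_mono fun x => (ENNReal.ofReal_le_ofReal (hc x)).trans ENNReal.ofReal_add_le
    _ = (∫⁻ x in A, ENNReal.ofReal (u' x)) + volume A * ENNReal.ofReal c := by
        rw [lintegral_add_right _ measurable_const, setLIntegral_const, mul_comm]
    _ ≤ rearrInt u' s + s * ENNReal.ofReal c :=
        add_le_add ((setLIntegral_le_rearrInt hu' hu0' A).trans (rearrInt_mono _ hAs))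
          (mul_le_mul_left hAs _)

section
variable {N : ℕ} {α : ℝ} {Ω : Set (Euc N)} {f : Euc N → ℝ} {w : Euc N → ℝ → ℝ}

/-- The uncurried solution. -/
def unc {N : ℕ} (w : Euc N → ℝ → ℝ) (p : Euc N × ℝ) : ℝ := w p.1 p.2

lemma isOpen_cyl (hΩ : IsOpen Ω) : IsOpen (Ω ×ˢ Ioi (0 : ℝ)) := hΩ.prod isOpen_Ioi

lemma IsExtSol.contDiffAt (hw : IsExtSol α Ω f w) (hΩ : IsOpen Ω) {x : Euc N} (hx : x ∈ Ω)
    {y : ℝ} (hy : 0 < y) : ContDiffAt ℝ 2 (unc w) (x, y) :=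
  hw.smooth.contDiffAt ((isOpen_cyl hΩ).mem_nhds ⟨hx, hy⟩)

lemma IsExtSol.hasFDerivAt (hw : IsExtSol α Ω f w) (hΩ : IsOpen Ω) {x : Euc N} (hx : x ∈ Ω)
    {y : ℝ} (hy : 0 < y) : HasFDerivAt (unc w) (fderiv ℝ (unc w) (x, y)) (x, y) :=
  ((hw.contDiffAt hΩ hx hy).differentiableAt (by norm_num)).hasFDerivAt

lemma IsExtSol.hasFDerivAt_fderiv (hw : IsExtSol α Ω f w) (hΩ : IsOpen Ω) {x : Euc N}
    (hx : x ∈ Ω) {y : ℝ} (hy : 0 < y) :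
    HasFDerivAt (fderiv ℝ (unc w)) (fderiv ℝ (fderiv ℝ (unc w)) (x, y)) (x, y) :=
  (((hw.contDiffAt hΩ hx hy).fderiv_right (m := 1) (by norm_num)).differentiableAt
    (by norm_num)).hasFDerivAt

lemma hasDerivAt_vert (x : Euc N) (y : ℝ) :
    HasDerivAt (fun t : ℝ => (x, t)) ((0 : Euc N), (1 : ℝ)) y :=
  (hasDerivAt_const y x).prodMk (hasDerivAt_id y)

lemma hasDerivAt_horiz (x e : Euc N) (y t : ℝ) :
    HasDerivAt (fun t : ℝ => (x + t • e, y)) (e, (0 : ℝ)) t := by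
  refine HasDerivAt.prodMk ?_ (hasDerivAt_const t y)
  simpa using ((hasDerivAt_id t).smul_const e).const_add x

lemma IsExtSol.hasDerivAt_y (hw : IsExtSol α Ω f w) (hΩ : IsOpen Ω) {x : Euc N} (hx : x ∈ Ω)
    {y : ℝ} (hy : 0 < y) : HasDerivAt (w x) (fderiv ℝ (unc w) (x, y) (0, 1)) y :=
  (hw.hasFDerivAt hΩ hx hy).comp_hasDerivAt y (hasDerivAt_vert x y)

lemma IsExtSol.deriv_y (hw : IsExtSol α Ω f w) (hΩ : IsOpen Ω) {x : Euc N} (hx : x ∈ Ω)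
    {y : ℝ} (hy : 0 < y) : deriv (w x) y = fderiv ℝ (unc w) (x, y) (0, 1) :=
  (hw.hasDerivAt_y hΩ hx hy).deriv

lemma IsExtSol.hasDerivAt_deriv_y (hw : IsExtSol α Ω f w) (hΩ : IsOpen Ω) {x : Euc N}
    (hx : x ∈ Ω) {y : ℝ} (hy : 0 < y) :
    HasDerivAt (deriv (w x)) (fderiv ℝ (fderiv ℝ (unc w)) (x, y) (0, 1) (0, 1)) y := by
  have h1 := ((hw.hasFDerivAt_fderiv hΩ hx hy).comp_hasDerivAt y (hasDerivAt_vert x y)).clm_apply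
    (hasDerivAt_const y ((0 : Euc N), (1 : ℝ)))
  simp only [map_zero, add_zero] at h1
  refine h1.congr_of_eventuallyEq ?_
  filter_upwards [Ioi_mem_nhds hy] with t ht
  exact hw.deriv_y hΩ hx ht

lemma IsExtSol.hasDerivAt_x (hw : IsExtSol α Ω f w) (hΩ : IsOpen Ω) {x e : Euc N} {t : ℝ}
    (hx : x + t • e ∈ Ω) {y : ℝ} (hy : 0 < y) :
    HasDerivAt (fun s : ℝ => w (x + s • e) y) (fderiv ℝ (unc w) (x + t • e, y) (e, 0)) t := by
  have h0 := hw.hasFDerivAt hΩ hx hy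
  have h1 := HasFDerivAt.comp_hasDerivAt (f := fun s : ℝ => (x + s • e, y)) t h0
    (hasDerivAt_horiz x e y t)
  exact h1

lemma IsExtSol.hasDerivAt_fderiv_x (hw : IsExtSol α Ω f w) (hΩ : IsOpen Ω) {x e : Euc N} {t : ℝ}
    (hx : x + t • e ∈ Ω) {y : ℝ} (hy : 0 < y) :
    HasDerivAt (fun s : ℝ => fderiv ℝ (unc w) (x + s • e, y) (e, 0))
      (fderiv ℝ (fderiv ℝ (unc w)) (x + t • e, y) (e, 0) (e, 0)) t := by
  have h0 := hw.hasFDerivAt_fderiv hΩ hx hy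
  have h1 := (HasFDerivAt.comp_hasDerivAt (f := fun s : ℝ => (x + s • e, y)) t h0
    (hasDerivAt_horiz x e y t)).clm_apply (hasDerivAt_const t (e, (0 : ℝ)))
  simp only [map_zero, add_zero] at h1
  exact h1

lemma IsExtSol.lapx_eq (hw : IsExtSol α Ω f w) (hΩ : IsOpen Ω) {x : Euc N} (hx : x ∈ Ω)
    {y : ℝ} (hy : 0 < y) : lapx w x y = ∑ i : Fin N, fderiv ℝ (fderiv ℝ (unc w)) (x, y)
      (EuclideanSpace.single i 1, 0) (EuclideanSpace.single i 1, 0) := by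
  refine Finset.sum_congr rfl fun i _ => ?_
  set e : Euc N := EuclideanSpace.single i 1
  have h0 : x + (0 : ℝ) • e ∈ Ω := by simpa using hx
  have h1 := hw.hasDerivAt_fderiv_x hΩ (e := e) h0 hy
  simp only [zero_smul, add_zero] at h1
  refine HasDerivAt.deriv (h1.congr_of_eventuallyEq ?_)
  have : ∀ᶠ t : ℝ in nhds 0, x + t • e ∈ Ω := by
    have hc : Continuous fun t : ℝ => x + t • e := by fun_prop
    exact hc.continuousAt.eventually (hΩ.mem_nhds h0)
  filter_upwards [this] with t ht
  exact (hw.hasDerivAt_x hΩ ht hy).deriv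

/-- A common bound for the solution and its derivatives. -/
lemma IsExtSol.exists_bound (hw : IsExtSol α Ω f w) (hΩ : IsOpen Ω) : ∃ M : ℝ, 0 < M ∧
    (∀ x ∈ closure Ω, ∀ y : ℝ, 0 ≤ y → |w x y| ≤ M) ∧
    (∀ x ∈ Ω, ∀ y : ℝ, 0 < y → |deriv (w x) y| ≤ M) ∧
    (∀ x ∈ Ω, ∀ y : ℝ, 0 < y → |deriv (deriv (w x)) y| ≤ M) ∧
    (∀ x ∈ Ω, ∀ y : ℝ, 0 < y → ∀ e : Euc N,
      |fderiv ℝ (fderiv ℝ (unc w)) (x, y) (e, 0) (e, 0)| ≤ M * ‖e‖ ^ 2) ∧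
    (∀ x ∈ Ω, ∀ y : ℝ, 0 < y → |lapx w x y| ≤ M) := by
  obtain ⟨M₁, h₁⟩ := hw.bdd
  obtain ⟨M₂, h₂⟩ := hw.derivBdd
  have hM : 0 ≤ |M₁| + |M₂| := by positivity
  have b2 : ∀ x ∈ Ω, ∀ y : ℝ, 0 < y → ∀ e : Euc N,
      |fderiv ℝ (fderiv ℝ (unc w)) (x, y) (e, 0) (e, 0)| ≤ (|M₁| + |M₂|) * ‖e‖ ^ 2 := by
    intro x hx y hy e
    have h3 := (h₂ (x, y) ⟨hx, hy⟩).2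
    have h4 := ContinuousLinearMap.le_opNorm₂ (fderiv ℝ (fderiv ℝ (unc w)) (x, y)) (e, 0) (e, 0)
    have h5 : ‖((e, 0) : Euc N × ℝ)‖ = ‖e‖ := by simp [Prod.norm_def]
    rw [h5, Real.norm_eq_abs] at h4
    have h6 : M₂ ≤ |M₁| + |M₂| := (le_abs_self _).trans (by linarith [abs_nonneg M₁])
    calc _ ≤ _ := h4
      _ ≤ (|M₁| + |M₂|) * ‖e‖ * ‖e‖ := by gcongr; exact h3.trans h6
      _ = _ := by ring
  refine ⟨(|M₁| + |M₂|) * (N + 1) + 1, by positivity, ?_, ?_, ?_, ?_, ?_⟩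
  · intro x hx y hy
    have : |w x y| ≤ M₁ := by
      refine h₁ (x, y) ?_
      rw [closure_prod_eq, closure_Ioi]
      exact ⟨hx, hy⟩
    have := this.trans (le_abs_self _)
    have h7 : 0 ≤ (|M₁| + |M₂|) * N := by positivity
    nlinarith [abs_nonneg M₁, abs_nonneg M₂]
  · intro x hx y hy
    rw [hw.deriv_y hΩ hx hy]
    have h3 := (h₂ (x, y) ⟨hx, hy⟩).1
    have h4 := (fderiv ℝ (unc w) (x, y)).le_opNorm (0, 1)
    have h5 : ‖((0, 1) : Euc N × ℝ)‖ = 1 := by simp [Prod.norm_def]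
    rw [h5, mul_one, Real.norm_eq_abs] at h4
    have h6 : |fderiv ℝ (unc w) (x, y) (0, 1)| ≤ M₂ := h4.trans h3
    have h7 : 0 ≤ (|M₁| + |M₂|) * N := by positivity
    nlinarith [abs_nonneg M₁, le_abs_self M₂]
  · intro x hx y hy
    rw [(hw.hasDerivAt_deriv_y hΩ hx hy).deriv]
    have h3 := (h₂ (x, y) ⟨hx, hy⟩).2
    have h4 := ContinuousLinearMap.le_opNorm₂ (fderiv ℝ (fderiv ℝ (unc w)) (x, y)) (0, 1) (0, 1)
    have h5 : ‖((0, 1) : Euc N × ℝ)‖ = 1 := by simp [Prod.norm_def]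
    rw [h5, mul_one, mul_one, Real.norm_eq_abs] at h4
    have h6 : |fderiv ℝ (fderiv ℝ (unc w)) (x, y) (0, 1) (0, 1)| ≤ M₂ := h4.trans h3
    have h7 : 0 ≤ (|M₁| + |M₂|) * N := by positivity
    nlinarith [abs_nonneg M₁, le_abs_self M₂]
  · intro x hx y hy e
    refine (b2 x hx y hy e).trans (mul_le_mul_of_nonneg_right ?_ (by positivity))
    have h7 : 0 ≤ (|M₁| + |M₂|) * N := by positivity
    linarith
  · intro x hx y hy
    rw [hw.lapx_eq hΩ hx hy]
    refine (Finset.abs_sum_le_sum_abs _ _).trans ?_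
    refine (Finset.sum_le_sum fun i _ => b2 x hx y hy _).trans ?_
    simp only [PiLp.norm_single, norm_one, one_pow, mul_one, Finset.sum_const,
      Finset.card_univ, Fintype.card_fin, nsmul_eq_mul]
    linarith

lemma IsExtSol.exists_bound_weighted (hw : IsExtSol α Ω f w) (hΩ : IsOpen Ω) (hα : α < 2) :
    ∃ C : ℝ, ∀ x ∈ Ω, ∀ y ∈ Ioc (0 : ℝ) 1, |y ^ (1 - α) * deriv (w x) y| ≤ C := by
  obtain ⟨M, hM, -, h1, h2, -, h3⟩ := hw.exists_bound hΩ
  by_cases ha : α = 1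
  · refine ⟨M, fun x hx y hy => ?_⟩
    rw [ha, sub_self, Real.rpow_zero, one_mul]
    exact h1 x hx y hy.1
  · refine ⟨2 * M / |1 - α|, fun x hx y hy => ?_⟩
    have hpos : 0 < |1 - α| := abs_pos.2 (sub_ne_zero.2 (Ne.symm ha))
    have hp := hw.pde x hx y hy.1
    have e1 : |(1 - α) / y * deriv (w x) y| ≤ 2 * M := by
      have : (1 - α) / y * deriv (w x) y = -(lapx w x y + deriv (deriv (w x)) y) := by linarith
      rw [this, abs_neg]
      exact (abs_add_le _ _).trans (by linarith [h2 x hx y hy.1, h3 x hx y hy.1])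
    have e2 : y ^ (1 - α) * deriv (w x) y =
        y ^ (2 - α) * ((1 - α) / y * deriv (w x) y) / (1 - α) := by
      have : y ^ (2 - α) = y ^ (1 - α) * y := by
        rw [show 2 - α = (1 - α) + 1 by ring, Real.rpow_add_one hy.1.ne']
      rw [this]
      have := hy.1.ne'
      have : (1 - α) ≠ 0 := sub_ne_zero.2 (Ne.symm ha)
      field_simp
    rw [e2, abs_div, abs_mul]
    refine div_le_div_of_nonneg_right ?_ hpos.le
    have e3 : |y ^ (2 - α)| ≤ 1 := by
      rw [abs_of_nonneg (Real.rpow_nonneg hy.1.le _)]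
      exact Real.rpow_le_one hy.1.le hy.2 (by linarith)
    calc _ ≤ 1 * (2 * M) := mul_le_mul e3 e1 (abs_nonneg _) zero_le_one
      _ = _ := one_mul _
end

section
variable {N : ℕ} {α : ℝ} {Ω : Set (Euc N)} {f : Euc N → ℝ} {w : Euc N → ℝ → ℝ}

lemma IsExtSol.continuousOn_prod (hw : IsExtSol α Ω f w) :
    ContinuousOn (unc w) (closure Ω ×ˢ Ici (0 : ℝ)) := by
  have := hw.cont
  rwa [closure_prod_eq, closure_Ioi] at this

lemma IsExtSol.continuousOn_x (hw : IsExtSol α Ω f w) {y : ℝ} (hy : 0 ≤ y) :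
    ContinuousOn (fun x => w x y) (closure Ω) :=
  hw.continuousOn_prod.comp (f := fun x : Euc N => (x, y)) (by fun_prop) fun _ hx => ⟨hx, hy⟩

lemma IsExtSol.continuousOn_y (hw : IsExtSol α Ω f w) {x : Euc N} (hx : x ∈ closure Ω) :
    ContinuousOn (w x) (Ici 0) :=
  hw.continuousOn_prod.comp (f := fun y : ℝ => (x, y)) (by fun_prop) fun _ hy => ⟨hx, hy⟩

lemma IsExtSol.continuousOn_fderiv (hw : IsExtSol α Ω f w) (hΩ : IsOpen Ω) :
    ContinuousOn (fderiv ℝ (unc w)) (Ω ×ˢ Ioi (0 : ℝ)) :=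
  fun _p hp => (hw.hasFDerivAt_fderiv hΩ hp.1 hp.2).continuousAt.continuousWithinAt

lemma IsExtSol.continuousOn_fderiv_fderiv (hw : IsExtSol α Ω f w) (hΩ : IsOpen Ω) :
    ContinuousOn (fderiv ℝ (fderiv ℝ (unc w))) (Ω ×ˢ Ioi (0 : ℝ)) := fun p hp =>
  ((((hw.contDiffAt hΩ hp.1 hp.2).fderiv_right (m := 1) (by norm_num)).fderiv_right (m := 0)
    (by norm_num)).continuousAt).continuousWithinAt

lemma IsExtSol.continuousOn_deriv (hw : IsExtSol α Ω f w) (hΩ : IsOpen Ω) {y : ℝ} (hy : 0 < y) :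
    ContinuousOn (fun x => deriv (w x) y) Ω := by
  have h1 : ContinuousOn (fun x : Euc N => fderiv ℝ (unc w) (x, y)) Ω :=
    (hw.continuousOn_fderiv hΩ).comp (f := fun x : Euc N => (x, y)) (by fun_prop)
      fun _ hx => ⟨hx, hy⟩
  exact (h1.clm_apply continuousOn_const).congr fun x hx => hw.deriv_y hΩ hx hy

lemma IsExtSol.continuousOn_deriv_deriv (hw : IsExtSol α Ω f w) (hΩ : IsOpen Ω) {y : ℝ}
    (hy : 0 < y) : ContinuousOn (fun x => deriv (deriv (w x)) y) Ω := by
  have h1 : ContinuousOn (fun x : Euc N => fderiv ℝ (fderiv ℝ (unc w)) (x, y)) Ω :=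
    (hw.continuousOn_fderiv_fderiv hΩ).comp (f := fun x : Euc N => (x, y)) (by fun_prop)
      fun _ hx => ⟨hx, hy⟩
  exact ((h1.clm_apply continuousOn_const).clm_apply continuousOn_const).congr
    fun x hx => (hw.hasDerivAt_deriv_y hΩ hx hy).deriv

lemma IsExtSol.continuousOn_lapx (hw : IsExtSol α Ω f w) (hΩ : IsOpen Ω) {y : ℝ}
    (hy : 0 < y) : ContinuousOn (fun x => lapx w x y) Ω := by
  have h1 : ContinuousOn (fun x : Euc N => fderiv ℝ (fderiv ℝ (unc w)) (x, y)) Ω :=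
    (hw.continuousOn_fderiv_fderiv hΩ).comp (f := fun x : Euc N => (x, y)) (by fun_prop)
      fun _ hx => ⟨hx, hy⟩
  refine ContinuousOn.congr (continuousOn_finsetSum _ fun i _ => ?_)
    fun x hx => hw.lapx_eq hΩ hx hy
  exact ((h1.clm_apply continuousOn_const).clm_apply continuousOn_const)

lemma aestronglyMeasurable_of_continuousOn {g : Euc N → ℝ} (hΩ : IsOpen Ω)
    (hg : ContinuousOn g Ω) {A : Set (Euc N)} (hA : A ⊆ Ω) :
    AEStronglyMeasurable g (volume.restrict A) :=
  (hg.aestronglyMeasurable hΩ.measurableSet).mono_measure (Measure.restrict_mono hA le_rfl)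

lemma integrableOn_of_continuousOn {g : Euc N → ℝ} (hΩ : IsOpen Ω)
    (hg : ContinuousOn g Ω) {A : Set (Euc N)} (hA : A ⊆ Ω) (hAm : MeasurableSet A)
    (hAf : volume A ≠ ⊤) {M : ℝ} (hM : ∀ x ∈ Ω, |g x| ≤ M) : IntegrableOn g A := by
  exact (integrableOn_const (C := M) hAf).mono' (aestronglyMeasurable_of_continuousOn hΩ hg hA)
    ((ae_restrict_iff' hAm).2 (ae_of_all _ fun x hx => hM x (hA hx)))

lemma IsExtSol.integrableOn (hw : IsExtSol α Ω f w) (hΩ : IsOpen Ω) {A : Set (Euc N)}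
    (hA : A ⊆ Ω) (hAm : MeasurableSet A) (hAf : volume A ≠ ⊤) {y : ℝ} (hy : 0 ≤ y) :
    IntegrableOn (fun x => w x y) A := by
  obtain ⟨M, -, h, -⟩ := hw.exists_bound hΩ
  exact integrableOn_of_continuousOn hΩ ((hw.continuousOn_x hy).mono subset_closure) hA hAm hAf
    fun x hx => h x (subset_closure hx) y hy

lemma IsExtSol.hasDerivAt_integral (hw : IsExtSol α Ω f w) (hΩ : IsOpen Ω) {A : Set (Euc N)}
    (hA : A ⊆ Ω) (hAm : MeasurableSet A) (hAf : volume A ≠ ⊤) {y : ℝ} (hy : 0 < y) :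
    HasDerivAt (fun y => ∫ x in A, w x y) (∫ x in A, deriv (w x) y) y := by
  obtain ⟨M, -, -, h, -⟩ := hw.exists_bound hΩ
  refine (hasDerivAt_integral_of_dominated_loc_of_deriv_le (F := fun y x => w x y)
    (F' := fun y x => deriv (w x) y) (bound := fun _ => M)
    (Ioi_mem_nhds hy) ?_ (hw.integrableOn hΩ hA hAm hAf hy.le)
    (aestronglyMeasurable_of_continuousOn hΩ (hw.continuousOn_deriv hΩ hy) hA) ?_ ?_ ?_).2
  · filter_upwards [Ioi_mem_nhds hy] with t ht
    exact (hw.integrableOn hΩ hA hAm hAf (le_of_lt ht)).aestronglyMeasurable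
  · exact (ae_restrict_iff' hAm).2 (ae_of_all _ fun x hx t ht => h x (hA hx) t ht)
  · exact integrableOn_const hAf
  · refine (ae_restrict_iff' hAm).2 (ae_of_all _ fun x hx t ht => ?_)
    exact (hw.hasDerivAt_y hΩ (hA hx) ht).differentiableAt.hasDerivAt

lemma IsExtSol.hasDerivAt_integral_deriv (hw : IsExtSol α Ω f w) (hΩ : IsOpen Ω)
    {A : Set (Euc N)} (hA : A ⊆ Ω) (hAm : MeasurableSet A) (hAf : volume A ≠ ⊤) {y : ℝ}
    (hy : 0 < y) :
    HasDerivAt (fun y => ∫ x in A, deriv (w x) y) (∫ x in A, deriv (deriv (w x)) y) y := by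
  obtain ⟨M, -, -, h', h, -⟩ := hw.exists_bound hΩ
  refine (hasDerivAt_integral_of_dominated_loc_of_deriv_le (F := fun y x => deriv (w x) y)
    (F' := fun y x => deriv (deriv (w x)) y) (bound := fun _ => M)
    (Ioi_mem_nhds hy) ?_ ?_
    (aestronglyMeasurable_of_continuousOn hΩ (hw.continuousOn_deriv_deriv hΩ hy) hA) ?_ ?_ ?_).2
  · filter_upwards [Ioi_mem_nhds hy] with t ht
    exact aestronglyMeasurable_of_continuousOn hΩ (hw.continuousOn_deriv hΩ ht) hA
  · exact integrableOn_of_continuousOn hΩ (hw.continuousOn_deriv hΩ hy) hA hAm hAf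
      fun x hx => h' x hx y hy
  · exact (ae_restrict_iff' hAm).2 (ae_of_all _ fun x hx t ht => h x (hA hx) t ht)
  · exact integrableOn_const hAf
  · refine (ae_restrict_iff' hAm).2 (ae_of_all _ fun x hx t ht => ?_)
    exact (hw.hasDerivAt_deriv_y hΩ (hA hx) ht).differentiableAt.hasDerivAt

lemma IsExtSol.continuousOn_integral (hw : IsExtSol α Ω f w) (hΩ : IsOpen Ω)
    {A : Set (Euc N)} (hA : A ⊆ Ω) (hAm : MeasurableSet A) (hAf : volume A ≠ ⊤) :
    ContinuousOn (fun y => ∫ x in A, w x y) (Ici 0) := by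
  obtain ⟨M, -, h, -⟩ := hw.exists_bound hΩ
  refine continuousOn_of_dominated (bound := fun _ => M) (fun y hy => ?_) (fun y hy => ?_)
    (integrableOn_const hAf) ?_
  · exact (hw.integrableOn hΩ hA hAm hAf hy).aestronglyMeasurable
  · exact (ae_restrict_iff' hAm).2 (ae_of_all _ fun x hx => h x (subset_closure (hA hx)) y hy)
  · exact (ae_restrict_iff' hAm).2 (ae_of_all _ fun x hx =>
      hw.continuousOn_y (subset_closure (hA hx)))

lemma IsExtSol.tendsto_integral_neumann (hw : IsExtSol α Ω f w) (hΩ : IsOpen Ω) (hα : α < 2)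
    {A : Set (Euc N)} (hA : A ⊆ Ω) (hAm : MeasurableSet A) (hAf : volume A ≠ ⊤) :
    Tendsto (fun y : ℝ => y ^ (1 - α) * ∫ x in A, deriv (w x) y) (nhdsWithin 0 (Ioi 0))
      (nhds (-(kappa α) * ∫ x in A, f x)) := by
  obtain ⟨C, hC⟩ := hw.exists_bound_weighted hΩ hα
  simp only [← integral_const_mul]
  refine tendsto_integral_filter_of_dominated_convergence (fun _ => C) ?_ ?_
    (integrableOn_const hAf) ?_
  · filter_upwards [self_mem_nhdsWithin] with y hy
    exact (aestronglyMeasurable_of_continuousOn hΩ (hw.continuousOn_deriv hΩ hy) hA).const_mul _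
  · filter_upwards [Ioc_mem_nhdsGT (zero_lt_one' ℝ)] with y hy
    exact (ae_restrict_iff' hAm).2 (ae_of_all _ fun x hx => hC x (hA hx) y hy)
  · exact (ae_restrict_iff' hAm).2 (ae_of_all _ fun x hx => hw.neumann x (hA hx))

lemma IsExtSol.integral_pde (hw : IsExtSol α Ω f w) (hΩ : IsOpen Ω)
    {A : Set (Euc N)} (hA : A ⊆ Ω) (hAm : MeasurableSet A) (hAf : volume A ≠ ⊤) {y : ℝ}
    (hy : 0 < y) :
    (∫ x in A, lapx w x y) + (1 - α) / y * (∫ x in A, deriv (w x) y) +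
      ∫ x in A, deriv (deriv (w x)) y = 0 := by
  obtain ⟨M, -, -, h1, h2, -, h3⟩ := hw.exists_bound hΩ
  have i1 := integrableOn_of_continuousOn hΩ (hw.continuousOn_lapx hΩ hy) hA hAm hAf
    fun x hx => h3 x hx y hy
  have i2 := integrableOn_of_continuousOn hΩ (hw.continuousOn_deriv hΩ hy) hA hAm hAf
    fun x hx => h1 x hx y hy
  have i3 := integrableOn_of_continuousOn hΩ (hw.continuousOn_deriv_deriv hΩ hy) hA hAm hAf
    fun x hx => h2 x hx y hy
  have i4 : IntegrableOn (fun x => lapx w x y + (1 - α) / y * deriv (w x) y) A :=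
    i1.add (i2.const_mul _)
  rw [← integral_const_mul, ← integral_add i1 (i2.const_mul _), ← integral_add i4 i3]
  exact setIntegral_eq_zero_of_forall_eq_zero fun x hx => hw.pde x (hA hx) y hy

end

lemma kappa_pos {α : ℝ} (hα : α ∈ Ioo (0 : ℝ) 2) : 0 < kappa α := by
  unfold kappa
  have h1 := Real.Gamma_pos_of_pos (show 0 < 1 - α / 2 by linarith [hα.2])
  have h2 := Real.Gamma_pos_of_pos (show 0 < α / 2 by linarith [hα.1])
  have h3 : (0 : ℝ) < 2 ^ (1 - α) := by positivity
  positivity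

/-- Two solutions whose data are ordered in mean cannot have a difference of means, corrected by
`δ y ^ α`, which is maximal at a point where the means of the Laplacians are strictly ordered. -/
lemma false_of_isMax_integral {N : ℕ} {α : ℝ} (hα : α ∈ Ioo (0 : ℝ) 2) {Ω Ω' : Set (Euc N)}
    {f g : Euc N → ℝ} {w v : Euc N → ℝ → ℝ} (hw : IsExtSol α Ω f w) (hv : IsExtSol α Ω' g v)
    (hΩ : IsOpen Ω) (hΩ' : IsOpen Ω') {A B : Set (Euc N)} (hA : A ⊆ Ω) (hB : B ⊆ Ω')
    (hAm : MeasurableSet A) (hBm : MeasurableSet B) (hAf : volume A ≠ ⊤) (hBf : volume B ≠ ⊤)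
    {δ : ℝ} (hδ : 0 < δ) {y₀ Y : ℝ} (hy₀ : 0 ≤ y₀) (hY : y₀ < Y)
    (hmax : ∀ y ∈ Icc 0 Y, (∫ x in A, w x y) - (∫ x in B, v x y) + δ * y ^ α ≤
      (∫ x in A, w x y₀) - (∫ x in B, v x y₀) + δ * y₀ ^ α)
    (hdata : ∫ x in A, f x ≤ ∫ x in B, g x)
    (hlap : 0 < y₀ → ∫ x in A, lapx w x y₀ < ∫ x in B, lapx v x y₀) : False := by
  set G : ℝ → ℝ := fun y => (∫ x in A, w x y) - (∫ x in B, v x y) + δ * y ^ α with hG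
  set J : ℝ → ℝ := fun y => (∫ x in A, deriv (w x) y) - ∫ x in B, deriv (v x) y with hJ
  set H : ℝ → ℝ := fun y => y ^ (1 - α) * J y + δ * α with hH
  have dG : ∀ y, 0 < y → HasDerivAt G (y ^ (α - 1) * H y) y := by
    intro y hy
    have h1 := ((hw.hasDerivAt_integral hΩ hA hAm hAf hy).sub
      (hv.hasDerivAt_integral hΩ' hB hBm hBf hy)).add
      ((Real.hasDerivAt_rpow_const (p := α) (Or.inl hy.ne')).const_mul δ)
    refine h1.congr_deriv ?_
    have : y ^ (α - 1) * y ^ (1 - α) = 1 := by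
      rw [← Real.rpow_add hy]; simp
    simp only [hH, hJ]
    linear_combination (-1 : ℝ) * ((∫ x in A, deriv (w x) y) - ∫ x in B, deriv (v x) y) * this
  have hcont : ContinuousOn G (Ici 0) :=
    ((hw.continuousOn_integral hΩ hA hAm hAf).sub (hv.continuousOn_integral hΩ' hB hBm hBf)).add
      (continuousOn_const.mul (Real.continuous_rpow_const hα.1.le).continuousOn)
  have hpos : ∀ᶠ y in nhdsWithin y₀ (Ioi y₀), 0 < H y := by
    rcases hy₀.eq_or_lt with h0 | h0
    · rw [← h0]
      have t1 := (hw.tendsto_integral_neumann hΩ hα.2 hA hAm hAf).sub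
        (hv.tendsto_integral_neumann hΩ' hα.2 hB hBm hBf)
      have t2 : Tendsto H (nhdsWithin 0 (Ioi 0)) (nhds (-(kappa α) * (∫ x in A, f x) -
          -(kappa α) * (∫ x in B, g x) + δ * α)) := by
        refine (t1.add_const (δ * α)).congr fun y => ?_
        simp only [hH, hJ]; ring
      refine t2.eventually (lt_mem_nhds ?_)
      have := mul_le_mul_of_nonneg_left hdata (kappa_pos hα).le
      have := mul_pos hδ hα.1
      linarith
    · have hloc : IsLocalMax G y₀ := by
        filter_upwards [Icc_mem_nhds h0 hY] with y hy using hmax y hy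
      have hz := hloc.hasDerivAt_eq_zero (dG y₀ h0)
      have hH0 : H y₀ = 0 := by
        have : y₀ ^ (α - 1) ≠ 0 := (Real.rpow_pos_of_pos h0 _).ne'
        simpa [this] using hz
      have dJ : HasDerivAt J ((∫ x in A, deriv (deriv (w x)) y₀) -
          ∫ x in B, deriv (deriv (v x)) y₀) y₀ :=
        (hw.hasDerivAt_integral_deriv hΩ hA hAm hAf h0).sub
          (hv.hasDerivAt_integral_deriv hΩ' hB hBm hBf h0)
      have dH : HasDerivAt H (y₀ ^ (1 - α) * ((∫ x in B, lapx v x y₀) - ∫ x in A, lapx w x y₀))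
          y₀ := by
        have h1 := ((Real.hasDerivAt_rpow_const (p := 1 - α) (Or.inl h0.ne')).mul dJ).add_const
          (δ * α)
        refine h1.congr_deriv ?_
        have p1 := hw.integral_pde hΩ hA hAm hAf h0
        have p2 := hv.integral_pde hΩ' hB hBm hBf h0
        have e : y₀ ^ (1 - α - 1) = y₀ ^ (1 - α) / y₀ := Real.rpow_sub_one h0.ne' _
        rw [e]
        simp only [hJ]
        linear_combination y₀ ^ (1 - α) * p1 - y₀ ^ (1 - α) * p2
      have hd : 0 < y₀ ^ (1 - α) * ((∫ x in B, lapx v x y₀) - ∫ x in A, lapx w x y₀) :=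
        mul_pos (Real.rpow_pos_of_pos h0 _) (sub_pos.2 (hlap h0))
      have hs := (hasDerivAt_iff_tendsto_slope.1 dH).mono_left
        (nhdsWithin_mono y₀ (fun y (hy : y₀ < y) => hy.ne'))
      filter_upwards [hs.eventually (lt_mem_nhds hd), self_mem_nhdsWithin] with y hy1 hy2
      rw [slope_def_field, hH0, sub_zero] at hy1
      have hy2' : 0 < y - y₀ := sub_pos.2 hy2
      exact (div_pos_iff_of_pos_right hy2').1 hy1
  obtain ⟨z, hz, hz'⟩ := mem_nhdsGT_iff_exists_Ioo_subset.1 hpos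
  obtain ⟨b, hb1, hb2⟩ := exists_between (lt_min hz hY)
  have hmono : StrictMonoOn G (Icc y₀ b) := by
    refine strictMonoOn_of_deriv_pos (convex_Icc _ _)
      (hcont.mono fun y hy => hy₀.trans hy.1) fun y hy => ?_
    rw [interior_Icc] at hy
    have hy0 : 0 < y := hy₀.trans_lt hy.1
    rw [(dG y hy0).deriv]
    exact mul_pos (Real.rpow_pos_of_pos hy0 _)
      (hz' ⟨hy.1, hy.2.trans (hb2.trans_le (min_le_left _ _))⟩)
  have h1 := hmono (left_mem_Icc.2 hb1.le) (right_mem_Icc.2 hb1.le) hb1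
  have h2 := hmax b ⟨hy₀.trans hb1.le, (hb2.trans_le (min_le_right _ _)).le⟩
  exact absurd h1 (not_lt.2 h2)

section
variable {N : ℕ}

lemma setIntegral_unitBall_comp (T : Euc N ≃ₗᵢ[ℝ] Euc N) (F : Euc N → ℝ) :
    ∫ ζ in Metric.ball (0 : Euc N) 1, F (T ζ) = ∫ ζ in Metric.ball (0 : Euc N) 1, F ζ := by
  have h := T.measurePreserving.setIntegral_preimage_emb T.toHomeomorph.measurableEmbedding F
    (Metric.ball 0 1)
  rwa [LinearIsometryEquiv.preimage_ball, map_zero] at h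

lemma integrableOn_unitBall {F : Euc N → ℝ} (hF : Continuous F) :
    IntegrableOn F (Metric.ball (0 : Euc N) 1) :=
  (hF.continuousOn.integrableOn_compact (isCompact_closedBall (0 : Euc N) 1)).mono_set
    Metric.ball_subset_closedBall

lemma setIntegral_unitBall_mul_eq_zero {i j : Fin N} (hij : i ≠ j) :
    ∫ ζ in Metric.ball (0 : Euc N) 1, ζ i * ζ j = 0 := by
  have h := setIntegral_unitBall_comp (LinearIsometryEquiv.piLpCongrRight 2 fun k : Fin N =>
    if k = i then LinearIsometryEquiv.neg ℝ else LinearIsometryEquiv.refl ℝ ℝ)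
    (fun ζ => ζ i * ζ j)
  simp only [LinearIsometryEquiv.piLpCongrRight_apply, if_pos, if_neg hij.symm,
    LinearIsometryEquiv.coe_neg, LinearIsometryEquiv.coe_refl, id, neg_mul] at h
  rw [integral_neg] at h
  linarith

lemma setIntegral_unitBall_sq_eq (i j : Fin N) :
    ∫ ζ in Metric.ball (0 : Euc N) 1, ζ i * ζ i = ∫ ζ in Metric.ball (0 : Euc N) 1, ζ j * ζ j := by
  have h := setIntegral_unitBall_comp (LinearIsometryEquiv.piLpCongrLeft 2 ℝ ℝ (Equiv.swap i j))
    (fun ζ => ζ i * ζ i)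
  simp only [LinearIsometryEquiv.piLpCongrLeft_apply, Equiv.piCongrLeft'_apply, Equiv.symm_swap,
    Equiv.swap_apply_left] at h
  exact h.symm

lemma setIntegral_unitBall_sq_pos (i : Fin N) :
    0 < ∫ ζ in Metric.ball (0 : Euc N) 1, ζ i * ζ i := by
  have hc : Continuous fun ζ : Euc N => ζ i * ζ i := by fun_prop
  rw [setIntegral_pos_iff_support_of_nonneg_ae (ae_of_all _ fun ζ => mul_self_nonneg _)
    (integrableOn_unitBall hc)]
  refine (hc.isOpen_support.inter Metric.isOpen_ball).measure_pos _
    ⟨(1 / 2 : ℝ) • EuclideanSpace.single i (1 : ℝ), ?_, ?_⟩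
  · simp
  · rw [mem_ball_zero_iff, norm_smul, PiLp.norm_single]; norm_num

/-- The mean of a quadratic form over the unit ball is a positive multiple of its trace. -/
lemma exists_setIntegral_unitBall_quadratic [Nontrivial (Euc N)] :
    ∃ c : ℝ, 0 < c ∧ ∀ Q : Euc N → Euc N → ℝ, (∀ z, IsLinearMap ℝ fun x => Q x z) →
      (∀ x, IsLinearMap ℝ (Q x)) →
      ∫ ζ in Metric.ball (0 : Euc N) 1, Q ζ ζ =
        c * ∑ i, Q (EuclideanSpace.single i 1) (EuclideanSpace.single i 1) := by
  have : Nonempty (Fin N) := by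
    by_contra h
    rw [not_nonempty_iff] at h
    exact not_subsingleton (Euc N) inferInstance
  obtain ⟨i₀⟩ := this
  refine ⟨_, setIntegral_unitBall_sq_pos i₀, fun Q h1 h2 => ?_⟩
  have e : ∀ ζ : Euc N, Q ζ ζ = ∑ i, ∑ j, ζ i * ζ j *
      Q (EuclideanSpace.single i 1) (EuclideanSpace.single j 1) := by
    intro ζ
    have hζ : ζ = ∑ i, ζ i • EuclideanSpace.single i (1 : ℝ) := by
      ext k; simp [Finset.sum_apply, Pi.single_apply]
    have a1 : ∀ z, Q ζ z = ∑ i, ζ i * Q (EuclideanSpace.single i 1) z := by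
      intro z
      have := map_sum ((h1 z).mk' _) (fun i => ζ i • EuclideanSpace.single i (1 : ℝ)) Finset.univ
      rw [← hζ] at this
      simpa [(h1 z).map_smul] using this
    have a2 : ∀ x, Q x ζ = ∑ j, ζ j * Q x (EuclideanSpace.single j 1) := by
      intro x
      have := map_sum ((h2 x).mk' _) (fun i => ζ i • EuclideanSpace.single i (1 : ℝ)) Finset.univ
      rw [← hζ] at this
      simpa [(h2 x).map_smul] using this
    rw [a1]
    refine Finset.sum_congr rfl fun i _ => ?_
    rw [a2, Finset.mul_sum]
    exact Finset.sum_congr rfl fun j _ => by ring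
  rw [integral_congr_ae (ae_of_all _ e)]
  rw [integral_finsetSum _ fun i _ => integrableOn_unitBall (by fun_prop), Finset.mul_sum]
  refine Finset.sum_congr rfl fun i _ => ?_
  rw [integral_finsetSum _ fun i _ => integrableOn_unitBall (by fun_prop),
    Finset.sum_eq_single i]
  · rw [integral_mul_const, setIntegral_unitBall_sq_eq i i₀]
  · intro j _ hj
    rw [integral_mul_const, setIntegral_unitBall_mul_eq_zero hj.symm, zero_mul]
  · simp

lemma abs_second_difference_le {φ φ' φ'' : ℝ → ℝ} {h a ε : ℝ} (hh : 0 ≤ h)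
    (h1 : ∀ s ∈ Icc (-h) h, HasDerivAt φ (φ' s) s)
    (h2 : ∀ s ∈ Icc (-h) h, HasDerivAt φ' (φ'' s) s)
    (h3 : ∀ s ∈ Icc (-h) h, |φ'' s - a| ≤ ε) :
    |φ h + φ (-h) - 2 * φ 0 - a * h ^ 2| ≤ 2 * ε * h ^ 2 := by
  have hε : 0 ≤ ε := (abs_nonneg _).trans (h3 h ⟨by linarith, le_rfl⟩)
  have n : ∀ {s}, s ∈ Icc 0 h → s ∈ Icc (-h) h ∧ -s ∈ Icc (-h) h := fun {s} hs =>
    ⟨⟨by linarith [hs.1], hs.2⟩, ⟨by linarith [hs.2], by linarith [hs.1]⟩⟩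
  have d1 : ∀ s ∈ Icc 0 h, HasDerivAt (fun s => φ s + φ (-s) - a * s ^ 2)
      (φ' s - φ' (-s) - 2 * a * s) s := by
    intro s hs
    have := ((h1 s (n hs).1).add ((h1 (-s) (n hs).2).comp s (hasDerivAt_neg s))).sub
      ((hasDerivAt_pow 2 s).const_mul a)
    refine this.congr_deriv ?_
    simp; ring
  have d2 : ∀ s ∈ Icc 0 h, HasDerivAt (fun s => φ' s - φ' (-s) - 2 * a * s)
      (φ'' s + φ'' (-s) - 2 * a) s := by
    intro s hs
    have := ((h2 s (n hs).1).sub ((h2 (-s) (n hs).2).comp s (hasDerivAt_neg s))).sub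
      ((hasDerivAt_id s).const_mul (2 * a))
    refine this.congr_deriv ?_
    simp
  have b1 : ∀ s ∈ Icc 0 h, ‖φ' s - φ' (-s) - 2 * a * s‖ ≤ 2 * ε * h := by
    intro s hs
    have := norm_image_sub_le_of_norm_deriv_le_segment' (C := 2 * ε)
      (fun t ht => (d2 t ht).hasDerivWithinAt) (fun t ht => ?_) s hs
    · simp only [neg_zero, sub_self, mul_zero, sub_zero] at this
      exact this.trans (mul_le_mul_of_nonneg_left hs.2 (by positivity))
    · have ht' : t ∈ Icc 0 h := ⟨ht.1, ht.2.le⟩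
      rw [Real.norm_eq_abs]
      have e1 := h3 t (n ht').1
      have e2 := h3 (-t) (n ht').2
      rw [abs_le] at *
      constructor <;> linarith
  have := norm_image_sub_le_of_norm_deriv_le_segment' (C := 2 * ε * h)
      (fun t ht => (d1 t ht).hasDerivWithinAt) (fun t ht => b1 t ⟨ht.1, ht.2.le⟩) h ⟨hh, le_rfl⟩
  rw [Real.norm_eq_abs] at this
  calc _ = |φ h + φ (-h) - a * h ^ 2 - (φ 0 + φ (-0) - a * 0 ^ 2)| := by
        congr 1; simp; ring
    _ ≤ _ := this
    _ = _ := by ring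

/-- Second-order expansion of ball averages, integrated over a set. -/
lemma tendsto_integral_average {g : Euc N → ℝ} (hg : Measurable g) {C : ℝ} (hgC : ∀ x, |g x| ≤ C)
    {A : Set (Euc N)} (hA : MeasurableSet A) (hAf : volume A ≠ ⊤) {q : Euc N → Euc N → ℝ}
    (hlim : ∀ x ∈ A, ∀ ζ ∈ Metric.ball (0 : Euc N) 1, Tendsto (fun h : ℝ =>
      (g (x + h • ζ) + g (x + h • -ζ) - 2 * g x) / h ^ 2) (nhdsWithin 0 (Ioi 0)) (nhds (q x ζ)))
    {D : ℝ} (hbd : ∀ᶠ h in nhdsWithin (0 : ℝ) (Ioi 0), ∀ x ∈ A, ∀ ζ ∈ Metric.ball (0 : Euc N) 1,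
      |(g (x + h • ζ) + g (x + h • -ζ) - 2 * g x) / h ^ 2| ≤ D) :
    Tendsto (fun h : ℝ => (∫ x in A, ∫ z in Metric.ball x h, (g z - g x)) / h ^ (N + 2))
      (nhdsWithin 0 (Ioi 0))
      (nhds (2⁻¹ * ∫ x in A, ∫ ζ in Metric.ball (0 : Euc N) 1, q x ζ)) := by
  have hB : volume (Metric.ball (0 : Euc N) 1) ≠ ⊤ := measure_ball_lt_top.ne
  have hbi : ∀ G : Euc N → ℝ, Measurable G → (∀ z, |G z| ≤ C) →
      IntegrableOn G (Metric.ball (0 : Euc N) 1) := fun G hG hGC =>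
    (integrableOn_const (C := C) hB).mono' hG.aestronglyMeasurable (ae_of_all _ hGC)
  have key : ∀ h : ℝ, 0 < h → ∀ x, ∫ z in Metric.ball x h, (g z - g x) =
      h ^ (N + 2) * (2⁻¹ * ∫ ζ in Metric.ball (0 : Euc N) 1,
        (g (x + h • ζ) + g (x + h • -ζ) - 2 * g x) / h ^ 2) := by
    intro h hh x
    have m1 : Measurable fun ζ : Euc N => g (x + h • ζ) := hg.comp (by fun_prop)
    have m2 : Measurable fun ζ : Euc N => g (x + h • -ζ) := hg.comp (by fun_prop)
    have i1 := hbi _ m1 fun ζ => hgC _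
    have i2 := hbi _ m2 fun ζ => hgC _
    have i3 : IntegrableOn (fun _ : Euc N => g x) (Metric.ball (0 : Euc N) 1) :=
      integrableOn_const hB
    have e1 : ∫ z in Metric.ball x h, (g z - g x) =
        h ^ N * ∫ ζ in Metric.ball (0 : Euc N) 1, (g (x + h • ζ) - g x) := by
      have t := (measurePreserving_add_left (volume : Measure (Euc N)) x).setIntegral_preimage_emb
        (Homeomorph.addLeft x).measurableEmbedding (fun z => g z - g x) (Metric.ball x h)
      have t2 := Measure.setIntegral_comp_smul_of_pos (volume : Measure (Euc N))
        (fun z => g (x + z) - g x) (Metric.ball (0 : Euc N) 1) hh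
      have e3 : (fun z => x + z) ⁻¹' Metric.ball x h = Metric.ball 0 h := by
        ext z; simp [dist_eq_norm]
      rw [e3] at t
      rw [smul_unitBall_of_pos hh] at t2
      rw [← t, t2, finrank_euclideanSpace_fin, smul_eq_mul, mul_inv_cancel_left₀ (by positivity)]
    have e2 : ∫ ζ in Metric.ball (0 : Euc N) 1, (g (x + h • ζ) - g x) =
        ∫ ζ in Metric.ball (0 : Euc N) 1, (g (x + h • -ζ) - g x) :=
      (setIntegral_unitBall_comp (LinearIsometryEquiv.neg ℝ) fun ζ => g (x + h • ζ) - g x).symm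
    have e4 : ∫ ζ in Metric.ball (0 : Euc N) 1,
        (g (x + h • ζ) + g (x + h • -ζ) - 2 * g x) / h ^ 2 =
        ((∫ ζ in Metric.ball (0 : Euc N) 1, (g (x + h • ζ) - g x)) +
        ∫ ζ in Metric.ball (0 : Euc N) 1, (g (x + h • -ζ) - g x)) / h ^ 2 := by
      have i4 : IntegrableOn (fun ζ => g (x + h • ζ) - g x) (Metric.ball (0 : Euc N) 1) := i1.sub i3
      have i5 : IntegrableOn (fun ζ => g (x + h • -ζ) - g x) (Metric.ball (0 : Euc N) 1) :=
        i2.sub i3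
      rw [integral_div, ← integral_add i4 i5]
      congr 2; ext ζ; ring
    rw [e1, e4, ← e2]
    have := hh.ne'
    field_simp
    ring
  have h2 : Tendsto (fun h : ℝ => ∫ x in A, ∫ ζ in Metric.ball (0 : Euc N) 1,
        (g (x + h • ζ) + g (x + h • -ζ) - 2 * g x) / h ^ 2) (nhdsWithin 0 (Ioi 0))
      (nhds (∫ x in A, ∫ ζ in Metric.ball (0 : Euc N) 1, q x ζ)) := by
    refine tendsto_integral_filter_of_dominated_convergence
      (fun _ => D * (volume.real (Metric.ball (0 : Euc N) 1))) ?_ ?_ (integrableOn_const hAf) ?_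
    · refine Eventually.of_forall fun h => ?_
      have m : Measurable fun p : Euc N × Euc N =>
          (g (p.1 + h • p.2) + g (p.1 + h • -p.2) - 2 * g p.1) / h ^ 2 :=
        (((hg.comp (by fun_prop)).add (hg.comp (by fun_prop))).sub
          ((hg.comp measurable_fst).const_mul 2)).div_const _
      exact (m.stronglyMeasurable.integral_prod_right
        (ν := volume.restrict (Metric.ball (0 : Euc N) 1))).aestronglyMeasurable
    · filter_upwards [hbd] with h hh
      refine (ae_restrict_iff' hA).2 (ae_of_all _ fun x hx => ?_)
      exact norm_setIntegral_le_of_norm_le_const measure_ball_lt_top fun ζ hζ => hh x hx ζ hζ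
    · refine (ae_restrict_iff' hA).2 (ae_of_all _ fun x hx => ?_)
      refine tendsto_integral_filter_of_dominated_convergence (fun _ => D) ?_ ?_
        (integrableOn_const hB) ?_
      · refine Eventually.of_forall fun h => Measurable.aestronglyMeasurable ?_
        exact (((hg.comp (by fun_prop)).add (hg.comp (by fun_prop))).sub_const _).div_const _
      · filter_upwards [hbd] with h hh
        exact (ae_restrict_iff' measurableSet_ball).2 (ae_of_all _ fun ζ hζ => hh x hx ζ hζ)
      · exact (ae_restrict_iff' measurableSet_ball).2 (ae_of_all _ fun ζ hζ => hlim x hx ζ hζ)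
  refine (h2.const_mul 2⁻¹).congr' ?_
  filter_upwards [self_mem_nhdsWithin] with h hh
  have hh' : (0 : ℝ) < h := hh
  simp_rw [key h hh', integral_const_mul]
  field_simp
end

section
variable {N : ℕ} {α : ℝ} {Ω : Set (Euc N)} {f : Euc N → ℝ} {w : Euc N → ℝ → ℝ}

lemma IsExtSol.tendsto_second_difference (hw : IsExtSol α Ω f w) (hΩ : IsOpen Ω) {x : Euc N}
    (hx : x ∈ Ω) {y : ℝ} (hy : 0 < y) (ζ : Euc N) :
    Tendsto (fun h : ℝ => (w (x + h • ζ) y + w (x + h • -ζ) y - 2 * w x y) / h ^ 2)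
      (nhdsWithin 0 (Ioi 0)) (nhds (fderiv ℝ (fderiv ℝ (unc w)) (x, y) (ζ, 0) (ζ, 0))) := by
  have hc : ContinuousAt (fun s : ℝ =>
      fderiv ℝ (fderiv ℝ (unc w)) (x + s • ζ, y) (ζ, 0) (ζ, 0)) 0 := by
    have h1 : ContinuousAt (fderiv ℝ (fderiv ℝ (unc w))) (x + (0 : ℝ) • ζ, y) := by
      refine (hw.continuousOn_fderiv_fderiv hΩ).continuousAt (isOpen_cyl hΩ |>.mem_nhds ?_)
      simpa using ⟨hx, hy⟩
    have h2 : ContinuousAt (fun s : ℝ => fderiv ℝ (fderiv ℝ (unc w)) (x + s • ζ, y)) 0 :=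
      ContinuousAt.comp (f := fun s : ℝ => (x + s • ζ, y)) h1 (by fun_prop)
    exact (h2.clm_apply continuousAt_const).clm_apply continuousAt_const
  have hΩn : ∀ᶠ s : ℝ in nhds 0, x + s • ζ ∈ Ω := by
    have : ContinuousAt (fun s : ℝ => x + s • ζ) 0 := by fun_prop
    exact this.eventually_mem (hΩ.mem_nhds (by simpa using hx))
  rw [Metric.tendsto_nhds]
  intro ε hε
  have h3 := Metric.tendsto_nhds.1 hc.tendsto (ε / 3) (by positivity)
  obtain ⟨r, hr, hr'⟩ := Metric.eventually_nhds_iff.1 (h3.and hΩn)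
  filter_upwards [Ioo_mem_nhdsGT hr] with h hh
  have hin : ∀ s ∈ Icc (-h) h, dist s 0 < r := fun s hs => by
    rw [dist_zero_right, Real.norm_eq_abs]
    exact (abs_le.2 hs).trans_lt hh.2
  have key := abs_second_difference_le (φ := fun s => w (x + s • ζ) y)
    (a := fderiv ℝ (fderiv ℝ (unc w)) (x, y) (ζ, 0) (ζ, 0)) (ε := ε / 3) hh.1.le
    (fun s hs => hw.hasDerivAt_x hΩ (hr' (hin s hs)).2 hy)
    (fun s hs => hw.hasDerivAt_fderiv_x hΩ (hr' (hin s hs)).2 hy)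
    (fun s hs => by
      have := (hr' (hin s hs)).1.le
      rw [Real.dist_eq] at this
      simpa using this)
  have hp : 0 < h ^ 2 := pow_pos hh.1 2
  rw [Real.dist_eq, div_sub' hp.ne', abs_div, abs_of_pos hp, div_lt_iff₀ hp]
  have e : w (x + h • ζ) y + w (x + h • -ζ) y - 2 * w x y -
      h ^ 2 * (fderiv ℝ (fderiv ℝ (unc w)) (x, y)) (ζ, 0) (ζ, 0) =
      w (x + h • ζ) y + w (x + (-h) • ζ) y - 2 * w (x + (0 : ℝ) • ζ) y -
      (fderiv ℝ (fderiv ℝ (unc w)) (x, y)) (ζ, 0) (ζ, 0) * h ^ 2 := by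
    simp [mul_comm]
  rw [e]
  refine key.trans_lt ?_
  nlinarith [mul_pos hε hp]

lemma measurable_indicator_of_continuousOn (hΩ : IsOpen Ω) {g : Euc N → ℝ}
    (hg : ContinuousOn g Ω) : Measurable (Ω.indicator g) := by
  classical
  rw [← piecewise_eq_indicator]
  exact hg.measurable_piecewise continuousOn_const hΩ.measurableSet

lemma second_difference_norm_sq (x ζ : Euc N) (h : ℝ) :
    ‖x + h • ζ‖ ^ 2 + ‖x + h • -ζ‖ ^ 2 - 2 * ‖x‖ ^ 2 = 2 * ‖ζ‖ ^ 2 * h ^ 2 := by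
  rw [norm_add_sq_real, norm_add_sq_real, smul_neg, inner_neg_right, norm_neg, norm_smul,
    Real.norm_eq_abs, mul_pow, sq_abs]
  ring

lemma IsExtSol.tendsto_average (hw : IsExtSol α Ω f w) (hΩ : IsOpen Ω)
    (hΩb : Bornology.IsBounded Ω) {A K : Set (Euc N)} (hA : MeasurableSet A) (hAK : A ⊆ K)
    (hK : IsCompact K) (hKΩ : K ⊆ Ω) {y : ℝ} (hy : 0 < y) {ε : ℝ} (hε : 0 ≤ ε) {c : ℝ}
    (hc : ∀ Q : Euc N → Euc N → ℝ, (∀ z, IsLinearMap ℝ fun x => Q x z) →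
      (∀ x, IsLinearMap ℝ (Q x)) →
      ∫ ζ in Metric.ball (0 : Euc N) 1, Q ζ ζ =
        c * ∑ i, Q (EuclideanSpace.single i 1) (EuclideanSpace.single i 1)) :
    Tendsto (fun h : ℝ => (∫ x in A, ∫ z in Metric.ball x h,
        (Ω.indicator (fun x => w x y - ε * ‖x‖ ^ 2) z -
          Ω.indicator (fun x => w x y - ε * ‖x‖ ^ 2) x)) / h ^ (N + 2))
      (nhdsWithin 0 (Ioi 0))
      (nhds (2⁻¹ * (c * ∫ x in A, (lapx w x y - 2 * N * ε)))) := by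
  obtain ⟨M, hM, hb, -, -, hb2, -⟩ := hw.exists_bound hΩ
  obtain ⟨R, hR⟩ := hΩb.exists_norm_le
  obtain ⟨h₀, hh₀, hsub⟩ := hK.exists_cthickening_subset_open hΩ hKΩ
  have hmem : ∀ x ∈ A, ∀ ζ ∈ Metric.ball (0 : Euc N) 1, ∀ s : ℝ, |s| ≤ h₀ → x + s • ζ ∈ Ω := by
    intro x hx ζ hζ s hs
    refine hsub (Metric.mem_cthickening_of_dist_le _ x _ _ (hAK hx) ?_)
    rw [dist_eq_norm, add_sub_cancel_left, norm_smul, Real.norm_eq_abs]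
    have := mem_ball_zero_iff.1 hζ
    nlinarith [abs_nonneg s, norm_nonneg ζ]
  have hg : Measurable (Ω.indicator (fun x => w x y - ε * ‖x‖ ^ 2)) :=
    measurable_indicator_of_continuousOn hΩ
      (((hw.continuousOn_x hy.le).mono subset_closure).sub (by fun_prop))
  have hgC : ∀ x, |Ω.indicator (fun x => w x y - ε * ‖x‖ ^ 2) x| ≤ M + ε * R ^ 2 := by
    intro x
    by_cases hx : x ∈ Ω
    · rw [indicator_of_mem hx]
      have h1 := hb x (subset_closure hx) y hy.le
      have h2 : ‖x‖ ^ 2 ≤ R ^ 2 := pow_le_pow_left₀ (norm_nonneg _) (hR x hx) 2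
      refine (abs_sub _ _).trans (add_le_add h1 ?_)
      rw [abs_of_nonneg (by positivity)]
      gcongr
    · rw [indicator_of_notMem hx, abs_zero]; positivity
  have heq : ∀ h : ℝ, 0 < h → h ≤ h₀ → ∀ x ∈ A, ∀ ζ ∈ Metric.ball (0 : Euc N) 1,
      (Ω.indicator (fun x => w x y - ε * ‖x‖ ^ 2) (x + h • ζ) +
        Ω.indicator (fun x => w x y - ε * ‖x‖ ^ 2) (x + h • -ζ) -
        2 * Ω.indicator (fun x => w x y - ε * ‖x‖ ^ 2) x) / h ^ 2 =
      (w (x + h • ζ) y + w (x + h • -ζ) y - 2 * w x y) / h ^ 2 - 2 * ε * ‖ζ‖ ^ 2 := by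
    intro h hh hh' x hx ζ hζ
    have a1 := hmem x hx ζ hζ h (by rwa [abs_of_pos hh])
    have a2 : x + h • -ζ ∈ Ω := by
      have := hmem x hx ζ hζ (-h) (by rwa [abs_neg, abs_of_pos hh])
      simpa using this
    rw [indicator_of_mem a1, indicator_of_mem a2, indicator_of_mem (hKΩ (hAK hx))]
    have := second_difference_norm_sq x ζ h
    have hp := hh.ne'
    field_simp
    linear_combination (-ε) * this
  have hAf : volume A ≠ ⊤ := ((hK.isBounded.subset hAK).measure_lt_top).ne
  have main := tendsto_integral_average hg hgC hA hAf
    (q := fun x ζ => fderiv ℝ (fderiv ℝ (unc w)) (x, y) (ζ, 0) (ζ, 0) - 2 * ε * ‖ζ‖ ^ 2)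
    (D := 2 * M + 2 * ε) ?_ ?_
  · convert main using 3
    rw [← integral_const_mul]
    refine setIntegral_congr_fun hA fun x hx => ?_
    have hxΩ := hKΩ (hAK hx)
    have := hc (fun a b => fderiv ℝ (fderiv ℝ (unc w)) (x, y) (a, 0) (b, 0) -
      2 * ε * inner ℝ a b) (fun z => ?_) (fun z => ?_)
    · simp only [real_inner_self_eq_norm_sq] at this
      rw [this, hw.lapx_eq hΩ hxΩ hy]
      simp [Finset.sum_sub_distrib]
      left; ring
    · constructor
      · intro a b
        have : ((a + b, 0) : Euc N × ℝ) = (a, 0) + (b, 0) := by simp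
        simp only [this, map_add, add_apply, inner_add_left]; ring
      · intro r a
        have : ((r • a, 0) : Euc N × ℝ) = r • (a, 0) := by simp
        simp only [this, map_smul, smul_apply, inner_smul_left, smul_eq_mul]
        simp; ring
    · constructor
      · intro a b
        have : ((a + b, 0) : Euc N × ℝ) = (a, 0) + (b, 0) := by simp
        simp only [this, map_add, inner_add_right]; ring
      · intro r a
        have : ((r • a, 0) : Euc N × ℝ) = r • (a, 0) := by simp
        simp only [this, map_smul, inner_smul_right, smul_eq_mul]; ring
  · intro x hx ζ hζ
    refine ((hw.tendsto_second_difference hΩ (hKΩ (hAK hx)) hy ζ).sub_const _).congr' ?_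
    filter_upwards [Ioc_mem_nhdsGT hh₀] with h hh
    exact (heq h hh.1 hh.2 x hx ζ hζ).symm
  · filter_upwards [Ioc_mem_nhdsGT hh₀] with h hh x hx ζ hζ
    rw [heq h hh.1 hh.2 x hx ζ hζ]
    have hζ1 : ‖ζ‖ ^ 2 ≤ 1 := pow_le_one₀ (norm_nonneg _) (mem_ball_zero_iff.1 hζ).le
    have hin : ∀ s ∈ Icc (-h) h, x + s • ζ ∈ Ω := fun s hs =>
      hmem x hx ζ hζ s ((abs_le.2 hs).trans hh.2)
    have key := abs_second_difference_le (φ := fun s => w (x + s • ζ) y) (a := 0) (ε := M) hh.1.le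
      (fun s hs => hw.hasDerivAt_x hΩ (hin s hs) hy)
      (fun s hs => hw.hasDerivAt_fderiv_x hΩ (hin s hs) hy)
      (fun s hs => by
        rw [sub_zero]
        refine (hb2 _ (hin s hs) y hy ζ).trans ?_
        nlinarith)
    refine (abs_sub _ _).trans (add_le_add ?_ ?_)
    · have hp : 0 < h ^ 2 := pow_pos hh.1 2
      rw [abs_div, abs_of_pos hp, div_le_iff₀ hp]
      simpa using key
    · rw [abs_of_nonneg (by positivity)]
      nlinarith
end

section
variable {N : ℕ} {Ω : Set (Euc N)} {f : Euc N → ℝ} {M : ℝ}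

lemma bddAbove_rearr_set (hfb : ∀ x ∈ Ω, |f x| ≤ M) (s : ℝ) :
    ∀ t ∈ {t : ℝ | 0 ≤ t ∧ ENNReal.ofReal s < volume {x | x ∈ Ω ∧ t < |f x|}}, t ≤ |M| := by
  rintro t ⟨-, h⟩
  obtain ⟨x, hx, hx'⟩ := nonempty_of_measure_ne_zero (pos_of_gt h).ne'
  exact (hx'.le.trans (hfb x hx)).trans (le_abs_self _)

lemma rearr_nonneg (s : ℝ) : 0 ≤ rearr Ω f s := Real.sSup_nonneg fun _ ht => ht.1

lemma rearr_le (hfb : ∀ x ∈ Ω, |f x| ≤ M) (s : ℝ) : rearr Ω f s ≤ |M| :=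
  Real.sSup_le (bddAbove_rearr_set hfb s) (abs_nonneg _)

lemma le_rearr (hfb : ∀ x ∈ Ω, |f x| ≤ M) {s t : ℝ} (ht : 0 ≤ t)
    (h : ENNReal.ofReal s < volume {x | x ∈ Ω ∧ t < |f x|}) : t ≤ rearr Ω f s :=
  le_csSup ⟨_, bddAbove_rearr_set hfb s⟩ ⟨ht, h⟩

lemma antitone_rearr (hfb : ∀ x ∈ Ω, |f x| ≤ M) : Antitone (rearr Ω f) := fun _ _ h =>
  Real.sSup_le (fun _ ht => le_rearr hfb ht.1 ((ENNReal.ofReal_le_ofReal h).trans_lt ht.2))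
    (rearr_nonneg _)

lemma measurable_schwarz (hfb : ∀ x ∈ Ω, |f x| ≤ M) : Measurable (schwarz Ω f) :=
  (antitone_rearr hfb).measurable.comp (by fun_prop)

/-- Hardy–Littlewood inequality for the Schwarz rearrangement. -/
lemma setIntegral_le_setIntegral_schwarz [Nontrivial (Euc N)] (hΩ : IsOpen Ω)
    (hΩb : Bornology.IsBounded Ω) (hfc : ContinuousOn f Ω) (hfb : ∀ x ∈ Ω, |f x| ≤ M)
    {A : Set (Euc N)} (hA : MeasurableSet A) (hAΩ : A ⊆ Ω) {r₀ : ℝ}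
    (hr : volume (Metric.ball (0 : Euc N) r₀) = volume A) :
    ∫ x in A, f x ≤ ∫ x in Metric.ball (0 : Euc N) r₀, schwarz Ω f x := by
  have hAf : volume A ≠ ⊤ := ((hΩb.subset hAΩ).measure_lt_top).ne
  have i1 := integrableOn_of_continuousOn hΩ hfc hAΩ hA hAf hfb
  have i2 : IntegrableOn (schwarz Ω f) (Metric.ball (0 : Euc N) r₀) :=
    (integrableOn_const (C := |M|) measure_ball_lt_top.ne).mono'
      (measurable_schwarz hfb).aestronglyMeasurable (ae_of_all _ fun x => by
        rw [Real.norm_eq_abs, schwarz, abs_of_nonneg (rearr_nonneg _)]; exact rearr_le hfb _)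
  have hn : ∀ x, 0 ≤ schwarz Ω f x := fun x => rearr_nonneg _
  refine (integral_mono i1 i1.abs fun x => le_abs_self _).trans ?_
  rw [← ENNReal.ofReal_le_ofReal_iff (integral_nonneg hn),
    ofReal_integral_eq_lintegral_ofReal i1.abs (ae_of_all _ fun x => abs_nonneg _),
    ofReal_integral_eq_lintegral_ofReal i2 (ae_of_all _ hn),
    lintegral_eq_lintegral_meas_lt _ (ae_of_all _ fun x => abs_nonneg _)
      i1.abs.aestronglyMeasurable.aemeasurable,
    lintegral_eq_lintegral_meas_le _ (ae_of_all _ hn)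
      i2.aestronglyMeasurable.aemeasurable]
  refine setLIntegral_mono' measurableSet_Ioi fun t ht => ?_
  set S : Set (Euc N) := {x | x ∈ Ω ∧ t < |f x|} with hS
  have hSf : volume S ≠ ⊤ := ((hΩb.subset fun x hx => hx.1).measure_lt_top).ne
  have h1 : volume.restrict A {x | t < |f x|} ≤ min (volume A) (volume S) := by
    refine le_min ((measure_mono (subset_univ _)).trans (by simp)) ?_
    rw [Measure.restrict_apply' hA]
    exact measure_mono fun x hx => ⟨hAΩ hx.2, hx.1⟩
  refine h1.trans ?_
  have h2 : Metric.ball (0 : Euc N) (min (ballRad S) r₀) ⊆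
      {x | t ≤ schwarz Ω f x} ∩ Metric.ball 0 r₀ := by
    intro x hx
    rw [mem_ball_zero_iff, lt_min_iff] at hx
    refine ⟨le_rearr hfb (le_of_lt ht) ?_, mem_ball_zero_iff.2 hx.2⟩
    rw [← hS, ← volume_ball_ballRad hSf, volume_ball_eq_ofReal 0 (ballRad_nonneg S)]
    have h0 := (norm_nonneg x).trans_lt hx.1
    have hN : N ≠ 0 := by
      rintro rfl
      exact not_subsingleton (Euc 0) inferInstance
    have := pow_lt_pow_left₀ hx.1 (norm_nonneg x) hN
    refine (ENNReal.ofReal_lt_ofReal_iff (by have := omegaN_pos N; positivity)).2 ?_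
    exact mul_lt_mul_of_pos_left this (omegaN_pos N)
  rw [Measure.restrict_apply' measurableSet_ball]
  refine le_trans ?_ (measure_mono h2)
  rcases min_choice (ballRad S) r₀ with h | h <;> rw [h]
  · rw [volume_ball_ballRad hSf]; exact min_le_right _ _
  · rw [hr]; exact min_le_left _ _
end

section
variable {N : ℕ}

lemma integrableOn_setIntegral_ball {F : Euc N → Euc N → ℝ} (hF : Measurable (Function.uncurry F))
    {C : ℝ} (hC : ∀ x z, |F x z| ≤ C) {S : Set (Euc N)} (hSf : volume S ≠ ⊤) (h : ℝ) :
    IntegrableOn (fun x => ∫ z in Metric.ball x h, F x z) S := by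
  have hm : MeasurableSet {p : Euc N × Euc N | dist p.2 p.1 < h} :=
    measurableSet_lt (by fun_prop) measurable_const
  have e : (fun x => ∫ z in Metric.ball x h, F x z) = fun x => ∫ z,
      {p : Euc N × Euc N | dist p.2 p.1 < h}.indicator (Function.uncurry F) (x, z) := by
    funext x
    rw [← integral_indicator measurableSet_ball]
    rfl
  refine (integrableOn_const (C := C * volume.real (Metric.ball (0 : Euc N) h)) hSf).mono' ?_
    (ae_of_all _ fun x => ?_)
  · rw [e]
    exact ((hF.indicator hm).stronglyMeasurable.integral_prod_right'
      (ν := volume)).aestronglyMeasurable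
  · have := norm_setIntegral_le_of_norm_le_const (s := Metric.ball x h) (μ := volume)
      (f := F x) measure_ball_lt_top fun z _ => hC x z
    rwa [Measure.real, Measure.addHaar_ball_center] at this

lemma setLIntegral_setLIntegral_ball {F : Euc N → Euc N → ℝ}
    (hF : Measurable (Function.uncurry F)) (h0 : ∀ x z, 0 ≤ F x z)
    {C : ℝ} (hC : ∀ x z, F x z ≤ C) {S : Set (Euc N)} (hSf : volume S ≠ ⊤) (h : ℝ) :
    ∫⁻ x in S, ∫⁻ z in Metric.ball x h, ENNReal.ofReal (F x z) =
      ENNReal.ofReal (∫ x in S, ∫ z in Metric.ball x h, F x z) := by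
  have hC' : ∀ x z, |F x z| ≤ C := fun x z => by rw [abs_of_nonneg (h0 x z)]; exact hC x z
  rw [ofReal_integral_eq_lintegral_ofReal (integrableOn_setIntegral_ball hF hC' hSf h)
    (ae_of_all _ fun x => integral_nonneg fun z => h0 x z)]
  refine lintegral_congr fun x => ?_
  rw [ofReal_integral_eq_lintegral_ofReal _ (ae_of_all _ fun z => h0 x z)]
  exact (integrableOn_const (C := C) measure_ball_lt_top.ne).mono'
    (hF.comp measurable_prodMk_left).aestronglyMeasurable (ae_of_all _ fun z => hC' x z)

lemma integrable_ball_of_bounded {G : Euc N → ℝ} (hG : Measurable G) {C : ℝ}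
    (hC : ∀ x, |G x| ≤ C) (x : Euc N) (h : ℝ) : IntegrableOn G (Metric.ball x h) :=
  (integrableOn_const (C := C) measure_ball_lt_top.ne).mono' hG.aestronglyMeasurable
    (ae_of_all _ hC)

/-- Real-valued form of `lintegral_average_comparison`. -/
lemma integral_average_comparison [Nontrivial (Euc N)] {h r₀ R : ℝ}
    {A : Set (Euc N)} (hA : MeasurableSet A) (hAb : Bornology.IsBounded A)
    (hr₀ : volume (Metric.ball (0 : Euc N) r₀) = volume A) (hR : r₀ + h ≤ R) (hR0 : 0 ≤ R)
    {u q : Euc N → ℝ} {C : ℝ} (hu : Measurable u) (hu0 : ∀ x, 0 ≤ u x) (huC : ∀ x, u x ≤ C)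
    (hub : Bornology.IsBounded (Function.support u))
    (hq : Measurable q) (hq0 : ∀ x, 0 ≤ q x) (hqC : ∀ x, q x ≤ C)
    (hmax : ∀ ρ ∈ Icc 0 R, rearrInt u (volume (Metric.ball (0 : Euc N) ρ)) +
      (∫⁻ x in Metric.ball (0 : Euc N) r₀, ENNReal.ofReal (q x)) ≤
      (∫⁻ x in Metric.ball (0 : Euc N) ρ, ENNReal.ofReal (q x)) +
        ∫⁻ x in A, ENNReal.ofReal (u x)) :
    ∫ x in A, ∫ z in Metric.ball x h, (u z - u x) ≤
      ∫ x in Metric.ball (0 : Euc N) r₀, ∫ z in Metric.ball x h, (q z - q x) := by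
  have hAf : volume A ≠ ⊤ := hAb.measure_lt_top.ne
  have hBf : volume (Metric.ball (0 : Euc N) r₀) ≠ ⊤ := measure_ball_lt_top.ne
  have main := lintegral_average_comparison (h := h) hA hAb hr₀ hR hR0 hu hu0 hub
    hq.ennreal_ofReal hmax
  have conv : ∀ {G : Euc N → ℝ}, Measurable G → ∀ S : Set (Euc N),
      volume (Metric.ball (0 : Euc N) h) * (∫⁻ x in S, ENNReal.ofReal (G x)) =
      ∫⁻ x in S, ∫⁻ z in Metric.ball x h, ENNReal.ofReal (G x) := by
    intro G hG S
    rw [← lintegral_const_mul _ hG.ennreal_ofReal]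
    refine lintegral_congr fun x => ?_
    rw [setLIntegral_const, Measure.addHaar_ball_center volume x, mul_comm]
  rw [conv hq, conv hu,
    setLIntegral_setLIntegral_ball (F := fun _ z => u z) (hu.comp measurable_snd)
      (fun _ z => hu0 z) (fun _ z => huC z) hAf,
    setLIntegral_setLIntegral_ball (F := fun _ z => q z) (hq.comp measurable_snd)
      (fun _ z => hq0 z) (fun _ z => hqC z) hBf,
    setLIntegral_setLIntegral_ball (F := fun x _ => u x) (hu.comp measurable_fst)
      (fun x _ => hu0 x) (fun x _ => huC x) hAf,
    setLIntegral_setLIntegral_ball (F := fun x _ => q x) (hq.comp measurable_fst)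
      (fun x _ => hq0 x) (fun x _ => hqC x) hBf] at main
  have nn : ∀ {F : Euc N → Euc N → ℝ} (S : Set (Euc N)), (∀ x z, 0 ≤ F x z) →
      0 ≤ ∫ x in S, ∫ z in Metric.ball x h, F x z := fun S hF =>
    integral_nonneg fun x => integral_nonneg fun z => hF x z
  rw [← ENNReal.ofReal_add (nn A fun _ z => hu0 z) (nn _ fun x _ => hq0 x),
    ← ENNReal.ofReal_add (nn _ fun _ z => hq0 z) (nn A fun x _ => hu0 x),
    ENNReal.ofReal_le_ofReal_iff (add_nonneg (nn _ fun _ z => hq0 z) (nn A fun x _ => hu0 x))]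
    at main
  have sub : ∀ {G : Euc N → ℝ}, Measurable G → (∀ x, 0 ≤ G x) → (∀ x, G x ≤ C) →
      ∀ S : Set (Euc N), volume S ≠ ⊤ → ∫ x in S, ∫ z in Metric.ball x h, (G z - G x) =
      (∫ x in S, ∫ z in Metric.ball x h, G z) - ∫ x in S, ∫ z in Metric.ball x h, G x := by
    intro G hG h0 hC S hS
    have hC' : ∀ x, |G x| ≤ C := fun x => by rw [abs_of_nonneg (h0 x)]; exact hC x
    rw [← integral_sub
      (integrableOn_setIntegral_ball (F := fun _ z => G z) (hG.comp measurable_snd)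
        (fun _ z => hC' z) hS h)
      (integrableOn_setIntegral_ball (F := fun x _ => G x) (hG.comp measurable_fst)
        (fun x _ => hC' x) hS h)]
    refine integral_congr_ae (ae_of_all _ fun x => ?_)
    exact integral_sub (integrable_ball_of_bounded hG hC' x h)
      (integrableOn_const measure_ball_lt_top.ne)
  rw [sub hu hu0 huC A hAf, sub hq hq0 hqC _ hBf]
  linarith

variable {α : ℝ} {Ω : Set (Euc N)} {f g : Euc N → ℝ} {w v : Euc N → ℝ → ℝ}

/-- Comparison of the means of the Laplacians at a maximum, in the radius, of the difference of the
rearranged integrals. -/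
lemma setIntegral_lapx_lt [Nontrivial (Euc N)] (hw : IsExtSol α Ω f w) (hΩ : IsOpen Ω)
    (hΩb : Bornology.IsBounded Ω) {R : ℝ} (hv : IsExtSol α (Metric.ball 0 R) g v)
    {y : ℝ} (hy : 0 < y) {ε τ C r₀ : ℝ} (hε : 0 < ε) (hr₀ : 0 < r₀) (hR : r₀ < R)
    {A K : Set (Euc N)} (hA : MeasurableSet A) (hAK : A ⊆ K) (hK : IsCompact K) (hKΩ : K ⊆ Ω)
    (hvol : volume (Metric.ball (0 : Euc N) r₀) = volume A)
    {u q : Euc N → ℝ} (hu : Measurable u) (hu0 : ∀ x, 0 ≤ u x) (huC : ∀ x, u x ≤ C)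
    (hub : Bornology.IsBounded (Function.support u)) (huw : ∀ x ∈ Ω, w x y - τ ≤ u x)
    (huA : ∀ x ∈ A, u x = w x y - τ)
    (hq : Measurable q) (hq0 : ∀ x, 0 ≤ q x) (hqC : ∀ x, q x ≤ C)
    (hqv : ∀ x ∈ Metric.ball 0 R, q x = v x y + ε * (R ^ 2 - ‖x‖ ^ 2))
    (hmax : ∀ ρ ∈ Icc 0 R, rearrInt u (volume (Metric.ball (0 : Euc N) ρ)) +
      (∫⁻ x in Metric.ball (0 : Euc N) r₀, ENNReal.ofReal (q x)) ≤
      (∫⁻ x in Metric.ball (0 : Euc N) ρ, ENNReal.ofReal (q x)) +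
        ∫⁻ x in A, ENNReal.ofReal (u x)) :
    ∫ x in A, lapx w x y < ∫ x in Metric.ball (0 : Euc N) r₀, lapx v x y := by
  obtain ⟨c, hc0, hc⟩ := exists_setIntegral_unitBall_quadratic (N := N)
  have hN : 0 < N := by
    rcases Nat.eq_zero_or_pos N with rfl | h
    · exact (not_subsingleton (Euc 0) inferInstance).elim
    · exact h
  have hAb : Bornology.IsBounded A := hK.isBounded.subset hAK
  have hR0 : 0 ≤ R := hr₀.le.trans hR.le
  have t1 := hw.tendsto_average hΩ hΩb hA hAK hK hKΩ hy le_rfl hc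
  have t2 := hv.tendsto_average Metric.isOpen_ball Metric.isBounded_ball measurableSet_ball
    (A := Metric.ball 0 r₀) Metric.ball_subset_closedBall (isCompact_closedBall (0 : Euc N) r₀)
    (Metric.closedBall_subset_ball hR) hy hε.le hc
  obtain ⟨h₀, hh₀, hsub⟩ := hK.exists_cthickening_subset_open hΩ hKΩ
  have hle : ∀ᶠ h in nhdsWithin (0 : ℝ) (Ioi 0),
      (∫ x in A, ∫ z in Metric.ball x h, (Ω.indicator (fun x => w x y - 0 * ‖x‖ ^ 2) z -
          Ω.indicator (fun x => w x y - 0 * ‖x‖ ^ 2) x)) / h ^ (N + 2) ≤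
      (∫ x in Metric.ball (0 : Euc N) r₀, ∫ z in Metric.ball x h,
        ((Metric.ball (0 : Euc N) R).indicator (fun x => v x y - ε * ‖x‖ ^ 2) z -
          (Metric.ball (0 : Euc N) R).indicator (fun x => v x y - ε * ‖x‖ ^ 2) x)) /
          h ^ (N + 2) := by
    filter_upwards [Ioc_mem_nhdsGT (lt_min hh₀ (sub_pos.2 hR))] with h hh
    have hhp : 0 < h := hh.1
    refine div_le_div_of_nonneg_right ?_ (by positivity)
    have main := integral_average_comparison (h := h) hA hAb hvol
      (by linarith [hh.2.trans (min_le_right _ _)]) hR0 hu hu0 huC hub hq hq0 hqC hmax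
    have hball : ∀ x ∈ A, Metric.ball x h ⊆ Ω := fun x hx z hz =>
      hsub (Metric.mem_cthickening_of_dist_le _ x _ _ (hAK hx)
        ((le_of_lt hz).trans (hh.2.trans (min_le_left _ _))))
    obtain ⟨M, hM, hb, -⟩ := hw.exists_bound hΩ
    have hgm : Measurable (Ω.indicator (fun x => w x y - 0 * ‖x‖ ^ 2)) :=
      measurable_indicator_of_continuousOn hΩ
        (((hw.continuousOn_x hy.le).mono subset_closure).sub (by fun_prop))
    have hgC : ∀ x, |Ω.indicator (fun x => w x y - 0 * ‖x‖ ^ 2) x| ≤ M := by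
      intro x
      by_cases hx : x ∈ Ω
      · rw [indicator_of_mem hx]
        simpa using hb x (subset_closure hx) y hy.le
      · rw [indicator_of_notMem hx, abs_zero]; exact hM.le
    have huC' : ∀ x, |u x| ≤ C := fun x => by rw [abs_of_nonneg (hu0 x)]; exact huC x
    have two : ∀ {G : Euc N → ℝ} {D : ℝ}, (∀ x, |G x| ≤ D) → ∀ x z, |G z - G x| ≤ D + D :=
      fun hG x z => (abs_sub _ _).trans (add_le_add (hG z) (hG x))
    have e1 : ∫ x in A, ∫ z in Metric.ball x h, (Ω.indicator (fun x => w x y - 0 * ‖x‖ ^ 2) z -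
          Ω.indicator (fun x => w x y - 0 * ‖x‖ ^ 2) x) ≤
        ∫ x in A, ∫ z in Metric.ball x h, (u z - u x) := by
      refine setIntegral_mono_on
        (integrableOn_setIntegral_ball
          ((hgm.comp measurable_snd).sub (hgm.comp measurable_fst)) (two hgC)
          hAb.measure_lt_top.ne h)
        (integrableOn_setIntegral_ball
          ((hu.comp measurable_snd).sub (hu.comp measurable_fst)) (two huC')
          hAb.measure_lt_top.ne h) hA fun x hx => ?_
      refine setIntegral_mono_on
        (integrable_ball_of_bounded (hgm.sub_const _) (fun z => two hgC x z) x h)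
        (integrable_ball_of_bounded (hu.sub_const _) (fun z => two huC' x z) x h)
        measurableSet_ball fun z hz => ?_
      rw [indicator_of_mem (hball x hx hz), indicator_of_mem (hKΩ (hAK hx)), huA x hx]
      linarith [huw z (hball x hx hz)]
    refine e1.trans (main.trans_eq ?_)
    refine setIntegral_congr_fun measurableSet_ball fun x hx => ?_
    refine setIntegral_congr_fun measurableSet_ball fun z hz => ?_
    have hx' : x ∈ Metric.ball (0 : Euc N) R := Metric.ball_subset_ball hR.le hx
    have hz' : z ∈ Metric.ball (0 : Euc N) R := by
      rw [Metric.mem_ball] at *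
      linarith [dist_triangle z x 0, hh.2.trans (min_le_right _ _)]
    rw [indicator_of_mem hx', indicator_of_mem hz', hqv x hx', hqv z hz']
    ring
  have hlim := le_of_tendsto_of_tendsto t1 t2 hle
  obtain ⟨M, -, -, -, -, -, hb⟩ := hv.exists_bound Metric.isOpen_ball
  have i1 := integrableOn_of_continuousOn Metric.isOpen_ball
    (hv.continuousOn_lapx Metric.isOpen_ball hy) (Metric.ball_subset_ball hR.le)
    measurableSet_ball measure_ball_lt_top.ne fun x hx => hb x hx y hy
  rw [integral_sub i1 (integrableOn_const measure_ball_lt_top.ne), setIntegral_const] at hlim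
  simp only [mul_zero, sub_zero, smul_eq_mul] at hlim
  have hvpos : 0 < volume.real (Metric.ball (0 : Euc N) r₀) :=
    ENNReal.toReal_pos (Metric.measure_ball_pos _ _ hr₀).ne' measure_ball_lt_top.ne
  have h3 := le_of_mul_le_mul_left (le_of_mul_le_mul_left hlim (by norm_num)) hc0
  have h4 : 0 < volume.real (Metric.ball (0 : Euc N) r₀) * (2 * N * ε) := by
    have : (0 : ℝ) < N := by exact_mod_cast hN
    positivity
  linarith
end

section
variable {N : ℕ}

lemma rearrInt_zero (u : Euc N → ℝ) : rearrInt u 0 = 0 := by simp [rearrInt]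

lemma rearrInt_ne_top {u : Euc N → ℝ} {M : ℝ} (hM : ∀ x, u x ≤ M) {s : ℝ≥0∞} (hs : s ≠ ⊤) :
    rearrInt u s ≠ ⊤ := by
  refine ne_top_of_le_ne_top ?_ (rearrInt_le_add hM (s := 0) (s' := s))
  rw [rearrInt_zero, zero_add, tsub_zero]
  exact ENNReal.mul_ne_top hs ENNReal.ofReal_ne_top

lemma toReal_rearrInt_ball_le [Nontrivial (Euc N)] {u u' : Euc N → ℝ} {M c r r' : ℝ}
    (hu : Measurable u) (hu0 : ∀ x, 0 ≤ u x) (hub : Bornology.IsBounded (Function.support u))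
    (hM : ∀ x, u x ≤ M) (hM0 : 0 ≤ M) (hu' : Measurable u') (hu0' : ∀ x, 0 ≤ u' x)
    (hM' : ∀ x, u' x ≤ M) (hc : 0 ≤ c)
    (huu : ∀ x, u x ≤ u' x + c) (hr : 0 ≤ r) (hr' : 0 ≤ r') :
    (rearrInt u (volume (Metric.ball (0 : Euc N) r))).toReal ≤
      (rearrInt u' (volume (Metric.ball (0 : Euc N) r'))).toReal +
        |omegaN N * r ^ N - omegaN N * r' ^ N| * M + omegaN N * r ^ N * c := by
  have hω := omegaN_pos N
  have h1 := rearrInt_le_add_of_le hu hu0 hub hM hu' hu0' huu (volume (Metric.ball (0 : Euc N) r))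
  have h2 := rearrInt_le_add hM' (s := volume (Metric.ball (0 : Euc N) r'))
    (s' := volume (Metric.ball (0 : Euc N) r))
  have h3 := ENNReal.ofReal_toReal (rearrInt_ne_top hM'
    (measure_ball_lt_top (μ := volume) (x := (0 : Euc N)) (r := r')).ne)
  refine ENNReal.toReal_le_of_le_ofReal (by positivity) ?_
  rw [ENNReal.ofReal_add (by positivity) (by positivity), ENNReal.ofReal_add (by positivity)
    (by positivity), h3, ENNReal.ofReal_mul (by positivity), ENNReal.ofReal_mul (by positivity),
    ← volume_ball_eq_ofReal (0 : Euc N) hr]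
  refine h1.trans (add_le_add (h2.trans (add_le_add le_rfl ?_)) le_rfl)
  refine mul_le_mul_left ?_ _
  rw [volume_ball_eq_ofReal _ hr, volume_ball_eq_ofReal _ hr',
    ← ENNReal.ofReal_sub _ (by positivity)]
  exact ENNReal.ofReal_le_ofReal (le_abs_self _)

lemma continuousOn_rearrInt [Nontrivial (Euc N)] {u : ℝ → Euc N → ℝ} {I : Set ℝ} {M R : ℝ}
    (hM0 : 0 ≤ M) (hu : ∀ y ∈ I, Measurable (u y)) (hu0 : ∀ y ∈ I, ∀ x, 0 ≤ u y x)
    (hub : ∀ y ∈ I, Bornology.IsBounded (Function.support (u y)))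
    (hM : ∀ y ∈ I, ∀ x, u y x ≤ M)
    (hunif : ∀ η > 0, ∃ δ > 0, ∀ y ∈ I, ∀ y' ∈ I, dist y y' < δ → ∀ x, u y x ≤ u y' x + η) :
    ContinuousOn (fun p : ℝ × ℝ =>
      (rearrInt (u p.2) (volume (Metric.ball (0 : Euc N) p.1))).toReal) (Icc 0 R ×ˢ I) := by
  have hω := omegaN_pos N
  rw [Metric.continuousOn_iff]
  rintro ⟨r, y⟩ ⟨hr, hy⟩ e he
  have hR : 0 ≤ R := hr.1.trans hr.2
  have hB : 0 < omegaN N * R ^ N + 1 := by positivity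
  obtain ⟨δ₁, hδ₁, h1⟩ := hunif (e / (2 * (omegaN N * R ^ N + 1))) (by positivity)
  have hcr : Continuous fun s : ℝ => |omegaN N * s ^ N - omegaN N * r ^ N| * M := by fun_prop
  obtain ⟨δ₂, hδ₂, h2⟩ := Metric.continuous_iff.1 hcr r (e / 2) (by positivity)
  refine ⟨min δ₁ δ₂, lt_min hδ₁ hδ₂, ?_⟩
  rintro ⟨s, z⟩ ⟨hs, hz⟩ hd
  rw [Prod.dist_eq, max_lt_iff] at hd
  have hd1 : dist z y < δ₁ := hd.2.trans_le (min_le_left _ _)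
  have h3 := h2 s (hd.1.trans_le (min_le_right _ _))
  simp only [sub_self, abs_zero, zero_mul, dist_zero_right, Real.norm_eq_abs] at h3
  have h4 := (le_abs_self _).trans_lt h3
  have h5 : ∀ t ∈ Icc 0 R, omegaN N * t ^ N * (e / (2 * (omegaN N * R ^ N + 1))) ≤ e / 2 := by
    intro t ht
    have : omegaN N * t ^ N ≤ omegaN N * R ^ N + 1 := by
      have := pow_le_pow_left₀ ht.1 ht.2 N
      nlinarith
    calc _ ≤ (omegaN N * R ^ N + 1) * (e / (2 * (omegaN N * R ^ N + 1))) := by gcongr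
      _ = e / 2 := by field_simp
  have a1 := toReal_rearrInt_ball_le (hu z hz) (hu0 z hz) (hub z hz) (hM z hz) hM0 (hu y hy)
    (hu0 y hy) (hM y hy) (by positivity) (h1 z hz y hy hd1) hs.1 hr.1
  have a2 := toReal_rearrInt_ball_le (hu y hy) (hu0 y hy) (hub y hy) (hM y hy) hM0 (hu z hz)
    (hu0 z hz) (hM z hz) (by positivity) (h1 y hy z hz (by rwa [dist_comm])) hr.1 hs.1
  rw [abs_sub_comm] at a2
  rw [Real.dist_eq, abs_lt]
  constructor <;> linarith [h5 s hs, h5 r hr]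

lemma setIntegral_ball_eq_smul (hN : N ≠ 0) (G : Euc N → ℝ) {r : ℝ} (hr : 0 ≤ r) :
    ∫ x in Metric.ball (0 : Euc N) r, G x =
      r ^ N * ∫ ζ in Metric.ball (0 : Euc N) 1, G (r • ζ) := by
  rcases hr.eq_or_lt with rfl | hr
  · simp [hN]
  · have t := Measure.setIntegral_comp_smul_of_pos (volume : Measure (Euc N)) G
      (Metric.ball (0 : Euc N) 1) hr
    rw [smul_unitBall_of_pos hr] at t
    rw [t, finrank_euclideanSpace_fin, smul_eq_mul, mul_inv_cancel_left₀ (by positivity)]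

variable {α : ℝ} {Ω : Set (Euc N)} {f g : Euc N → ℝ} {w v : Euc N → ℝ → ℝ}

lemma IsExtSol.continuousOn_setIntegral_ball [Nontrivial (Euc N)] {R : ℝ} (hR : 0 < R)
    (hv : IsExtSol α (Metric.ball 0 R) g v) (ε : ℝ) :
    ContinuousOn (fun p : ℝ × ℝ =>
      ∫ x in Metric.ball (0 : Euc N) p.1, (v x p.2 + ε * (R ^ 2 - ‖x‖ ^ 2)))
      (Icc 0 R ×ˢ Ici 0) := by
  have hN : N ≠ 0 := by
    rintro rfl
    exact not_subsingleton (Euc 0) inferInstance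
  obtain ⟨M, hM, hb, -⟩ := hv.exists_bound Metric.isOpen_ball
  have hmem : ∀ r ∈ Icc 0 R, ∀ ζ ∈ Metric.ball (0 : Euc N) 1,
      r • ζ ∈ closure (Metric.ball (0 : Euc N) R) := by
    intro r hr ζ hζ
    rw [closure_ball _ hR.ne', mem_closedBall_zero_iff, norm_smul, Real.norm_eq_abs,
      abs_of_nonneg hr.1]
    have := mem_ball_zero_iff.1 hζ
    nlinarith [norm_nonneg ζ, hr.1, hr.2]
  refine ContinuousOn.congr (f := fun p : ℝ × ℝ => p.1 ^ N *
    ∫ ζ in Metric.ball (0 : Euc N) 1, (v (p.1 • ζ) p.2 + ε * (R ^ 2 - ‖p.1 • ζ‖ ^ 2))) ?_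
    fun p hp => setIntegral_ball_eq_smul hN _ hp.1.1
  refine ContinuousOn.mul (by fun_prop) ?_
  have hcont : ∀ ζ ∈ Metric.ball (0 : Euc N) 1, ContinuousOn
      (fun p : ℝ × ℝ => v (p.1 • ζ) p.2 + ε * (R ^ 2 - ‖p.1 • ζ‖ ^ 2)) (Icc 0 R ×ˢ Ici 0) := by
    intro ζ hζ
    refine ContinuousOn.add ?_ (by fun_prop)
    exact hv.continuousOn_prod.comp (f := fun p : ℝ × ℝ => (p.1 • ζ, p.2)) (by fun_prop)
      fun p hp => ⟨hmem _ hp.1 ζ hζ, hp.2⟩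
  refine continuousOn_of_dominated (bound := fun _ => M + |ε| * R ^ 2) (fun p hp => ?_)
    (fun p hp => ?_) (integrableOn_const measure_ball_lt_top.ne)
    ((ae_restrict_iff' measurableSet_ball).2 (ae_of_all _ hcont))
  · refine ContinuousOn.aestronglyMeasurable ?_ measurableSet_ball
    refine ContinuousOn.add ?_ (by fun_prop)
    exact (hv.continuousOn_x hp.2).comp (f := fun ζ : Euc N => p.1 • ζ) (by fun_prop)
      fun ζ hζ => hmem _ hp.1 ζ hζ
  · refine (ae_restrict_iff' measurableSet_ball).2 (ae_of_all _ fun ζ hζ => ?_)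
    have h1 := hmem _ hp.1 ζ hζ
    have h2 := hb _ h1 p.2 hp.2
    rw [closure_ball _ hR.ne', mem_closedBall_zero_iff] at h1
    refine (abs_add_le _ _).trans (add_le_add h2 ?_)
    rw [abs_mul]
    have h3 : ‖p.1 • ζ‖ ^ 2 ≤ R ^ 2 := pow_le_pow_left₀ (norm_nonneg _) h1 2
    have h4 : |R ^ 2 - ‖p.1 • ζ‖ ^ 2| ≤ R ^ 2 := by
      rw [abs_of_nonneg (by linarith)]; linarith [sq_nonneg ‖p.1 • ζ‖]
    gcongr

/-- The truncation `(w(·, y) - τ)⁺`, extended by zero outside `Ω`. -/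
def excess (Ω : Set (Euc N)) (w : Euc N → ℝ → ℝ) (τ y : ℝ) (x : Euc N) : ℝ :=
  Ω.indicator (fun x => max (w x y - τ) 0) x

lemma excess_nonneg (τ y : ℝ) (x : Euc N) : 0 ≤ excess Ω w τ y x :=
  indicator_nonneg (fun _ _ => le_max_right _ _) x

lemma isBounded_support_excess (hΩb : Bornology.IsBounded Ω) (τ y : ℝ) :
    Bornology.IsBounded (Function.support (excess Ω w τ y)) :=
  hΩb.subset support_indicator_subset

lemma excess_pos_iff {τ y : ℝ} {x : Euc N} : 0 < excess Ω w τ y x ↔ x ∈ Ω ∧ τ < w x y := by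
  by_cases hx : x ∈ Ω <;> simp [excess, hx]

lemma IsExtSol.measurable_excess (hw : IsExtSol α Ω f w) (hΩ : IsOpen Ω) (τ : ℝ) {y : ℝ}
    (hy : 0 ≤ y) : Measurable (excess Ω w τ y) :=
  measurable_indicator_of_continuousOn hΩ
    ((((hw.continuousOn_x hy).mono subset_closure).sub continuousOn_const).sup continuousOn_const)

lemma excess_le {M : ℝ} (hM : 0 ≤ M) {τ y : ℝ} (hτ : 0 ≤ τ) (hb : ∀ x ∈ Ω, |w x y| ≤ M)
    (x : Euc N) : excess Ω w τ y x ≤ M := by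
  by_cases hx : x ∈ Ω
  · rw [excess, indicator_of_mem hx]
    exact max_le (by linarith [(abs_le.1 (hb x hx)).2]) hM
  · rwa [excess, indicator_of_notMem hx]

lemma IsExtSol.excess_unif (hw : IsExtSol α Ω f w) (hΩb : Bornology.IsBounded Ω) (τ Y : ℝ) :
    ∀ η > 0, ∃ δ > 0, ∀ y ∈ Icc 0 Y, ∀ y' ∈ Icc 0 Y, dist y y' < δ → ∀ x,
      excess Ω w τ y x ≤ excess Ω w τ y' x + η := by
  intro η hη
  have hK : IsCompact (closure Ω ×ˢ Icc 0 Y) := hΩb.isCompact_closure.prod isCompact_Icc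
  obtain ⟨δ, hδ, h⟩ := Metric.uniformContinuousOn_iff.1 (hK.uniformContinuousOn_of_continuous
    (hw.continuousOn_prod.mono (prod_mono le_rfl Icc_subset_Ici_self))) η hη
  refine ⟨δ, hδ, fun y hy y' hy' hd x => ?_⟩
  by_cases hx : x ∈ Ω
  · have h1 := h (x, y) ⟨subset_closure hx, hy⟩ (x, y') ⟨subset_closure hx, hy'⟩
      (by simpa [Prod.dist_eq] using hd)
    rw [Real.dist_eq] at h1
    have h2 := (abs_lt.1 h1).2
    simp only [unc] at h2
    rw [excess, excess, indicator_of_mem hx, indicator_of_mem hx]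
    refine max_le ?_ (by linarith [le_max_right (w x y' - τ) 0])
    linarith [le_max_left (w x y' - τ) 0]
  · rw [excess, excess, indicator_of_notMem hx, indicator_of_notMem hx]
    linarith
end

section
variable {N : ℕ} {α : ℝ} {Ω : Set (Euc N)} {f g : Euc N → ℝ} {w v : Euc N → ℝ → ℝ}

lemma ballRad_pos [Nontrivial (Euc N)] (hΩ : IsOpen Ω) (hΩb : Bornology.IsBounded Ω)
    (hne : Ω.Nonempty) : 0 < ballRad Ω := by
  have h := volume_ball_ballRad hΩb.measure_lt_top.ne
  refine (ballRad_nonneg Ω).lt_of_ne fun h0 => ?_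
  rw [← h0, Metric.ball_zero, measure_empty] at h
  exact (hΩ.measure_pos volume hne).ne h

lemma nonneg_of_radialDecr [Nontrivial (Euc N)] {R : ℝ} (hR : 0 < R)
    (hv : IsExtSol α (Metric.ball 0 R) g v) (hvrad : RadialDecr v) {x : Euc N} (hx : ‖x‖ ≤ R)
    {y : ℝ} (hy : 0 ≤ y) : 0 ≤ v x y := by
  obtain ⟨z, hz⟩ := exists_norm_eq (Euc N) hR.le
  have h1 := hv.lateral z (by rw [frontier_ball _ hR.ne']; simpa using hz) y hy
  rw [← h1]
  exact hvrad y hy _ _ (hx.trans hz.ge)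

lemma isCompact_superlevel (hw : IsExtSol α Ω f w) (hΩb : Bornology.IsBounded Ω) {y τ : ℝ}
    (hy : 0 ≤ y) : IsCompact {x ∈ closure Ω | τ ≤ w x y} := by
  have : {x ∈ closure Ω | τ ≤ w x y} = closure Ω ∩ (fun x => w x y) ⁻¹' Ici τ := rfl
  rw [this]
  exact hΩb.isCompact_closure.of_isClosed_subset
    ((hw.continuousOn_x hy).preimage_isClosed_of_isClosed isClosed_closure isClosed_Ici)
    inter_subset_left

lemma superlevel_subset (hw : IsExtSol α Ω f w) (hΩ : IsOpen Ω) {y τ : ℝ}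
    (hy : 0 ≤ y) (hτ : 0 < τ) : {x ∈ closure Ω | τ ≤ w x y} ⊆ Ω := by
  rintro x ⟨hx, hx'⟩
  by_contra h
  have := hw.lateral x (by rw [hΩ.frontier_eq]; exact ⟨hx, h⟩) y hy
  linarith

lemma volume_compact_lt [Nontrivial (Euc N)] (hΩ : IsOpen Ω) (hΩb : Bornology.IsBounded Ω)
    (hne : Ω.Nonempty) {K : Set (Euc N)} (hK : IsCompact K) (hKΩ : K ⊆ Ω) :
    volume K < volume Ω := by
  have hd : (Ω \ K).Nonempty := by
    rw [sdiff_nonempty]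
    intro h
    have hEq : Ω = K := h.antisymm hKΩ
    rcases isClopen_iff.1 ⟨hEq ▸ hK.isClosed, hΩ⟩ with h | h
    · exact hne.ne_empty h
    · exact NormedSpace.unbounded_univ ℝ (Euc N) (h ▸ hΩb)
  have h1 := (hΩ.sdiff hK.isClosed).measure_pos volume hd
  rw [← measure_inter_add_sdiff Ω hK.measurableSet, inter_eq_right.2 hKΩ]
  exact ENNReal.lt_add_right hK.measure_lt_top.ne h1.ne'

lemma setIntegral_le_toReal_rearrInt {u : Euc N → ℝ} (hu : Measurable u) (hu0 : ∀ x, 0 ≤ u x)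
    {M : ℝ} (hM : ∀ x, u x ≤ M) {A : Set (Euc N)} (hAf : volume A ≠ ⊤) {G : Euc N → ℝ}
    (hA : MeasurableSet A) (hG : IntegrableOn G A) (hGu : ∀ x ∈ A, G x ≤ u x) :
    ∫ x in A, G x ≤ (rearrInt u (volume A)).toReal := by
  have hi : IntegrableOn u A := (integrableOn_const (C := M) hAf).mono' hu.aestronglyMeasurable
    (ae_of_all _ fun x => by rw [Real.norm_eq_abs, abs_of_nonneg (hu0 x)]; exact hM x)
  refine (setIntegral_mono_on hG hi hA hGu).trans ?_
  rw [← ENNReal.ofReal_le_iff_le_toReal (rearrInt_ne_top hM hAf),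
    ofReal_integral_eq_lintegral_ofReal hi (ae_of_all _ hu0)]
  exact setLIntegral_le_rearrInt hu hu0 A

/-- The difference of the rearranged integrals of `w - τ` and of the integrals of the
perturbed `v` is nonpositive. -/
lemma toReal_rearrInt_le [Nontrivial (Euc N)] (hα : α ∈ Ioo (0 : ℝ) 2) (hΩ : IsOpen Ω)
    (hΩb : Bornology.IsBounded Ω) (hne : Ω.Nonempty) (hfc : ContinuousOn f Ω)
    (hfb : ∃ M : ℝ, ∀ x ∈ Ω, |f x| ≤ M) (hw : IsExtSol α Ω f w)
    (hv : IsExtSol α (symmBall Ω) (schwarz Ω f) v) (hvrad : RadialDecr v)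
    {τ ε δ Y : ℝ} (hτ : 0 < τ) (hε : 0 < ε) (hδ : 0 < δ)
    (hdecay : ∀ x ∈ Ω, |w x Y| ≤ τ) {r y : ℝ} (hr : r ∈ Icc 0 (ballRad Ω)) (hy : y ∈ Icc 0 Y) :
    (rearrInt (excess Ω w τ y) (volume (Metric.ball (0 : Euc N) r))).toReal ≤
      (∫ x in Metric.ball (0 : Euc N) r, (v x y + ε * (ballRad Ω ^ 2 - ‖x‖ ^ 2))) +
        δ * (Y ^ α - y ^ α) := by
  have hR := ballRad_pos hΩ hΩb hne
  have hRvol := volume_ball_ballRad hΩb.measure_lt_top.ne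
  unfold symmBall at hv
  generalize ballRad Ω = R at hR hRvol hv hr ⊢
  have hω := omegaN_pos N
  have hN : N ≠ 0 := by
    rintro rfl
    exact not_subsingleton (Euc 0) inferInstance
  obtain ⟨M, hM, hb, -⟩ := hw.exists_bound hΩ
  obtain ⟨Mv, hMv, hbv, -⟩ := hv.exists_bound Metric.isOpen_ball
  have hvn : ∀ x ∈ Metric.ball (0 : Euc N) R, ∀ y, 0 ≤ y →
      ε * (R ^ 2 - ‖x‖ ^ 2) ≤ v x y + ε * (R ^ 2 - ‖x‖ ^ 2) ∧ 0 < ε * (R ^ 2 - ‖x‖ ^ 2) := by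
    intro x hx y hy
    rw [mem_ball_zero_iff] at hx
    have h1 := nonneg_of_radialDecr hR hv hvrad hx.le hy
    have h2 := pow_lt_pow_left₀ hx (norm_nonneg x) two_ne_zero
    exact ⟨by linarith, mul_pos hε (by linarith)⟩
  have hue : ∀ y ∈ Icc 0 Y, ∀ x, excess Ω w τ y x ≤ M := fun y hy x =>
    excess_le hM.le hτ.le (fun x hx => hb x (subset_closure hx) y hy.1) x
  have hum : ∀ y ∈ Icc 0 Y, Measurable (excess Ω w τ y) := fun y hy =>
    hw.measurable_excess hΩ τ hy.1
  set W : ℝ → ℝ → ℝ := fun r y =>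
    (rearrInt (excess Ω w τ y) (volume (Metric.ball (0 : Euc N) r))).toReal with hW
  set V : ℝ → ℝ → ℝ := fun r y =>
    ∫ x in Metric.ball (0 : Euc N) r, (v x y + ε * (R ^ 2 - ‖x‖ ^ 2)) with hV
  have hWc : ContinuousOn (fun p : ℝ × ℝ => W p.1 p.2) (Icc 0 R ×ˢ Icc 0 Y) :=
    continuousOn_rearrInt hM.le hum (fun y _ x => excess_nonneg τ y x)
      (fun y _ => isBounded_support_excess hΩb τ y) hue (hw.excess_unif hΩb τ Y)
  have hVc : ContinuousOn (fun p : ℝ × ℝ => V p.1 p.2) (Icc 0 R ×ˢ Icc 0 Y) :=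
    (hv.continuousOn_setIntegral_ball hR ε).mono (prod_mono le_rfl Icc_subset_Ici_self)
  have hΦc : ContinuousOn (fun p : ℝ × ℝ => W p.1 p.2 - V p.1 p.2 + δ * (p.2 ^ α - Y ^ α))
      (Icc 0 R ×ˢ Icc 0 Y) :=
    (hWc.sub hVc).add (continuousOn_const.mul
      (((Real.continuous_rpow_const hα.1.le).comp continuous_snd).continuousOn.sub
        continuousOn_const))
  obtain ⟨⟨r₀, y₀⟩, ⟨hr₀, hy₀⟩, hmax⟩ := (isCompact_Icc.prod isCompact_Icc).exists_isMaxOn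
    ⟨(r, y), ⟨hr, hy⟩⟩ hΦc
  change r₀ ∈ Icc 0 R at hr₀
  change y₀ ∈ Icc 0 Y at hy₀
  have hmax' : ∀ r ∈ Icc 0 R, ∀ y ∈ Icc 0 Y, W r y - V r y + δ * (y ^ α - Y ^ α) ≤
      W r₀ y₀ - V r₀ y₀ + δ * (y₀ ^ α - Y ^ α) := fun r hr y hy =>
    hmax (show (r, y) ∈ Icc 0 R ×ˢ Icc 0 Y from ⟨hr, hy⟩)
  suffices hle : W r₀ y₀ - V r₀ y₀ + δ * (y₀ ^ α - Y ^ α) ≤ 0 by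
    have := hmax' r hr y hy
    simp only [hW, hV] at *
    linarith
  by_contra hpos
  rw [not_le] at hpos
  have hVn : ∀ r ∈ Icc 0 R, ∀ y ∈ Icc 0 Y, 0 ≤ V r y := fun r hr y hy =>
    setIntegral_nonneg measurableSet_ball fun x hx => by
      have := hvn x (Metric.ball_subset_ball hr.2 hx) y hy.1
      linarith
  have hrp : ∀ y ∈ Icc 0 Y, δ * (y ^ α - Y ^ α) ≤ 0 := fun y hy =>
    mul_nonpos_of_nonneg_of_nonpos hδ.le
      (sub_nonpos.2 (Real.rpow_le_rpow hy.1 hy.2 hα.1.le))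
  have hr0 : 0 < r₀ := by
    refine hr₀.1.lt_of_ne fun h => ?_
    have h1 : W r₀ y₀ = 0 := by simp [hW, ← h, rearrInt_zero]
    linarith [hVn r₀ hr₀ y₀ hy₀, hrp y₀ hy₀]
  have hyY : y₀ < Y := by
    refine hy₀.2.lt_of_ne fun h => ?_
    have h1 : W r₀ y₀ = 0 := by
      have hs : {x | 0 < excess Ω w τ y₀ x} = ∅ := by
        ext x
        simp only [mem_ofPred_eq, excess_pos_iff, mem_empty_iff_false,
          iff_false, not_and, not_lt, h]
        exact fun hx => (le_abs_self _).trans (hdecay x hx)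
      have h2 := rearrInt_eq_of_ge (hum y₀ hy₀) (excess_nonneg τ y₀)
        (s := volume (Metric.ball (0 : Euc N) r₀)) (by rw [hs, measure_empty]; exact zero_le)
      simp only [hW]
      rw [h2, hs]
      simp
    linarith [hVn r₀ hr₀ y₀ hy₀, hrp y₀ hy₀]
  have hint : ∀ y, 0 ≤ y → ∀ r ∈ Icc 0 R,
      IntegrableOn (fun x => v x y + ε * (R ^ 2 - ‖x‖ ^ 2)) (Metric.ball (0 : Euc N) r) := by
    intro y hy r hr
    refine (hv.integrableOn Metric.isOpen_ball (Metric.ball_subset_ball hr.2) measurableSet_ball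
      measure_ball_lt_top.ne hy).add ?_
    exact ((by fun_prop : Continuous fun x : Euc N => ε * (R ^ 2 - ‖x‖ ^ 2)).continuousOn
      |>.integrableOn_compact (isCompact_closedBall (0 : Euc N) r)).mono_set
        Metric.ball_subset_closedBall
  set u := excess Ω w τ y₀ with hu
  have hum₀ := hum y₀ hy₀
  have hue₀ := hue y₀ hy₀
  have hu0 : ∀ x, 0 ≤ u x := excess_nonneg τ y₀
  have hS : volume (Metric.ball (0 : Euc N) r₀) ≤ volume {x | 0 < u x} := by
    by_contra hlt
    rw [not_le] at hlt
    set S : Set (Euc N) := {x | 0 < u x}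
    have hSf : volume S ≠ ⊤ := hlt.ne_top
    have hS1 := volume_ball_ballRad hSf
    have hr1 : ballRad S < r₀ := by
      by_contra h
      rw [not_lt] at h
      exact absurd (measure_mono (Metric.ball_subset_ball h)) (not_le.2 (hS1 ▸ hlt))
    have hr1' : ballRad S ∈ Icc 0 R := ⟨ballRad_nonneg S, hr1.le.trans hr₀.2⟩
    have h1 : W (ballRad S) y₀ = W r₀ y₀ := by
      simp only [hW]
      rw [rearrInt_eq_of_ge hum₀ hu0 hS1.ge, rearrInt_eq_of_ge hum₀ hu0 hlt.le]
    have h2 : V (ballRad S) y₀ < V r₀ y₀ := by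
      have hsub : Metric.ball (0 : Euc N) (ballRad S) ⊆ Metric.ball 0 r₀ :=
        Metric.ball_subset_ball hr1.le
      have h3 := setIntegral_sdiff (μ := volume) measurableSet_ball (hint y₀ hy₀.1 r₀ hr₀) hsub
      have h4 : 0 < ∫ x in Metric.ball (0 : Euc N) r₀ \ Metric.ball 0 (ballRad S),
          (v x y₀ + ε * (R ^ 2 - ‖x‖ ^ 2)) := by
        rw [setIntegral_pos_iff_support_of_nonneg_ae]
        · have : Metric.ball (0 : Euc N) r₀ \ Metric.ball 0 (ballRad S) ⊆
              (Function.support fun x => v x y₀ + ε * (R ^ 2 - ‖x‖ ^ 2)) ∩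
              (Metric.ball (0 : Euc N) r₀ \ Metric.ball 0 (ballRad S)) := by
            refine fun x hx => ⟨?_, hx⟩
            have := hvn x (Metric.ball_subset_ball hr₀.2 hx.1) y₀ hy₀.1
            exact (this.2.trans_le this.1).ne'
          refine lt_of_lt_of_le ?_ (measure_mono this)
          rw [volume_ball_sdiff_ball (ballRad_nonneg S) hr1.le, ENNReal.ofReal_pos]
          have := pow_lt_pow_left₀ hr1 (ballRad_nonneg S) hN
          nlinarith
        · refine (ae_restrict_iff' (measurableSet_ball.diff measurableSet_ball)).2
            (ae_of_all _ fun x hx => ?_)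
          have := hvn x (Metric.ball_subset_ball hr₀.2 hx.1) y₀ hy₀.1
          exact (this.2.trans_le this.1).le
        · exact (hint y₀ hy₀.1 r₀ hr₀).mono_set sdiff_subset
      simp only [hV]
      linarith
    linarith [hmax' _ hr1' y₀ hy₀]
  obtain ⟨A, hAm, hAu, hAvol, hAint⟩ := exists_setLIntegral_eq_rearrInt hum₀ hu0
    (isBounded_support_excess hΩb τ y₀) hue₀ (Metric.measure_ball_pos _ _ hr0).ne' hS
  set K : Set (Euc N) := {x ∈ closure Ω | τ ≤ w x y₀} with hKdef
  have hK : IsCompact K := isCompact_superlevel hw hΩb hy₀.1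
  have hKΩ : K ⊆ Ω := superlevel_subset hw hΩ hy₀.1 hτ
  have hAw : ∀ x ∈ A, x ∈ Ω ∧ τ < w x y₀ := fun x hx => excess_pos_iff.1 (hAu hx)
  have hAK : A ⊆ K := fun x hx => ⟨subset_closure (hAw x hx).1, (hAw x hx).2.le⟩
  have hAΩ : A ⊆ Ω := hAK.trans hKΩ
  have hAf : volume A ≠ ⊤ := (hΩb.subset hAΩ).measure_lt_top.ne
  have hrR : r₀ < R := by
    by_contra h
    rw [not_lt] at h
    have h1 := (volume_compact_lt hΩ hΩb hne hK hKΩ)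
    have h2 := measure_mono (μ := volume) (Metric.ball_subset_ball (x := (0 : Euc N)) h)
    rw [hRvol, ← hAvol] at h2
    exact absurd (h2.trans (measure_mono hAK)) (not_le.2 h1)
  have huA : ∀ x ∈ A, u x = w x y₀ - τ := fun x hx => by
    rw [hu, excess, indicator_of_mem (hAw x hx).1, max_eq_left]
    linarith [(hAw x hx).2]
  have hwu : ∀ y, ∀ x ∈ Ω, w x y - τ ≤ excess Ω w τ y x := fun y x hx => by
    rw [excess, indicator_of_mem hx]; exact le_max_left _ _
  have hiA : ∀ y, 0 ≤ y → IntegrableOn (fun x => w x y - τ) A := fun y hy =>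
    (hw.integrableOn hΩ hAΩ hAm hAf hy).sub (integrableOn_const hAf)
  have hWA : W r₀ y₀ = ∫ x in A, (w x y₀ - τ) := by
    simp only [hW]
    rw [← hu, ← hAint, integral_eq_lintegral_of_nonneg_ae]
    · exact congrArg _ (setLIntegral_congr_fun hAm fun x hx =>
        congrArg ENNReal.ofReal (huA x hx))
    · exact (ae_restrict_iff' hAm).2 (ae_of_all _ fun x hx => by
        have := (hAw x hx).2
        simp only [Pi.zero_apply]; linarith)
    · exact (hiA y₀ hy₀.1).aestronglyMeasurable
  obtain ⟨Mf, hMf⟩ := hfb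
  refine false_of_isMax_integral hα hw hv hΩ Metric.isOpen_ball hAΩ
    (Metric.ball_subset_ball hr₀.2) hAm measurableSet_ball hAf measure_ball_lt_top.ne hδ hy₀.1 hyY
    (fun y hy => ?_)
    (setIntegral_le_setIntegral_schwarz hΩ hΩb hfc hMf hAm hAΩ hAvol.symm) fun hy0 => ?_
  · have h1 := hmax' r₀ hr₀ y hy
    have h2 : ∫ x in A, (w x y - τ) ≤ W r₀ y := by
      simp only [hW]
      rw [← hAvol]
      exact setIntegral_le_toReal_rearrInt (hum y hy) (excess_nonneg τ y) (hue y hy) hAf hAm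
        (hiA y hy.1) fun x hx => hwu y x (hAΩ hx)
    have h3 : ∀ y, 0 ≤ y → ∫ x in A, (w x y - τ) = (∫ x in A, w x y) - ∫ _x in A, τ :=
      fun y hy => integral_sub (hw.integrableOn hΩ hAΩ hAm hAf hy) (integrableOn_const hAf)
    have h4 : ∀ y, 0 ≤ y → V r₀ y = (∫ x in Metric.ball (0 : Euc N) r₀, v x y) +
        ∫ x in Metric.ball (0 : Euc N) r₀, ε * (R ^ 2 - ‖x‖ ^ 2) := fun y hy =>
      integral_add (hv.integrableOn Metric.isOpen_ball (Metric.ball_subset_ball hr₀.2)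
        measurableSet_ball measure_ball_lt_top.ne hy)
        (((by fun_prop : Continuous fun x : Euc N => ε * (R ^ 2 - ‖x‖ ^ 2)).continuousOn
          |>.integrableOn_compact (isCompact_closedBall (0 : Euc N) r₀)).mono_set
          Metric.ball_subset_closedBall)
    rw [hWA, h3 y₀ hy₀.1, h4 y₀ hy₀.1, h4 y hy.1] at h1
    rw [h3 y hy.1] at h2
    linarith
  · set q : Euc N → ℝ := (Metric.ball (0 : Euc N) R).indicator
      fun x => v x y₀ + ε * (R ^ 2 - ‖x‖ ^ 2) with hq
    have hqm : Measurable q := measurable_indicator_of_continuousOn Metric.isOpen_ball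
      (((hv.continuousOn_x hy₀.1).mono subset_closure).add (by fun_prop))
    have hq0 : ∀ x, 0 ≤ q x := indicator_nonneg fun x hx =>
      ((hvn x hx y₀ hy₀.1).2.trans_le (hvn x hx y₀ hy₀.1).1).le
    have hqC : ∀ x, q x ≤ Mv + ε * R ^ 2 := by
      intro x
      by_cases hx : x ∈ Metric.ball (0 : Euc N) R
      · rw [hq, indicator_of_mem hx]
        have := (abs_le.1 (hbv x (subset_closure hx) y₀ hy₀.1)).2
        nlinarith [sq_nonneg ‖x‖]
      · rw [hq, indicator_of_notMem hx]; positivity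
    have hqi : ∀ ρ ∈ Icc 0 R, ∫⁻ x in Metric.ball (0 : Euc N) ρ, ENNReal.ofReal (q x) =
        ENNReal.ofReal (V ρ y₀) := by
      intro ρ hρ
      simp only [hV]
      rw [ofReal_integral_eq_lintegral_ofReal (hint y₀ hy₀.1 ρ hρ)]
      · refine setLIntegral_congr_fun measurableSet_ball fun x hx => ?_
        simp only [hq]
        rw [indicator_of_mem (Metric.ball_subset_ball hρ.2 hx)]
      · refine (ae_restrict_iff' measurableSet_ball).2 (ae_of_all _ fun x hx => ?_)
        have := hvn x (Metric.ball_subset_ball hρ.2 hx) y₀ hy₀.1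
        exact (this.2.trans_le this.1).le
    refine setIntegral_lapx_lt (C := M + (Mv + ε * R ^ 2)) hw hΩ hΩb hv hy0 hε hr0 hrR hAm hAK hK
      hKΩ hAvol.symm hum₀ hu0 (fun x => (hue₀ x).trans (by
        have : 0 ≤ Mv + ε * R ^ 2 := by positivity
        linarith))
      (isBounded_support_excess hΩb τ y₀) (hwu y₀) huA hqm hq0
      (fun x => (hqC x).trans (by linarith)) (fun x hx => indicator_of_mem hx _) fun ρ hρ => ?_
    have h1 := hmax' ρ hρ y₀ hy₀
    rw [hqi r₀ hr₀, hqi ρ hρ, hAint,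
      ← ENNReal.ofReal_toReal (rearrInt_ne_top hue₀ (measure_ball_lt_top (μ := volume)
        (x := (0 : Euc N)) (r := ρ)).ne),
      ← ENNReal.ofReal_toReal (rearrInt_ne_top hue₀ (measure_ball_lt_top (μ := volume)
        (x := (0 : Euc N)) (r := r₀)).ne),
      ← ENNReal.ofReal_add ENNReal.toReal_nonneg (hVn r₀ hr₀ y₀ hy₀),
      ← ENNReal.ofReal_add (hVn ρ hρ y₀ hy₀) ENNReal.toReal_nonneg]
    refine ENNReal.ofReal_le_ofReal ?_
    simp only [hW, ← hu] at h1
    linarith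
end

section
variable {N : ℕ} {α : ℝ} {Ω : Set (Euc N)} {f g : Euc N → ℝ} {w v : Euc N → ℝ → ℝ}

lemma IsExtSol.le_of_radialDecr [Nontrivial (Euc N)] (hα : α ∈ Ioo (0 : ℝ) 2) (hΩ : IsOpen Ω)
    (hΩb : Bornology.IsBounded Ω) (hne : Ω.Nonempty) (hfc : ContinuousOn f Ω)
    (hfb : ∃ M : ℝ, ∀ x ∈ Ω, |f x| ≤ M) (hw : IsExtSol α Ω f w)
    (hv : IsExtSol α (symmBall Ω) (schwarz Ω f) v) (hvrad : RadialDecr v)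
    {x₀ : Euc N} (hx₀ : x₀ ∈ Ω) {y : ℝ} (hy : 0 ≤ y) : w x₀ y ≤ v 0 y := by
  by_contra hlt
  rw [not_le] at hlt
  have hR := ballRad_pos hΩ hΩb hne
  have hv0 : 0 ≤ v 0 y := nonneg_of_radialDecr hR hv hvrad (by simpa using hR.le) hy
  obtain ⟨τ, hτ, hτw⟩ : ∃ τ > 0, w x₀ y = v 0 y + 4 * τ :=
    ⟨(w x₀ y - v 0 y) / 4, by linarith, by ring⟩
  obtain ⟨r, hr, hrR, hrΩ, hrw⟩ : ∃ r, 0 < r ∧ r ≤ ballRad Ω ∧ Metric.ball x₀ r ⊆ Ω ∧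
      ∀ x ∈ Metric.ball x₀ r, v 0 y + 3 * τ < w x y := by
    have h1 : ContinuousAt (fun x => w x y) x₀ :=
      ((hw.continuousOn_x hy).mono subset_closure).continuousAt (hΩ.mem_nhds hx₀)
    have h2 : ∀ᶠ x in nhds x₀, v 0 y + 3 * τ < w x y :=
      h1.eventually (lt_mem_nhds (by simp only [hτw]; linarith))
    obtain ⟨r, hr, hrs⟩ := Metric.eventually_nhds_iff_ball.1
      ((hΩ.eventually_mem hx₀).and h2)
    refine ⟨min r (ballRad Ω), lt_min hr hR, min_le_right _ _, fun x hx => ?_, fun x hx => ?_⟩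
    · exact (hrs x (Metric.ball_subset_ball (min_le_left _ _) hx)).1
    · exact (hrs x (Metric.ball_subset_ball (min_le_left _ _) hx)).2
  obtain ⟨Y₀, hY₀⟩ := hw.decay τ hτ
  set Y := max Y₀ y
  have hYy : y ≤ Y := le_max_right _ _
  have hY : 0 ≤ Y := hy.trans hYy
  set R := ballRad Ω
  obtain ⟨ε, hε, hεR⟩ : ∃ ε > 0, ε * R ^ 2 = τ := ⟨τ / R ^ 2, by positivity, by field_simp⟩
  set m := volume.real (Metric.ball (0 : Euc N) r) with hm
  have hmp : 0 < m := ENNReal.toReal_pos (Metric.measure_ball_pos _ _ hr).ne'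
    measure_ball_lt_top.ne
  have hvol : volume (Metric.ball x₀ r) = volume (Metric.ball (0 : Euc N) r) :=
    Measure.addHaar_ball_center _ _ _
  have hYα : 0 ≤ Y ^ α := Real.rpow_nonneg hY α
  have hyα : 0 ≤ y ^ α := Real.rpow_nonneg hy α
  obtain ⟨δ, hδ, hδY⟩ : ∃ δ > 0, δ * (Y ^ α + 1) = m * τ / 2 :=
    ⟨m * τ / 2 / (Y ^ α + 1), by positivity, by field_simp⟩
  have key := toReal_rearrInt_le hα hΩ hΩb hne hfc hfb hw hv hvrad hτ hε hδ
    (fun x hx => hY₀ Y (le_max_left _ _) x hx) (r := r) (y := y) ⟨hr.le, hrR⟩ ⟨hy, hYy⟩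
  obtain ⟨M, hM, hb, -⟩ := hw.exists_bound hΩ
  have hiw : IntegrableOn (fun x => w x y - τ) (Metric.ball x₀ r) :=
    (hw.integrableOn hΩ hrΩ measurableSet_ball measure_ball_lt_top.ne hy).sub
      (integrableOn_const measure_ball_lt_top.ne)
  have h1 := setIntegral_le_toReal_rearrInt (hw.measurable_excess hΩ τ hy) (excess_nonneg τ y)
    (excess_le hM.le hτ.le fun x hx => hb x (subset_closure hx) y hy)
    (A := Metric.ball x₀ r) measure_ball_lt_top.ne measurableSet_ball hiw fun x hx => by
      rw [excess, indicator_of_mem (hrΩ hx)]; exact le_max_left _ _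
  have h2 : m * (v 0 y + 2 * τ) ≤ ∫ x in Metric.ball x₀ r, (w x y - τ) := by
    have := setIntegral_mono_on (integrableOn_const (C := v 0 y + 2 * τ)
      (measure_ball_lt_top (μ := volume) (x := x₀) (r := r)).ne) hiw measurableSet_ball
      fun x hx => by linarith [hrw x hx]
    rwa [setIntegral_const, measureReal_def, hvol, smul_eq_mul] at this
  have hiv : IntegrableOn (fun x => v x y + ε * (R ^ 2 - ‖x‖ ^ 2)) (Metric.ball (0 : Euc N) r) :=
    (hv.integrableOn Metric.isOpen_ball (Metric.ball_subset_ball hrR) measurableSet_ball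
      measure_ball_lt_top.ne hy).add
      (((by fun_prop : Continuous fun x : Euc N => ε * (R ^ 2 - ‖x‖ ^ 2)).continuousOn
        |>.integrableOn_compact (isCompact_closedBall (0 : Euc N) r)).mono_set
          Metric.ball_subset_closedBall)
  have h3 : ∫ x in Metric.ball (0 : Euc N) r, (v x y + ε * (R ^ 2 - ‖x‖ ^ 2)) ≤
      m * (v 0 y + τ) := by
    have := setIntegral_mono_on hiv (integrableOn_const (C := v 0 y + τ)
      (measure_ball_lt_top (μ := volume) (x := (0 : Euc N)) (r := r)).ne) measurableSet_ball
      fun x _ => by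
        have := hvrad y hy 0 x (by simp)
        nlinarith [sq_nonneg ‖x‖]
    rwa [setIntegral_const, smul_eq_mul] at this
  rw [hvol] at h1
  have := h2.trans (h1.trans key)
  nlinarith [mul_pos hmp hτ, mul_nonneg hδ.le hyα]

lemma lapx_neg (w : Euc N → ℝ → ℝ) (x : Euc N) (y : ℝ) :
    lapx (fun x y => -w x y) x y = -lapx w x y := by
  simp only [lapx, deriv.fun_neg', deriv.fun_neg, Finset.sum_neg_distrib]

lemma IsExtSol.neg (hw : IsExtSol α Ω f w) :
    IsExtSol α Ω (fun x => -f x) fun x y => -w x y where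
  cont := hw.cont.neg
  bdd := by simpa only [abs_neg] using hw.bdd
  smooth := hw.smooth.neg
  derivBdd := by
    have h : (fderiv ℝ fun q : Euc N × ℝ => -w q.1 q.2) =
        fun p => -fderiv ℝ (fun q : Euc N × ℝ => w q.1 q.2) p := funext fun p => fderiv_fun_neg
    obtain ⟨M, hM⟩ := hw.derivBdd
    refine ⟨M, fun p hp => ?_⟩
    rw [h, fderiv_fun_neg]
    exact ⟨(norm_neg _).trans_le (hM p hp).1,
      (ContinuousLinearMap.opNorm_neg _).trans_le (hM p hp).2⟩
  pde x hx y hy := by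
    simp only [lapx_neg, deriv.fun_neg', deriv.fun_neg]
    linarith [hw.pde x hx y hy]
  lateral x hx y hy := by rw [hw.lateral x hx y hy, neg_zero]
  decay := by simpa only [abs_neg] using hw.decay
  neumann x hx := by
    simpa only [deriv.fun_neg, mul_neg] using (hw.neumann x hx).neg

end

/-- for every `y ≥ 0`,
`sup_{x∈Ω} |w(x,y)| ≤ sup_{x∈Ω^#} |v(x,y)| = v(0,y)`. -/
theorem sup_comparison
    {N : ℕ} (hN : 2 ≤ N) (α : ℝ) (hα : α ∈ Ioo (0 : ℝ) 2) (hαN : α < N)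
    (Ω : Set (Euc N)) (hΩo : IsOpen Ω) (hΩb : Bornology.IsBounded Ω) (hΩne : Ω.Nonempty)
    (f : Euc N → ℝ) (hfc : ContinuousOn f Ω) (hfb : ∃ M : ℝ, ∀ x ∈ Ω, |f x| ≤ M)
    (w v : Euc N → ℝ → ℝ)
    (hw : IsExtSol α Ω f w)
    (hv : IsExtSol α (symmBall Ω) (schwarz Ω f) v)
    (hvrad : RadialDecr v) :
    ∀ y : ℝ, 0 ≤ y →
      sSup ((fun x => |w x y|) '' Ω) ≤ sSup ((fun x => |v x y|) '' symmBall Ω) ∧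
      sSup ((fun x => |v x y|) '' symmBall Ω) = v 0 y := by
  intro y hy
  have : Nonempty (Fin N) := ⟨⟨0, by omega⟩⟩
  have : Nontrivial (Euc N) := inferInstance
  have hR := ballRad_pos hΩo hΩb hΩne
  have hv0 : ∀ x ∈ symmBall Ω, 0 ≤ v x y := fun x hx =>
    nonneg_of_radialDecr hR hv hvrad (mem_ball_zero_iff.1 hx).le hy
  have h0 : (0 : Euc N) ∈ symmBall Ω := Metric.mem_ball_self hR
  have hsup : IsGreatest ((fun x => |v x y|) '' symmBall Ω) (v 0 y) := by
    refine ⟨⟨0, h0, abs_of_nonneg (hv0 0 h0)⟩, ?_⟩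
    rintro _ ⟨x, hx, rfl⟩
    simp only [abs_of_nonneg (hv0 x hx)]
    exact hvrad y hy 0 x (by simp)
  refine ⟨?_, hsup.csSup_eq⟩
  rw [hsup.csSup_eq]
  refine csSup_le (hΩne.image _) ?_
  rintro _ ⟨x, hx, rfl⟩
  have hs : schwarz Ω (fun x => -f x) = schwarz Ω f := by
    funext x
    simp only [schwarz, rearr, abs_neg]
  refine abs_le'.2 ⟨hw.le_of_radialDecr hα hΩo hΩb hΩne hfc hfb hv hvrad hx hy, ?_⟩
  exact hw.neg.le_of_radialDecr hα hΩo hΩb hΩne hfc.neg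
    (by simpa only [Pi.neg_apply, abs_neg] using hfb)
    (hs ▸ hv) hvrad hx hy
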